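/- Let ω ∈ ℝ^r satisfy the Diophantine condition with constants C₀ > 0 and τ₀ ≥ r−1, and let f : ℝ^r × ℝ^s → ℝ be real analytic and 2π-periodic in each of its d = r+s variables. Let β₀ ∈ ℝ^s be such that ∇f₀(β₀) = 0 and assume that the Hessian matrix ∂²f₀(β₀) is nonsingular and has s pairwise distinct (real, possibly of mixed sign) eigenvalues. Then there exist ε̄ > 0 and a measurable set ℰ ⊆ (0, ε̄) such that: (i) for every ε ∈ ℰ there exist real-analytic functions a : ℝ^r → ℝ^r and b : ℝ^r → ℝ^s, 2π-periodic in each variable, such that for every ψ ∈ ℝ^r the curves α(t) = ψ + ωt + a(ψ + ωt) and β(t) = β₀ + b(ψ + ωt) satisfy α̈(t) = −ε ∇_α f(α(t), β(t)) and β̈(t) = −ε ∇_β f(α(t), β(t)) for all t ∈ ℝ; and (ii) Leb(ℰ ∩ (0, ε))/ε → 1 as ε → 0⁺. -/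

import Mathlib

open MeasureTheory Real Filter

namespace KAM
open scoped ENNReal NNReal ComplexConjugate
set_option linter.unusedSectionVars false
section
open scoped ENNReal ComplexConjugate
lemma hs_congr {ι : Type*} {f g : ι → ℂ} {a : ℂ} (h : HasSum f a) (e : ∀ i, g i = f i) : HasSum g a := by
  rw [show g = f from funext e]; exact h
abbrev Fn (d : Type) := ℝ → (d → ℝ) → ℂ
section basic
variable {d : Type} [Fintype d]
noncomputable def nm (ν : d → ℤ) : ℝ := ∑ k, |(ν k : ℝ)|
noncomputable def dot (ν : d → ℤ) (ψ : d → ℝ) : ℝ := ∑ k, (ν k : ℝ) * ψ k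
noncomputable def ee (ν : d → ℤ) (ψ : d → ℝ) : ℂ := Complex.exp (((dot ν ψ : ℝ) : ℂ) * Complex.I)
noncomputable def wt (ρ : ℝ) (ν : d → ℤ) : ℝ≥0∞ := ENNReal.ofReal (Real.exp (ρ * nm ν))
lemma nm_nonneg (ν : d → ℤ) : 0 ≤ nm ν := Finset.sum_nonneg fun _ _ => abs_nonneg _
lemma nm_zero : nm (0 : d → ℤ) = 0 := by simp [nm]
lemma nm_neg (ν : d → ℤ) : nm (-ν) = nm ν := by simp [nm]
lemma nm_add_le (ν η : d → ℤ) : nm (ν + η) ≤ nm ν + nm η := by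
  rw [nm, nm, nm, ← Finset.sum_add_distrib]
  exact Finset.sum_le_sum fun k _ => by push_cast [Pi.add_apply]; exact abs_add_le _ _
lemma one_le_nm {ν : d → ℤ} (h : ν ≠ 0) : 1 ≤ nm ν := by
  obtain ⟨k, hk⟩ := Function.ne_iff.mp h
  have h1 : (1 : ℝ) ≤ |(ν k : ℝ)| := by
    have := Int.one_le_abs hk
    exact_mod_cast this
  exact h1.trans (Finset.single_le_sum (f := fun k => |(ν k : ℝ)|) (fun _ _ => abs_nonneg _) (Finset.mem_univ k))
lemma dot_add (ν η : d → ℤ) (ψ : d → ℝ) : dot (ν + η) ψ = dot ν ψ + dot η ψ := by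
  simp [dot, add_mul, Finset.sum_add_distrib]
lemma dot_add_right (ν : d → ℤ) (ψ φ : d → ℝ) : dot ν (ψ + φ) = dot ν ψ + dot ν φ := by
  simp [dot, mul_add, Finset.sum_add_distrib]
lemma dot_smul_right (ν : d → ℤ) (t : ℝ) (φ : d → ℝ) : dot ν (t • φ) = t * dot ν φ := by
  simp only [dot, Finset.mul_sum, Pi.smul_apply, smul_eq_mul]
  exact Finset.sum_congr rfl fun k _ => by ring
lemma dot_neg (ν : d → ℤ) (ψ : d → ℝ) : dot (-ν) ψ = - dot ν ψ := by simp [dot]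
lemma ee_add (ν η : d → ℤ) (ψ : d → ℝ) : ee (ν + η) ψ = ee ν ψ * ee η ψ := by
  rw [ee, ee, ee, ← Complex.exp_add, dot_add]; push_cast; ring_nf
lemma ee_zero (ψ : d → ℝ) : ee 0 ψ = 1 := by simp [ee, dot]
lemma ee_norm (ν : d → ℤ) (ψ : d → ℝ) : ‖ee ν ψ‖ = 1 := Complex.norm_exp_ofReal_mul_I _
lemma ee_enorm (ν : d → ℤ) (ψ : d → ℝ) : ‖ee ν ψ‖ₑ = 1 := by
  rw [← ofReal_norm, ee_norm]; simp
lemma ee_conj (ν : d → ℤ) (ψ : d → ℝ) : conj (ee ν ψ) = ee (-ν) ψ := by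
  rw [ee, ee, ← Complex.exp_conj, dot_neg]; simp
lemma abs_dot_le (ν : d → ℤ) (ψ : d → ℝ) : |dot ν ψ| ≤ nm ν * ‖ψ‖ := by
  rw [dot, nm, Finset.sum_mul]
  refine (Finset.abs_sum_le_sum_abs _ _).trans (Finset.sum_le_sum fun k _ => ?_)
  rw [abs_mul]
  exact mul_le_mul_of_nonneg_left (norm_le_pi_norm ψ k) (abs_nonneg _)
lemma one_le_wt {ρ : ℝ} (h : 0 ≤ ρ) (ν : d → ℤ) : 1 ≤ wt ρ ν := by
  rw [wt, ← ENNReal.ofReal_one]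
  exact ENNReal.ofReal_le_ofReal (Real.one_le_exp (mul_nonneg h (nm_nonneg _)))
lemma wt_zero (ρ : ℝ) : wt ρ (0 : d → ℤ) = 1 := by simp [wt, nm_zero]
lemma wt_add_le {ρ : ℝ} (h : 0 ≤ ρ) (ν η : d → ℤ) : wt ρ (ν + η) ≤ wt ρ ν * wt ρ η := by
  rw [wt, wt, wt, ← ENNReal.ofReal_mul (Real.exp_pos _).le, ← Real.exp_add, ← mul_add]
  exact ENNReal.ofReal_le_ofReal (Real.exp_le_exp.2 (mul_le_mul_of_nonneg_left (nm_add_le _ _) h))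
lemma wt_mono {ρ ρ' : ℝ} (h : ρ' ≤ ρ) (ν : d → ℤ) : wt ρ' ν ≤ wt ρ ν :=
  ENNReal.ofReal_le_ofReal (Real.exp_le_exp.2 (mul_le_mul_of_nonneg_right h (nm_nonneg _)))
end basic
def LB (S : Set ℝ) (σ : ℝ≥0∞) (c : ℝ → ℂ) (b : ℝ≥0∞) : Prop :=
  ∃ s l : ℝ≥0∞, s + l ≤ b ∧ (∀ p ∈ S, ‖c p‖ₑ ≤ s) ∧
    ∀ p ∈ S, ∀ q ∈ S, σ * ‖c p - c q‖ₑ ≤ l * edist p q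
section LB
variable {S : Set ℝ} {σ : ℝ≥0∞}
lemma LB.mono {c : ℝ → ℂ} {b b' : ℝ≥0∞} (h : LB S σ c b) (hb : b ≤ b') : LB S σ c b' := by
  obtain ⟨s, l, h1, h2⟩ := h; exact ⟨s, l, h1.trans hb, h2⟩
lemma LB.subset {S' : Set ℝ} {c : ℝ → ℂ} {b : ℝ≥0∞} (h : LB S σ c b) (hS : S' ⊆ S) : LB S' σ c b := by
  obtain ⟨s, l, h1, h2, h3⟩ := h
  exact ⟨s, l, h1, fun p hp => h2 p (hS hp), fun p hp q hq => h3 p (hS hp) q (hS hq)⟩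
lemma LB.congr {c c' : ℝ → ℂ} {b : ℝ≥0∞} (h : LB S σ c b) (hc : ∀ p ∈ S, c' p = c p) : LB S σ c' b := by
  obtain ⟨s, l, h1, h2, h3⟩ := h
  exact ⟨s, l, h1, fun p hp => by rw [hc p hp]; exact h2 p hp,
    fun p hp q hq => by rw [hc p hp, hc q hq]; exact h3 p hp q hq⟩
lemma LB.enorm {c : ℝ → ℂ} {b : ℝ≥0∞} (h : LB S σ c b) {p : ℝ} (hp : p ∈ S) : ‖c p‖ₑ ≤ b := by
  obtain ⟨s, l, h1, h2, h3⟩ := h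
  exact (h2 p hp).trans (le_self_add.trans h1)
lemma LB.lip {c : ℝ → ℂ} {b : ℝ≥0∞} (h : LB S σ c b) {p q : ℝ} (hp : p ∈ S) (hq : q ∈ S) :
    σ * ‖c p - c q‖ₑ ≤ b * edist p q := by
  obtain ⟨s, l, h1, h2, h3⟩ := h
  exact (h3 p hp q hq).trans (mul_le_mul_left (le_add_self.trans h1) _)
lemma LB.const (z : ℂ) : LB S σ (fun _ => z) ‖z‖ₑ :=
  ⟨‖z‖ₑ, 0, by simp, fun _ _ => le_rfl, fun _ _ _ _ => by simp⟩
lemma LB.mul {c e : ℝ → ℂ} {b b' : ℝ≥0∞} (h : LB S σ c b) (h' : LB S σ e b') :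
    LB S σ (fun p => c p * e p) (b * b') := by
  obtain ⟨s, l, h1, h2, h3⟩ := h
  obtain ⟨s', l', h1', h2', h3'⟩ := h'
  refine ⟨s * s', s * l' + l * s', ?_, fun p hp => ?_, fun p hp q hq => ?_⟩
  · refine le_trans ?_ (mul_le_mul' h1 h1')
    rw [add_mul, mul_add, mul_add, ← add_assoc]
    gcongr
    exact le_self_add
  · rw [enorm_mul]; exact mul_le_mul' (h2 p hp) (h2' p hp)
  · have e1 : c p * e p - c q * e q = c p * (e p - e q) + (c p - c q) * e q := by ring
    calc σ * ‖c p * e p - c q * e q‖ₑ ≤ σ * (‖c p‖ₑ * ‖e p - e q‖ₑ + ‖c p - c q‖ₑ * ‖e q‖ₑ) := by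
          rw [e1]; gcongr; refine (enorm_add_le _ _).trans ?_; rw [enorm_mul, enorm_mul]
      _ = ‖c p‖ₑ * (σ * ‖e p - e q‖ₑ) + (σ * ‖c p - c q‖ₑ) * ‖e q‖ₑ := by ring
      _ ≤ s * (l' * edist p q) + (l * edist p q) * s' := by
          exact add_le_add (mul_le_mul' (h2 p hp) (h3' p hp q hq)) (mul_le_mul' (h3 p hp q hq) (h2' q hq))
      _ = _ := by ring
lemma LB.tsum {ι : Type*} {c : ι → ℝ → ℂ} {b : ι → ℝ≥0∞} {C : ℝ → ℂ}
    (h : ∀ i, LB S σ (c i) (b i)) (hC : ∀ p ∈ S, HasSum (fun i => c i p) (C p)) :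
    LB S σ C (∑' i, b i) := by
  choose s l h1 h2 h3 using h
  refine ⟨∑' i, s i, ∑' i, l i, ?_, fun p hp => ?_, fun p hp q hq => ?_⟩
  · rw [← ENNReal.tsum_add]; exact ENNReal.tsum_le_tsum h1
  · rw [← (hC p hp).tsum_eq]
    exact enorm_tsum_le_tsum_enorm.trans (ENNReal.tsum_le_tsum fun i => h2 i p hp)
  · rw [← ((hC p hp).sub (hC q hq)).tsum_eq, ← ENNReal.tsum_mul_right]
    refine (mul_le_mul_right enorm_tsum_le_tsum_enorm _).trans ?_
    rw [← ENNReal.tsum_mul_left]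
    exact ENNReal.tsum_le_tsum fun i => h3 i p hp q hq
lemma LB.conj {c : ℝ → ℂ} {b : ℝ≥0∞} (h : LB S σ c b) : LB S σ (fun p => conj (c p)) b := by
  obtain ⟨s, l, h1, h2, h3⟩ := h
  have e : ∀ z : ℂ, ‖(starRingEnd ℂ) z‖ₑ = ‖z‖ₑ := fun z => by
    rw [← ofReal_norm, ← ofReal_norm, Complex.norm_conj]
  refine ⟨s, l, h1, fun p hp => by rw [e]; exact h2 p hp, fun p hp q hq => ?_⟩
  rw [← map_sub, e]; exact h3 p hp q hq
lemma LB.add {c e : ℝ → ℂ} {b b' : ℝ≥0∞} (h : LB S σ c b) (h' : LB S σ e b') :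
    LB S σ (fun p => c p + e p) (b + b') := by
  obtain ⟨s, l, h1, h2, h3⟩ := h
  obtain ⟨s', l', h1', h2', h3'⟩ := h'
  refine ⟨s + s', l + l', ?_, fun p hp => ?_, fun p hp q hq => ?_⟩
  · rw [add_add_add_comm]; gcongr
  · exact (enorm_add_le _ _).trans (add_le_add (h2 p hp) (h2' p hp))
  · have e1 : c p + e p - (c q + e q) = (c p - c q) + (e p - e q) := by ring
    rw [e1, add_mul]
    refine (mul_le_mul_right (enorm_add_le _ _) _).trans ?_
    rw [mul_add]
    exact add_le_add (h3 p hp q hq) (h3' p hp q hq)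
lemma LB.neg {c : ℝ → ℂ} {b : ℝ≥0∞} (h : LB S σ c b) : LB S σ (fun p => - c p) b := by
  have := (LB.const (S := S) (σ := σ) (-1)).mul h
  simpa using this
lemma LB.sub {c e : ℝ → ℂ} {b b' : ℝ≥0∞} (h : LB S σ c b) (h' : LB S σ e b') :
    LB S σ (fun p => c p - e p) (b + b') := by
  simpa [sub_eq_add_neg] using h.add h'.neg
lemma LB.inv {c : ℝ → ℂ} {b T : ℝ≥0∞} (h : LB S σ c b) (hT : ∀ p ∈ S, c p ≠ 0 ∧ ‖(c p)⁻¹‖ₑ ≤ T) :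
    LB S σ (fun p => (c p)⁻¹) (T + b * T ^ 2) := by
  refine ⟨T, b * T ^ 2, le_rfl, fun p hp => (hT p hp).2, fun p hp q hq => ?_⟩
  have e1 : (c p)⁻¹ - (c q)⁻¹ = (c q - c p) * ((c p)⁻¹ * (c q)⁻¹) := by
    have := (hT p hp).1; have := (hT q hq).1
    field_simp
  rw [e1, enorm_mul, enorm_mul, ← mul_assoc]
  calc σ * ‖c q - c p‖ₑ * (‖(c p)⁻¹‖ₑ * ‖(c q)⁻¹‖ₑ) ≤ (b * edist q p) * (T * T) := by
        exact mul_le_mul' (h.lip hq hp) (mul_le_mul' (hT p hp).2 (hT q hq).2)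
    _ = _ := by rw [edist_comm]; ring
end LB
section Bd
variable {d : Type} [Fintype d] {S : Set ℝ} {σ : ℝ≥0∞} {ρ : ℝ}
def Rep (S : Set ℝ) (u : Fn d) (c : (d → ℤ) → ℝ → ℂ) : Prop :=
  ∀ p ∈ S, ∀ ψ, HasSum (fun ν => c ν p * ee ν ψ) (u p ψ)
def Bd (S : Set ℝ) (σ : ℝ≥0∞) (ρ : ℝ) (u : Fn d) (B : ℝ) : Prop :=
  0 ≤ ρ ∧ ∃ (c : (d → ℤ) → ℝ → ℂ) (b : (d → ℤ) → ℝ≥0∞), Rep S u c ∧ (∀ ν, LB S σ (c ν) (b ν)) ∧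
    ∑' ν, b ν * wt ρ ν ≤ ENNReal.ofReal B
variable {u v : Fn d} {A B : ℝ}
lemma Bd.mono (h : Bd S σ ρ u A) (hB : A ≤ B) : Bd S σ ρ u B := by
  obtain ⟨h0, c, b, h1, h2, h3⟩ := h
  exact ⟨h0, c, b, h1, h2, h3.trans (ENNReal.ofReal_le_ofReal hB)⟩
lemma Bd.rho {ρ' : ℝ} (h : Bd S σ ρ u A) (h0' : 0 ≤ ρ') (hB : ρ' ≤ ρ) : Bd S σ ρ' u A := by
  obtain ⟨h0, c, b, h1, h2, h3⟩ := h
  exact ⟨h0', c, b, h1, h2, (ENNReal.tsum_le_tsum fun ν => by gcongr; exact wt_mono hB ν).trans h3⟩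
lemma Bd.subset {S' : Set ℝ} (h : Bd S σ ρ u A) (hS : S' ⊆ S) : Bd S' σ ρ u A := by
  obtain ⟨h0, c, b, h1, h2, h3⟩ := h
  exact ⟨h0, c, b, fun p hp => h1 p (hS hp), fun ν => (h2 ν).subset hS, h3⟩
lemma Bd.congr (h : Bd S σ ρ u A) (hv : ∀ p ∈ S, ∀ ψ, v p ψ = u p ψ) : Bd S σ ρ v A := by
  obtain ⟨h0, c, b, h1, h2, h3⟩ := h
  exact ⟨h0, c, b, fun p hp ψ => by rw [hv p hp ψ]; exact h1 p hp ψ, h2, h3⟩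
lemma Bd.of_mono (hρ : 0 ≤ ρ) {c : ℝ → ℂ} {b : ℝ≥0∞} (h : LB S σ c b) (ν : d → ℤ)
    (hB : b * wt ρ ν ≤ ENNReal.ofReal B) : Bd S σ ρ (fun p ψ => c p * ee ν ψ) B := by
  classical
  refine ⟨hρ, fun η p => if η = ν then c p else 0, fun η => if η = ν then b else 0, fun p hp ψ => ?_,
    fun η => ?_, ?_⟩
  · convert hasSum_ite_eq ν (c p * ee ν ψ) using 2 with η
    split_ifs with h1 <;> simp [h1]
  · by_cases h1 : η = ν
    · simpa [h1] using h
    · simpa [h1] using (LB.const (S := S) (σ := σ) 0)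
  · rw [tsum_eq_single ν]
    · simpa using hB
    · intro η h1; simp [h1]
lemma Bd.of_LB (hρ : 0 ≤ ρ) {c : ℝ → ℂ} (h : LB S σ c (ENNReal.ofReal B)) :
    Bd S σ ρ (fun p (_ : d → ℝ) => c p) B := by
  have := Bd.of_mono hρ h (0 : d → ℤ) (by rw [wt_zero, mul_one])
  simpa [ee_zero] using this
lemma Bd.const (hρ : 0 ≤ ρ) (z : ℂ) : Bd S σ ρ (fun _ (_ : d → ℝ) => z) ‖z‖ :=
  Bd.of_LB hρ (by rw [ofReal_norm]; exact LB.const z)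
lemma Bd.zero (hρ : 0 ≤ ρ) : Bd S σ ρ (fun _ (_ : d → ℝ) => 0) 0 := by
  simpa using Bd.const (d := d) (S := S) (σ := σ) hρ 0
lemma Bd.ee (hρ : 0 ≤ ρ) (ν : d → ℤ) : Bd S σ ρ (fun _ ψ => ee ν ψ) (Real.exp (ρ * nm ν)) := by
  have := Bd.of_mono (B := Real.exp (ρ * nm ν)) hρ (LB.const (S := S) (σ := σ) 1) ν (by simp [wt])
  simpa using this
lemma Bd.tsum {ι : Type*} {w : ι → Fn d} {C : ι → ℝ} (hρ : 0 ≤ ρ)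
    (h : ∀ i, Bd S σ ρ (w i) (C i)) (hu : ∀ p ∈ S, ∀ ψ, HasSum (fun i => w i p ψ) (u p ψ))
    (hB : ∑' i, ENNReal.ofReal (C i) ≤ ENNReal.ofReal B) : Bd S σ ρ u B := by
  choose h0 c b h1 h2 h3 using h
  have key : ∑' i, ∑' ν, b i ν * wt ρ ν ≤ ENNReal.ofReal B := (ENNReal.tsum_le_tsum h3).trans hB
  have key' : ∑' i, ∑' ν, b i ν ≤ ENNReal.ofReal B := by
    refine le_trans (ENNReal.tsum_le_tsum fun i => ENNReal.tsum_le_tsum fun ν => ?_) key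
    exact le_mul_of_one_le_right' (one_le_wt hρ ν)
  have sumF : ∀ p ∈ S, ∀ ψ : d → ℝ, Summable (fun x : ι × (d → ℤ) => c x.1 x.2 p * KAM.ee x.2 ψ) := by
    intro p hp ψ
    have hs : ∑' x : ι × (d → ℤ), ‖c x.1 x.2 p * KAM.ee x.2 ψ‖ₑ ≠ ⊤ := by
      refine ne_top_of_le_ne_top (b := ENNReal.ofReal B) ENNReal.ofReal_ne_top ?_
      rw [ENNReal.tsum_prod']
      refine le_trans (ENNReal.tsum_le_tsum fun i => ENNReal.tsum_le_tsum fun ν => ?_) key'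
      rw [enorm_mul, ee_enorm, mul_one]
      exact (h2 i ν).enorm hp
    exact Summable.of_enorm hs
  have sumc : ∀ p ∈ S, ∀ ν, Summable fun i => c i ν p := by
    intro p hp ν
    have := (sumF p hp 0).comp_injective (i := fun i : ι => (i, ν)) (fun a b hab => by simpa using hab)
    refine this.congr fun i => ?_
    simp [KAM.ee, dot]
  refine ⟨hρ, fun ν p => ∑' i, c i ν p, fun ν => ∑' i, b i ν, fun p hp ψ => ?_, fun ν => ?_, ?_⟩
  · have H := (sumF p hp ψ).hasSum
    have e1 : u p ψ = ∑' x : ι × (d → ℤ), c x.1 x.2 p * KAM.ee x.2 ψ :=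
      (hu p hp ψ).unique (H.prod_fiberwise fun i => h1 i p hp ψ)
    rw [e1]
    have H2 : HasSum (fun x : (d → ℤ) × ι => c x.2 x.1 p * KAM.ee x.1 ψ)
        (∑' x : ι × (d → ℤ), c x.1 x.2 p * KAM.ee x.2 ψ) :=
      (Equiv.prodComm (d → ℤ) ι).hasSum_iff.mpr H
    exact HasSum.prod_fiberwise (g := fun ν => (∑' i, c i ν p) * KAM.ee ν ψ) H2
      fun ν => ((sumc p hp ν).hasSum).mul_right (KAM.ee ν ψ)
  · exact LB.tsum (fun i => h2 i ν) fun p hp => (sumc p hp ν).hasSum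
  · refine le_trans (le_of_eq ?_) key
    rw [ENNReal.tsum_comm]
    exact tsum_congr fun ν => ENNReal.tsum_mul_right.symm
lemma Bd.fsum {ι : Type*} (s : Finset ι) {w : ι → Fn d} {C : ι → ℝ} (hρ : 0 ≤ ρ)
    (hC : ∀ i, 0 ≤ C i) (h : ∀ i, Bd S σ ρ (w i) (C i)) :
    Bd S σ ρ (fun p ψ => ∑ i ∈ s, w i p ψ) (∑ i ∈ s, C i) := by
  refine Bd.tsum (ι := s) (w := fun i => w i) (C := fun i => C i) hρ (fun i => h i) (fun p _ ψ => ?_) ?_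
  · rw [← Finset.sum_coe_sort]; exact hasSum_fintype _
  · rw [tsum_fintype, Finset.sum_coe_sort s (fun i => ENNReal.ofReal (C i)),
      ENNReal.ofReal_sum_of_nonneg fun i _ => hC i]
lemma Bd.add (h : Bd S σ ρ u A) (h' : Bd S σ ρ v B) (hA : 0 ≤ A) (hB : 0 ≤ B) :
    Bd S σ ρ (fun p ψ => u p ψ + v p ψ) (A + B) := by
  have := Bd.fsum (S := S) (σ := σ) (Finset.univ : Finset Bool) (w := fun i => if i then u else v)
    (C := fun i => if i then A else B) h.1 (by rintro (_|_) <;> simpa) (by rintro (_|_) <;> simpa)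
  simpa using this
lemma Bd.mono_mul (h : Bd S σ ρ v B) {c : ℝ → ℂ} {b : ℝ≥0∞} (hc : LB S σ c b) (ν : d → ℤ)
    (hA : b * wt ρ ν ≤ ENNReal.ofReal A) (hA0 : 0 ≤ A) :
    Bd S σ ρ (fun p ψ => c p * KAM.ee ν ψ * v p ψ) (A * B) := by
  obtain ⟨h0, e, b', h1, h2, h3⟩ := h
  refine ⟨h0, fun η p => c p * e (η - ν) p, fun η => b * b' (η - ν), fun p hp ψ => ?_,
    fun η => hc.mul (h2 _), ?_⟩
  · have := ((Equiv.subRight ν).hasSum_iff.mpr (h1 p hp ψ)).mul_left (c p * KAM.ee ν ψ)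
    refine hs_congr this fun η => ?_
    have : KAM.ee η ψ = KAM.ee ν ψ * KAM.ee (η - ν) ψ := by rw [← ee_add]; congr 1; abel
    simp only [Function.comp, Equiv.subRight_apply]
    rw [this]; ring
  · rw [ENNReal.ofReal_mul hA0]
    refine le_trans ?_ (mul_le_mul' hA h3)
    rw [← ENNReal.tsum_mul_left, ← (Equiv.subRight ν).tsum_eq (fun η => b * wt ρ ν * (b' η * wt ρ η))]
    refine ENNReal.tsum_le_tsum fun η => ?_
    have : wt ρ η ≤ wt ρ ν * wt ρ (η - ν) := by
      conv_lhs => rw [show η = ν + (η - ν) by abel]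
      exact wt_add_le h0 _ _
    calc b * b' (η - ν) * wt ρ η ≤ b * b' (η - ν) * (wt ρ ν * wt ρ (η - ν)) := by gcongr
      _ = _ := by simp only [Equiv.subRight_apply]; ring
lemma Bd.mul (h : Bd S σ ρ u A) (h' : Bd S σ ρ v B) (hA : 0 ≤ A) :
    Bd S σ ρ (fun p ψ => u p ψ * v p ψ) (A * B) := by
  obtain ⟨h0, c, b, h1, h2, h3⟩ := h
  have hfin : ∀ ν, b ν * wt ρ ν ≠ ⊤ := fun ν =>
    ne_top_of_le_ne_top ENNReal.ofReal_ne_top ((ENNReal.le_tsum ν).trans h3)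
  refine Bd.tsum (w := fun ν p ψ => c ν p * KAM.ee ν ψ * v p ψ)
    (C := fun ν => (b ν * wt ρ ν).toReal * B) h0 (fun ν => ?_) (fun p hp ψ => (h1 p hp ψ).mul_right _) ?_
  · exact h'.mono_mul (h2 ν) ν (by rw [ENNReal.ofReal_toReal (hfin ν)]) ENNReal.toReal_nonneg
  · rw [ENNReal.ofReal_mul hA]
    refine le_trans (le_of_eq ?_) (mul_le_mul_left h3 _)
    rw [← ENNReal.tsum_mul_right]
    exact tsum_congr fun ν => by
      rw [ENNReal.ofReal_mul ENNReal.toReal_nonneg, ENNReal.ofReal_toReal (hfin ν)]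
lemma Bd.smul (h : Bd S σ ρ u A) (z : ℂ) : Bd S σ ρ (fun p ψ => z * u p ψ) (‖z‖ * A) :=
  (Bd.const h.1 z).mul h (norm_nonneg z)
lemma Bd.neg (h : Bd S σ ρ u A) : Bd S σ ρ (fun p ψ => - u p ψ) A := by
  simpa using h.smul (-1)
lemma Bd.conj (h : Bd S σ ρ u A) : Bd S σ ρ (fun p ψ => conj (u p ψ)) A := by
  obtain ⟨h0, c, b, h1, h2, h3⟩ := h
  refine ⟨h0, fun ν p => conj (c (-ν) p), fun ν => b (-ν), fun p hp ψ => ?_, fun ν => (h2 _).conj, ?_⟩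
  · have := (Complex.hasSum_conj'.mpr (h1 p hp ψ))
    rw [← (Equiv.neg (d → ℤ)).hasSum_iff] at this
    convert this using 2 with ν
    simp [ee_conj]
  · rw [← (Equiv.neg (d → ℤ)).tsum_eq] at h3
    refine le_trans (le_of_eq (tsum_congr fun ν => ?_)) h3
    simp [wt, nm_neg]
lemma Bd.norm_le (h : Bd S σ ρ u A) (hA : 0 ≤ A) {p : ℝ} (hp : p ∈ S) (ψ : d → ℝ) : ‖u p ψ‖ ≤ A := by
  obtain ⟨h0, c, b, h1, h2, h3⟩ := h
  rw [← ENNReal.ofReal_le_ofReal_iff hA, ofReal_norm, ← (h1 p hp ψ).tsum_eq]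
  refine le_trans (enorm_tsum_le_tsum_enorm.trans (ENNReal.tsum_le_tsum fun ν => ?_)) h3
  rw [enorm_mul, ee_enorm, mul_one]
  exact ((h2 ν).enorm hp).trans (le_mul_of_one_le_right' (one_le_wt h0 ν))
end Bd
end
section
open scoped ENNReal ComplexConjugate
section ex
variable {d : Type} [Fintype d] {S : Set ℝ} {σ : ℝ≥0∞} {ρ : ℝ} {u v : Fn d} {A B : ℝ}
lemma Bd.pow (h : Bd S σ ρ u B) (hB : 0 ≤ B) (n : ℕ) : Bd S σ ρ (fun p ψ => u p ψ ^ n) (B ^ n) := by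
  induction n with
  | zero => simpa using Bd.const (d := d) (S := S) (σ := σ) h.1 1
  | succ n ih => simpa [pow_succ] using ih.mul h (pow_nonneg hB n)
lemma Bd.exp_tail (h : Bd S σ ρ u B) (hB : 0 ≤ B) (k : ℕ) :
    Bd S σ ρ (fun p ψ => Complex.exp (u p ψ) - ∑ i ∈ Finset.range k, u p ψ ^ i / (i.factorial : ℂ))
      (Real.exp B - ∑ i ∈ Finset.range k, B ^ i / (i.factorial : ℝ)) := by
  have hR : HasSum (fun n => B ^ (n + k) / ((n + k).factorial : ℝ))
      (Real.exp B - ∑ i ∈ Finset.range k, B ^ i / (i.factorial : ℝ)) := by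
    rw [hasSum_nat_add_iff' (f := fun n => B ^ n / (n.factorial : ℝ)) k]
    have := NormedSpace.expSeries_div_hasSum_exp (𝔸 := ℝ) B
    rwa [← Real.exp_eq_exp_ℝ] at this
  refine Bd.tsum (w := fun n p ψ => ((n + k).factorial : ℂ)⁻¹ * u p ψ ^ (n + k))
    (C := fun n => B ^ (n + k) / ((n + k).factorial : ℝ)) h.1 (fun n => ?_) (fun p _ ψ => ?_) ?_
  · have := (h.pow hB (n + k)).smul ((n + k).factorial : ℂ)⁻¹
    refine this.mono (le_of_eq ?_)
    rw [norm_inv, Complex.norm_natCast]; ring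
  · have := NormedSpace.expSeries_div_hasSum_exp (𝔸 := ℂ) (u p ψ)
    rw [← Complex.exp_eq_exp_ℂ] at this
    rw [← hasSum_nat_add_iff' (f := fun n => u p ψ ^ n / (n.factorial : ℂ)) k] at this
    exact hs_congr this fun n => by rw [div_eq_inv_mul]
  · rw [← ENNReal.ofReal_tsum_of_nonneg (fun n => by positivity) hR.summable, hR.tsum_eq]
lemma Bd.exp (h : Bd S σ ρ u B) (hB : 0 ≤ B) : Bd S σ ρ (fun p ψ => Complex.exp (u p ψ)) (Real.exp B) := by
  simpa using h.exp_tail hB 0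
lemma exp_aux {B : ℝ} (hB : 0 ≤ B) : Real.exp B - 1 ≤ B * Real.exp B ∧ Real.exp B - 1 - B ≤ B ^ 2 * Real.exp B := by
  have h1 : 1 - B ≤ Real.exp (-B) := by linarith [Real.add_one_le_exp (-B)]
  have h2 : Real.exp (-B) * Real.exp B = 1 := by rw [← Real.exp_add]; simp
  have h3 := Real.exp_pos B
  have h4 : (1 - B) * Real.exp B ≤ 1 := by nlinarith
  have h5 : Real.exp B - 1 ≤ B * Real.exp B := by nlinarith
  refine ⟨h5, ?_⟩
  nlinarith [mul_le_mul_of_nonneg_left h5 hB]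
lemma Bd.exp1 (h : Bd S σ ρ u B) (hB : 0 ≤ B) :
    Bd S σ ρ (fun p ψ => Complex.exp (u p ψ) - 1) (B * Real.exp B) := by
  have := h.exp_tail hB 1
  simp only [Finset.sum_range_one, pow_zero, Nat.factorial_zero, Nat.cast_one, div_one] at this
  exact this.mono (exp_aux hB).1
lemma Bd.exp2 (h : Bd S σ ρ u B) (hB : 0 ≤ B) :
    Bd S σ ρ (fun p ψ => Complex.exp (u p ψ) - 1 - u p ψ) (B ^ 2 * Real.exp B) := by
  have := h.exp_tail hB 2
  simp only [Finset.sum_range_succ, Finset.sum_range_zero, pow_zero, Nat.factorial_zero, Nat.factorial_one,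
    Nat.cast_one, div_one, zero_add, pow_one] at this
  refine Bd.congr (this.mono ?_) fun p _ ψ => by ring
  have := (exp_aux hB).2
  linarith
end ex
section coef
variable {d : Type} [Fintype d] {S : Set ℝ} {σ : ℝ≥0∞} {ρ : ℝ} {u v : Fn d} {A B : ℝ}
noncomputable def mean (u : Fn d) (p : ℝ) : ℂ :=
  (((2 * π) ^ Fintype.card d : ℝ) : ℂ)⁻¹ * ∫ ψ in Set.univ.pi fun _ : d => Set.Icc (0 : ℝ) (2 * π), u p ψ
noncomputable def coef (u : Fn d) (ν : d → ℤ) (p : ℝ) : ℂ := mean (fun p ψ => u p ψ * ee (-ν) ψ) p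
lemma box_vol : (volume.restrict (Set.univ.pi fun _ : d => Set.Icc (0 : ℝ) (2 * π))) =
    Measure.pi fun _ : d => volume.restrict (Set.Icc (0 : ℝ) (2 * π)) := by
  rw [volume_pi, Measure.restrict_pi_pi]
lemma ee_prod (ν : d → ℤ) (ψ : d → ℝ) : ee ν ψ = ∏ k, Complex.exp (((ν k : ℝ) : ℂ) * (ψ k : ℂ) * Complex.I) := by
  rw [← Complex.exp_sum, ee, dot, ← Finset.sum_mul]; push_cast; rfl
lemma int_one (n : ℤ) : ∫ t in Set.Icc (0 : ℝ) (2 * π), Complex.exp (((n : ℝ) : ℂ) * (t : ℂ) * Complex.I) =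
    if n = 0 then ((2 * π : ℝ) : ℂ) else 0 := by
  rw [integral_Icc_eq_integral_Ioc, ← intervalIntegral.integral_of_le (by positivity)]
  split_ifs with h
  · simp [h]
  · have hn : ((n : ℝ) : ℂ) * Complex.I ≠ 0 := by simp [h]
    have := integral_exp_mul_complex (a := 0) (b := 2 * π) hn
    simp only [mul_right_comm _ _ Complex.I]
    rw [this]
    have : Complex.exp (((n : ℝ) : ℂ) * Complex.I * ((2 * π : ℝ) : ℂ)) = 1 := by
      rw [Complex.exp_eq_one_iff]; exact ⟨n, by push_cast; ring⟩
    rw [this]; simp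
lemma mean_ee (ν : d → ℤ) (p : ℝ) : mean (fun _ ψ => ee ν ψ) p = if ν = 0 then 1 else 0 := by
  rw [mean, box_vol]
  simp_rw [ee_prod]
  rw [integral_fintype_prod_eq_prod (f := fun k (t : ℝ) => Complex.exp (((ν k : ℝ) : ℂ) * (t : ℂ) * Complex.I))]
  simp_rw [int_one]
  split_ifs with h
  · simp only [h, Pi.zero_apply, if_true, Finset.prod_const, Finset.card_univ]
    rw [← Complex.ofReal_pow, inv_mul_cancel₀]
    exact_mod_cast (by positivity : (2 * π) ^ Fintype.card d ≠ 0)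
  · obtain ⟨k, hk⟩ := Function.ne_iff.mp h
    rw [Finset.prod_eq_zero (Finset.mem_univ k), mul_zero]
    simp only [Pi.zero_apply] at hk
    simp [hk]
instance : IsFiniteMeasure (volume.restrict (Set.univ.pi fun _ : d => Set.Icc (0 : ℝ) (2 * π))) := by
  rw [box_vol]; infer_instance
lemma cont_ee (ν : d → ℤ) : Continuous fun ψ => ee ν ψ := by
  unfold ee dot; fun_prop
lemma rep_mean {c : (d → ℤ) → ℝ → ℂ} {p : ℝ} (hp : p ∈ S) (h : Rep S u c) (hs : Summable fun ν => ‖c ν p‖) :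
    mean u p = c 0 p := by
  have h1 := hasSum_integral_of_summable_integral_norm
    (μ := volume.restrict (Set.univ.pi fun _ : d => Set.Icc (0 : ℝ) (2 * π)))
    (F := fun ν ψ => c ν p * ee ν ψ) (fun ν => ?_) ?_
  · have h2 := h1.mul_left ((((2 * π) ^ Fintype.card d : ℝ) : ℂ)⁻¹)
    have h3 : mean u p = (((2 * π) ^ Fintype.card d : ℝ) : ℂ)⁻¹ *
      ∫ ψ in Set.univ.pi fun _ : d => Set.Icc (0 : ℝ) (2 * π), ∑' ν, c ν p * ee ν ψ := by
      rw [mean]; congr 2; funext ψ; exact (h p hp ψ).tsum_eq.symm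
    rw [← h3] at h2
    refine h2.unique ?_
    have : ∀ ν : d → ℤ, (((2 * π) ^ Fintype.card d : ℝ) : ℂ)⁻¹ *
        ∫ ψ in Set.univ.pi fun _ : d => Set.Icc (0 : ℝ) (2 * π), c ν p * ee ν ψ = if ν = 0 then c 0 p else 0 := by
      intro ν
      rw [integral_const_mul, mul_left_comm]
      have := mean_ee ν p
      rw [mean] at this; rw [this]; split_ifs with h0 <;> simp [h0]
    exact hs_congr (hasSum_ite_eq 0 (c 0 p)) fun ν => by rw [this ν]
  · refine Integrable.of_bound ((continuous_const.mul (cont_ee ν)).aestronglyMeasurable) ‖c ν p‖ ?_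
    exact Eventually.of_forall fun ψ => by rw [norm_mul, ee_norm, mul_one]
  · simp only [norm_mul, ee_norm, mul_one, integral_const, smul_eq_mul]
    exact hs.mul_left _
lemma rep_coef {c : (d → ℤ) → ℝ → ℂ} {p : ℝ} (hp : p ∈ S) (h : Rep S u c) (hs : Summable fun ν => ‖c ν p‖)
    (ν : d → ℤ) : coef u ν p = c ν p := by
  have := rep_mean (S := S) (u := fun p ψ => u p ψ * ee (-ν) ψ) (c := fun η p => c (η + ν) p) hp
    (fun q hq ψ => ?_) ?_
  · rw [coef, this, zero_add]
  · have := ((Equiv.addRight ν).hasSum_iff.mpr (h q hq ψ)).mul_right (ee (-ν) ψ)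
    refine hs_congr this fun η => ?_
    simp only [Function.comp, Equiv.coe_addRight]
    rw [mul_assoc, ← ee_add]; congr 2; abel
  · exact ((Equiv.addRight ν).summable_iff (f := fun η => ‖c η p‖)).mpr hs
lemma Bd.spec (h : Bd S σ ρ u B) : 0 ≤ ρ ∧ Rep S u (coef u) ∧ (∀ p ∈ S, Summable fun ν => ‖coef u ν p‖) ∧
    ∃ b : (d → ℤ) → ℝ≥0∞, (∀ ν, LB S σ (coef u ν) (b ν)) ∧ ∑' ν, b ν * wt ρ ν ≤ ENNReal.ofReal B := by
  obtain ⟨h0, c, b, h1, h2, h3⟩ := h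
  have hs : ∀ p ∈ S, Summable fun ν => ‖c ν p‖ := by
    intro p hp
    have : ∑' ν, ‖c ν p‖ₑ ≠ ⊤ := by
      refine ne_top_of_le_ne_top (b := ENNReal.ofReal B) ENNReal.ofReal_ne_top (le_trans ?_ h3)
      exact ENNReal.tsum_le_tsum fun ν => ((h2 ν).enorm hp).trans (le_mul_of_one_le_right' (one_le_wt h0 ν))
    exact summable_norm_iff.mpr (Summable.of_enorm this)
  have e : ∀ ν, ∀ p ∈ S, coef u ν p = c ν p := fun ν p hp => rep_coef hp h1 (hs p hp) ν
  refine ⟨h0, fun p hp ψ => hs_congr (h1 p hp ψ) fun ν => by rw [e ν p hp], fun p hp => ?_, b,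
    fun ν => (h2 ν).congr (e ν), h3⟩
  exact (hs p hp).congr fun ν => by rw [e ν p hp]
lemma Bd.ext (h : Bd S σ ρ u A) {ρ' : ℝ} {σ' : ℝ≥0∞} (h' : Bd S σ' ρ' v B) {p : ℝ} (hp : p ∈ S)
    (e : ∀ ν, coef u ν p = coef v ν p) (ψ : d → ℝ) : u p ψ = v p ψ := by
  refine (h.spec.2.1 p hp ψ).unique (hs_congr (h'.spec.2.1 p hp ψ) fun ν => by rw [e])
lemma coef_zero (u : Fn d) (p : ℝ) : coef u 0 p = mean u p := by
  simp [coef, ee_zero]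
lemma coef_add (h : Bd S σ ρ u A) {ρ' : ℝ} {σ' : ℝ≥0∞} (h' : Bd S σ' ρ' v B) {p : ℝ} (hp : p ∈ S) (ν : d → ℤ) :
    coef (fun p ψ => u p ψ + v p ψ) ν p = coef u ν p + coef v ν p := by
  refine rep_coef (S := {p}) (c := fun ν p => coef u ν p + coef v ν p) rfl ?_ ?_ ν
  · intro q hq ψ
    have e : q = p := hq
    rw [e]
    exact hs_congr ((h.spec.2.1 p hp ψ).add (h'.spec.2.1 p hp ψ)) fun ν => by ring
  · refine Summable.of_nonneg_of_le (fun _ => norm_nonneg _) (fun ν => norm_add_le _ _) ((h.spec.2.2.1 p hp).add (h'.spec.2.2.1 p hp))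
lemma coef_smul (c : ℝ → ℂ) (u : Fn d) (p : ℝ) (ν : d → ℤ) :
    coef (fun p ψ => c p * u p ψ) ν p = c p * coef u ν p := by
  simp only [coef, mean]
  simp only [mul_assoc]
  rw [integral_const_mul, mul_left_comm]
lemma coef_congr {p : ℝ} (h : ∀ ψ, u p ψ = v p ψ) (ν : d → ℤ) : coef u ν p = coef v ν p := by
  simp only [coef, mean, h]
lemma mean_congr {p : ℝ} (h : ∀ ψ, u p ψ = v p ψ) : mean u p = mean v p := by
  simp only [mean, h]
lemma coef_const (c : ℝ → ℂ) (p : ℝ) (ν : d → ℤ) :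
    coef (fun p (_ : d → ℝ) => c p) ν p = if ν = 0 then c p else 0 := by
  classical
  have := coef_smul c (fun _ (_ : d → ℝ) => 1) p ν
  simp only [mul_one] at this
  rw [this, coef]; simp only [one_mul]
  rw [mean_ee]; simp
lemma mean_add (h : Bd S σ ρ u A) {ρ' : ℝ} {σ' : ℝ≥0∞} (h' : Bd S σ' ρ' v B) {p : ℝ} (hp : p ∈ S) :
    mean (fun p ψ => u p ψ + v p ψ) p = mean u p + mean v p := by
  simpa [coef_zero] using coef_add h h' hp 0
lemma mean_smul (c : ℝ → ℂ) (u : Fn d) (p : ℝ) : mean (fun p ψ => c p * u p ψ) p = c p * mean u p := by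
  simpa [coef_zero] using coef_smul c u p 0
lemma mean_const (c : ℝ → ℂ) (p : ℝ) : mean (fun p (_ : d → ℝ) => c p) p = c p := by
  simpa [coef_zero] using coef_const (d := d) c p 0
lemma Bd.mean (h : Bd S σ ρ u A) : LB S σ (mean u) (ENNReal.ofReal A) := by
  obtain ⟨h0, -, -, b, hb, hA⟩ := h.spec
  have := (hb 0).mono (le_trans (le_trans (by rw [wt_zero, mul_one]) (ENNReal.le_tsum 0)) hA)
  exact this.congr fun p _ => (coef_zero u p).symm
lemma Bd.mult (h : Bd S σ ρ u B) {m : (d → ℤ) → ℝ → ℂ} {t : (d → ℤ) → ℝ} {K δ : ℝ} (hδ : δ ≤ ρ)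
    (hm : ∀ ν, LB S σ (m ν) (ENNReal.ofReal (t ν))) (ht : ∀ ν, t ν ≤ K * Real.exp (δ * nm ν)) (hK : 0 ≤ K) :
    ∃ v : Fn d, Bd S σ (ρ - δ) v (K * B) ∧ Rep S v (fun ν p => m ν p * coef u ν p) ∧
      ∀ p ∈ S, ∀ ν, coef v ν p = m ν p * coef u ν p := by
  obtain ⟨h0, -, -, b, hb, hB⟩ := h.spec
  have key : ∑' ν, ENNReal.ofReal (t ν) * b ν * wt (ρ - δ) ν ≤ ENNReal.ofReal (K * B) := by
    rw [ENNReal.ofReal_mul hK]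
    refine le_trans ?_ (mul_le_mul' le_rfl hB)
    rw [← ENNReal.tsum_mul_left]
    refine ENNReal.tsum_le_tsum fun ν => ?_
    have : ENNReal.ofReal (t ν) * wt (ρ - δ) ν ≤ ENNReal.ofReal K * wt ρ ν := by
      rw [wt, wt, ← ENNReal.ofReal_mul hK, ← ENNReal.ofReal_mul' (Real.exp_pos _).le]
      refine ENNReal.ofReal_le_ofReal ?_
      refine (mul_le_mul_of_nonneg_right (ht ν) (Real.exp_pos _).le).trans (le_of_eq ?_)
      rw [mul_assoc, ← Real.exp_add]; congr 2; ring
    calc _ = b ν * (ENNReal.ofReal (t ν) * wt (ρ - δ) ν) := by ring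
      _ ≤ b ν * (ENNReal.ofReal K * wt ρ ν) := by gcongr
      _ = _ := by ring
  have hl : ∀ ν, LB S σ (fun p => m ν p * coef u ν p) (ENNReal.ofReal (t ν) * b ν) := fun ν => (hm ν).mul (hb ν)
  have hs : ∀ p ∈ S, Summable fun ν => ‖m ν p * coef u ν p‖ := by
    intro p hp
    have : ∑' ν, ‖m ν p * coef u ν p‖ₑ ≠ ⊤ := by
      refine ne_top_of_le_ne_top (b := ENNReal.ofReal (K * B)) ENNReal.ofReal_ne_top (le_trans ?_ key)
      exact ENNReal.tsum_le_tsum fun ν => ((hl ν).enorm hp).trans (le_mul_of_one_le_right' (one_le_wt (by linarith) ν))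
    exact summable_norm_iff.mpr (Summable.of_enorm this)
  have hR : Rep S (fun p ψ => ∑' ν, m ν p * coef u ν p * KAM.ee ν ψ) (fun ν p => m ν p * coef u ν p) := by
    intro p hp ψ
    refine Summable.hasSum (Summable.of_norm ?_)
    simpa only [norm_mul, ee_norm, mul_one] using hs p hp
  exact ⟨_, ⟨by linarith, _, _, hR, hl, key⟩, hR, fun p hp ν => rep_coef hp hR (hs p hp) ν⟩
end coef
end
section
open scoped ENNReal ComplexConjugate
section dv
variable {d : Type} {S : Set ℝ} {σ : ℝ≥0∞} {ρ : ℝ} {u v : Fn d} {A B : ℝ}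
noncomputable def dv (v : d → ℝ) (u : Fn d) : Fn d := fun p ψ => deriv (fun t : ℝ => u p (ψ + t • v)) 0
def Dif (u : Fn d) (p : ℝ) : Prop := ∀ ψ v : d → ℝ, DifferentiableAt ℝ (fun t : ℝ => u p (ψ + t • v)) 0
lemma Dif.add {p : ℝ} (h : Dif u p) (h' : Dif v p) : Dif (fun p ψ => u p ψ + v p ψ) p :=
  fun ψ w => (h ψ w).add (h' ψ w)
lemma Dif.mul {p : ℝ} (h : Dif u p) (h' : Dif v p) : Dif (fun p ψ => u p ψ * v p ψ) p :=
  fun ψ w => (h ψ w).mul (h' ψ w)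
lemma Dif.const (c : ℝ → ℂ) (p : ℝ) : Dif (fun p (_ : d → ℝ) => c p) p := fun _ _ => differentiableAt_const _
lemma dv_add {p : ℝ} (h : Dif u p) (h' : Dif v p) (w ψ : d → ℝ) :
    dv w (fun p ψ => u p ψ + v p ψ) p ψ = dv w u p ψ + dv w v p ψ := deriv_fun_add (h ψ w) (h' ψ w)
lemma dv_mul {p : ℝ} (h : Dif u p) (h' : Dif v p) (w ψ : d → ℝ) :
    dv w (fun p ψ => u p ψ * v p ψ) p ψ = dv w u p ψ * v p ψ + u p ψ * dv w v p ψ := by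
  have := deriv_fun_mul (h ψ w) (h' ψ w)
  simpa [dv] using this
lemma dv_const (c : ℝ → ℂ) (p : ℝ) (w ψ : d → ℝ) : dv w (fun p (_ : d → ℝ) => c p) p ψ = 0 := by simp [dv]
lemma dv_smul (c : ℝ → ℂ) (u : Fn d) (p : ℝ) (w ψ : d → ℝ) :
    dv w (fun p ψ => c p * u p ψ) p ψ = c p * dv w u p ψ := by simp [dv]
lemma dv_sum {ι : Type*} (s : Finset ι) {w : ι → Fn d} {p : ℝ} (h : ∀ i, Dif (w i) p) (v ψ : d → ℝ) :
    dv v (fun p ψ => ∑ i ∈ s, w i p ψ) p ψ = ∑ i ∈ s, dv v (w i) p ψ := deriv_fun_sum fun i _ => h i ψ v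
lemma dv_congr {p : ℝ} (h : ∀ ψ, u p ψ = v p ψ) (w ψ : d → ℝ) : dv w u p ψ = dv w v p ψ := by simp [dv, h]
variable [Fintype d]
lemma nm_le_exp {δ : ℝ} (hδ : 0 < δ) (ν : d → ℤ) : nm ν ≤ 1 / δ * Real.exp (δ * nm ν) := by
  rw [div_mul_eq_mul_div, one_mul, le_div_iff₀ hδ]
  linarith [Real.add_one_le_exp (δ * nm ν)]
lemma LB_dot (v : d → ℝ) (ν : d → ℤ) : LB S σ (fun _ => Complex.I * dot ν v) (ENNReal.ofReal (nm ν * ‖v‖)) := by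
  refine (LB.const _).mono ?_
  rw [← ofReal_norm, norm_mul, Complex.norm_I, one_mul, Complex.norm_real]
  exact ENNReal.ofReal_le_ofReal (abs_dot_le ν v)
lemma nm_dot_le {δ : ℝ} (hδ : 0 < δ) (v : d → ℝ) (ν : d → ℤ) : nm ν * ‖v‖ ≤ ‖v‖ / δ * Real.exp (δ * nm ν) := by
  have := mul_le_mul_of_nonneg_right (nm_le_exp hδ ν) (norm_nonneg v)
  calc nm ν * ‖v‖ ≤ _ := this
    _ = _ := by ring
lemma Bd.deriv_aux (h : Bd S σ ρ u B) (hρ : 0 < ρ) {p : ℝ} (hp : p ∈ S) (ψ v : d → ℝ) :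
    HasDerivAt (fun t : ℝ => u p (ψ + t • v)) (dv v u p ψ) 0 ∧
      HasSum (fun ν => Complex.I * dot ν v * coef u ν p * KAM.ee ν ψ) (dv v u p ψ) := by
  obtain ⟨w, hw, hR, -⟩ := h.mult (m := fun ν _ => Complex.I * dot ν v) (t := fun ν => nm ν * ‖v‖) (K := ‖v‖ / ρ)
    (δ := ρ) le_rfl (LB_dot v) (nm_dot_le hρ v) (by positivity)
  · have hsum : Summable fun ν => ‖Complex.I * dot ν v * coef u ν p‖ := by
      have := (hR p hp 0).summable.norm
      simpa only [norm_mul, ee_norm, mul_one] using this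
    have hd : ∀ (ν : d → ℤ) (t : ℝ), HasDerivAt (fun t : ℝ => coef u ν p * KAM.ee ν (ψ + t • v))
        (Complex.I * dot ν v * coef u ν p * KAM.ee ν (ψ + t • v)) t := by
      intro ν t
      have h1 : HasDerivAt (fun t : ℝ => ((dot ν (ψ + t • v) : ℝ) : ℂ) * Complex.I) (dot ν v * Complex.I) t := by
        refine HasDerivAt.mul_const ?_ _
        refine HasDerivAt.ofReal_comp ?_
        simp only [dot_add_right, dot_smul_right]
        simpa using ((hasDerivAt_id t).mul_const (dot ν v)).const_add (dot ν ψ)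
      have := (h1.cexp).const_mul (coef u ν p)
      refine this.congr_deriv ?_
      rw [KAM.ee]; ring
    have := hasDerivAt_tsum hsum (hd) (fun ν t => by rw [norm_mul _ (KAM.ee _ _), ee_norm, mul_one])
      (y₀ := 0) (h.spec.2.1 p hp _).summable 0
    have e : (fun z : ℝ => ∑' ν, coef u ν p * KAM.ee ν (ψ + z • v)) = fun z : ℝ => u p (ψ + z • v) := by
      funext z; exact (h.spec.2.1 p hp _).tsum_eq
    rw [e] at this
    simp only [zero_smul, add_zero] at this
    have e2 : dv v u p ψ = _ := this.deriv
    rw [e2]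
    exact ⟨this, (hR p hp ψ).summable.hasSum⟩
lemma Bd.dif (h : Bd S σ ρ u B) (hρ : 0 < ρ) {p : ℝ} (hp : p ∈ S) : Dif u p :=
  fun ψ v => (h.deriv_aux hρ hp ψ v).1.differentiableAt
lemma Bd.dv (h : Bd S σ ρ u B) {δ : ℝ} (hδ : 0 < δ) (hδρ : δ ≤ ρ) (v : d → ℝ) :
    Bd S σ (ρ - δ) (dv v u) (‖v‖ / δ * B) := by
  obtain ⟨w, hw, hR, -⟩ := h.mult (m := fun ν _ => Complex.I * dot ν v) (t := fun ν => nm ν * ‖v‖) (K := ‖v‖ / δ)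
    (δ := δ) hδρ (LB_dot v) (nm_dot_le hδ v) (by positivity)
  exact hw.congr fun p hp ψ => (h.deriv_aux (hδ.trans_le hδρ) hp ψ v).2.unique (hR p hp ψ)
lemma Bd.coef_dv (h : Bd S σ ρ u B) (hρ : 0 < ρ) {p : ℝ} (hp : p ∈ S) (v : d → ℝ) (ν : d → ℤ) :
    coef (KAM.dv v u) ν p = Complex.I * dot ν v * coef u ν p := by
  refine rep_coef (S := {p}) (c := fun ν p => Complex.I * dot ν v * coef u ν p) rfl ?_ ?_ ν
  · intro q hq ψ
    have e : q = p := hq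
    rw [e]
    exact (h.deriv_aux hρ hp ψ v).2
  · have := (h.deriv_aux hρ hp 0 v).2.summable.norm
    simpa only [norm_mul _ (KAM.ee _ _), ee_norm, mul_one] using this
lemma Bd.mean_dv (h : Bd S σ ρ u B) (hρ : 0 < ρ) {p : ℝ} (hp : p ∈ S) (v : d → ℝ) :
    KAM.mean (KAM.dv v u) p = 0 := by
  rw [← coef_zero, h.coef_dv hρ hp]; simp [dot]
lemma Bd.dv_comm (h : Bd S σ ρ u B) (hρ : 0 < ρ) {p : ℝ} (hp : p ∈ S) (v w ψ : d → ℝ) :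
    KAM.dv v (KAM.dv w u) p ψ = KAM.dv w (KAM.dv v u) p ψ := by
  have h2 : 0 < ρ / 2 := by linarith
  have a1 := h.dv h2 (by linarith) v
  have a2 := h.dv h2 (by linarith) w
  have h3 : 0 < ρ - ρ / 2 := by linarith
  refine (a2.dv h3 le_rfl v).ext (a1.dv h3 le_rfl w) hp (fun ν => ?_) ψ
  rw [a1.coef_dv h3 hp, a2.coef_dv h3 hp, h.coef_dv hρ hp, h.coef_dv hρ hp]; ring
end dv
section neumann
variable {d : Type} [Fintype d] {S : Set ℝ} {σ : ℝ≥0∞} {ρ : ℝ} {ι : Type} [Fintype ι] [DecidableEq ι]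
lemma neumann (A : ι → ι → Fn d) {η : ℝ} (hη : 0 ≤ η) (hN : Fintype.card ι * η ≤ 1 / 2) (hρ : 0 ≤ ρ)
    (h : ∀ i j, Bd S σ ρ (fun p ψ => A i j p ψ - if i = j then 1 else 0) η) :
    ∃ W : ι → ι → Fn d, (∀ i j, Bd S σ ρ (fun p ψ => W i j p ψ - if i = j then 1 else 0) (2 * η)) ∧
      ∀ p ∈ S, ∀ ψ, (Matrix.of fun i j => A i j p ψ) * (Matrix.of fun i j => W i j p ψ) = 1 := by
  classical
  obtain ⟨N, hNd⟩ : ∃ N : ℝ, N = Fintype.card ι := ⟨_, rfl⟩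
  rw [← hNd] at hN
  have hN0 : 0 ≤ N := hNd ▸ Nat.cast_nonneg _
  let R : ℝ → (d → ℝ) → Matrix ι ι ℂ := fun p ψ => 1 - Matrix.of fun i j => A i j p ψ
  have hR : ∀ i j, Bd S σ ρ (fun p ψ => R p ψ i j) η := fun i j => (h i j).neg.congr fun p _ ψ => by
    simp only [R, Matrix.sub_apply, Matrix.of_apply, Matrix.one_apply]; ring
  have hpow : ∀ n : ℕ, ∀ i j, Bd S σ ρ (fun p ψ => (R p ψ ^ (n + 1)) i j) ((1 / 2) ^ n * η) := by
    intro n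
    induction n with
    | zero => intro i j; simpa using hR i j
    | succ n ih =>
      intro i j
      have := Bd.fsum (S := S) (σ := σ) Finset.univ (w := fun k p ψ => (R p ψ) i k * (R p ψ ^ (n + 1)) k j)
        (C := fun _ => η * ((1 / 2) ^ n * η)) hρ (fun _ => by positivity) (fun k => (hR i k).mul (ih k j) hη)
      refine Bd.congr (this.mono ?_) fun p _ ψ => by rw [pow_succ', Matrix.mul_apply]
      rw [Finset.sum_const, Finset.card_univ, nsmul_eq_mul, ← hNd, pow_succ]
      have : 0 ≤ (1 / 2 : ℝ) ^ n * η := by positivity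
      nlinarith
  have hgeo : HasSum (fun n : ℕ => (1 / 2 : ℝ) ^ n * η) (2 * η) := hasSum_geometric_two.mul_right η
  have hs : ∀ p ∈ S, ∀ ψ i j, Summable fun n => (R p ψ ^ (n + 1)) i j := fun p hp ψ i j =>
    Summable.of_norm_bounded hgeo.summable fun n => (hpow n i j).norm_le (by positivity) hp ψ
  let Z : ℝ → (d → ℝ) → Matrix ι ι ℂ := fun p ψ => Matrix.of fun i j => ∑' n, (R p ψ ^ (n + 1)) i j
  refine ⟨fun i j p ψ => (1 + Z p ψ) i j, fun i j => ?_, fun p hp ψ => ?_⟩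
  · refine Bd.tsum (w := fun n p ψ => (R p ψ ^ (n + 1)) i j) (C := fun n => (1 / 2) ^ n * η) hρ
      (fun n => hpow n i j) (fun p hp ψ => ?_) ?_
    · have : ((1 + Z p ψ) i j - if i = j then 1 else 0) = ∑' n, (R p ψ ^ (n + 1)) i j := by
        simp [Z, Matrix.add_apply, Matrix.one_apply]
      rw [this]; exact (hs p hp ψ i j).hasSum
    · rw [← ENNReal.ofReal_tsum_of_nonneg (fun n => by positivity) hgeo.summable, hgeo.tsum_eq]
  · have hZ : Z p ψ = R p ψ + R p ψ * Z p ψ := by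
      ext i j
      rw [Matrix.add_apply, Matrix.mul_apply]
      have e1 : Z p ψ i j = ∑' n, (R p ψ ^ (n + 1)) i j := rfl
      rw [e1, (hs p hp ψ i j).tsum_eq_zero_add]
      congr 1
      · simp
      · have : ∀ n, (R p ψ ^ (n + 1 + 1)) i j = ∑ k, R p ψ i k * (R p ψ ^ (n + 1)) k j := fun n => by
          rw [pow_succ' _ (n + 1), Matrix.mul_apply]
        simp_rw [this]
        rw [Summable.tsum_finsetSum fun k _ => (hs p hp ψ k j).mul_left _]
        exact Finset.sum_congr rfl fun k _ => tsum_mul_left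
    have e2 : (Matrix.of fun i j => A i j p ψ) = 1 - R p ψ := by simp [R]
    have e3 : (Matrix.of fun i j => (1 + Z p ψ) i j) = 1 + Z p ψ := rfl
    rw [e2, e3]
    clear_value R Z
    have : (1 - R p ψ) * (1 + Z p ψ) = 1 + (Z p ψ - (R p ψ + R p ψ * Z p ψ)) := by noncomm_ring
    rw [this, ← hZ]; simp
end neumann
section solve
variable {d : Type} [Fintype d] {S : Set ℝ} {σ : ℝ≥0∞} {ρ : ℝ} {u g : Fn d} {A B : ℝ}
noncomputable def DD (κ : ℝ → ℝ) (ω : d → ℝ) (u : Fn d) : Fn d := fun p ψ => ((κ p : ℝ) : ℂ)⁻¹ * dv ω u p ψ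
def NR (S : Set ℝ) (κ : ℝ → ℝ) (ω : d → ℝ) (γ : ℝ) (τ : ℕ) (m : ℝ → ℂ) : Prop :=
  ∀ p ∈ S, ∀ ν : d → ℤ, ν ≠ 0 → γ ≤ ‖Complex.I * dot ν ω + κ p * m p‖ * nm ν ^ τ
lemma mult_LB {κ : ℝ → ℝ} {ω : d → ℝ} {γ X Y : ℝ} {τ : ℕ} {m : ℝ → ℂ} (hnr : NR S κ ω γ τ m) (hγ : 0 < γ)
    (hX : 1 ≤ X) (hγX : 1 / γ ≤ X) (hω : ‖ω‖ ≤ X) (hY : 0 ≤ Y) (hκ : LB S σ (fun p => (κ p : ℂ)) (ENNReal.ofReal Y))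
    (hY1 : Y ≤ 1)
    (hm : LB S σ m (ENNReal.ofReal X)) (ν : d → ℤ) (hν : ν ≠ 0) :
    LB S σ (fun p => (κ p : ℂ) * (Complex.I * dot ν ω + κ p * m p)⁻¹)
      (ENNReal.ofReal (Y * (3 * X ^ 3 * nm ν ^ (2 * τ + 1)))) := by
  have hn := one_le_nm hν
  have hn0 : 0 < nm ν := by linarith
  have h1 : LB S σ (fun p => Complex.I * dot ν ω + κ p * m p) (ENNReal.ofReal (2 * X * nm ν)) := by
    refine ((LB.const _).add (hκ.mul hm)).mono ?_
    rw [← ofReal_norm, ← ENNReal.ofReal_mul hY, ← ENNReal.ofReal_add (by positivity) (by positivity)]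
    refine ENNReal.ofReal_le_ofReal ?_
    rw [norm_mul, Complex.norm_I, one_mul, Complex.norm_real]
    have h2 := abs_dot_le ν ω
    have h3 : nm ν * ‖ω‖ ≤ nm ν * X := mul_le_mul_of_nonneg_left hω hn0.le
    have h4 : ‖dot ν ω‖ = |dot ν ω| := rfl
    nlinarith
  have h2 := h1.inv (T := ENNReal.ofReal (X * nm ν ^ τ)) (fun p hp => ?_)
  · refine (hκ.mul h2).mono ?_
    rw [ENNReal.ofReal_mul hY, ← ENNReal.ofReal_pow (by positivity), ← ENNReal.ofReal_mul (by positivity),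
      ← ENNReal.ofReal_add (by positivity) (by positivity)]
    refine mul_le_mul' le_rfl (ENNReal.ofReal_le_ofReal ?_)
    have e1 : X * nm ν ^ τ ≤ X ^ 3 * nm ν ^ (2 * τ + 1) :=
      mul_le_mul (by simpa using pow_le_pow_right₀ hX (show 1 ≤ 3 by norm_num)) (pow_le_pow_right₀ hn (by omega)) (by positivity) (by positivity)
    calc _ ≤ X ^ 3 * nm ν ^ (2 * τ + 1) + 2 * X * nm ν * (X * nm ν ^ τ) ^ 2 := by gcongr
      _ = _ := by ring
  · have h3 := hnr p hp ν hν
    have h4 : 0 < ‖Complex.I * dot ν ω + κ p * m p‖ := by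
      rcases (norm_nonneg (Complex.I * dot ν ω + κ p * m p)).eq_or_lt with h | h
      · rw [← h] at h3; linarith
      · exact h
    refine ⟨norm_pos_iff.mp h4, ?_⟩
    rw [← ofReal_norm, norm_inv]
    refine ENNReal.ofReal_le_ofReal ?_
    have h5 : 1 ≤ X * γ := by rwa [div_le_iff₀ hγ] at hγX
    rw [inv_le_iff_one_le_mul₀ h4]
    calc 1 ≤ X * γ := h5
      _ ≤ X * (‖Complex.I * dot ν ω + κ p * m p‖ * nm ν ^ τ) := by gcongr
      _ = _ := by ring
lemma solve_aux {κ : ℝ → ℝ} {ω : d → ℝ} {γ X Y δ : ℝ} {τ : ℕ} {m : ℝ → ℂ} (hnr : NR S κ ω γ τ m) (hγ : 0 < γ)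
    (hX : 3 ≤ X) (hγX : 1 / γ ≤ X) (hω : ‖ω‖ ≤ X) (hY : 0 ≤ Y) (hκ : LB S σ (fun p => (κ p : ℂ)) (ENNReal.ofReal Y))
    (hY1 : Y ≤ 1) (hm : LB S σ m (ENNReal.ofReal X)) (hδ : 0 < δ) (hδX : 1 / δ ≤ X) (hδρ : δ ≤ ρ)
    (hτ : ((2 * τ + 1).factorial : ℝ) ≤ X) (hg : Bd S σ ρ g B) :
    ∃ v : Fn d, Bd S σ (ρ - δ) v (Y * X ^ (2 * τ + 6) * B) ∧
      ∀ p ∈ S, ∀ ν, coef v ν p = if ν = 0 then 0 else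
        (κ p : ℂ) * (Complex.I * dot ν ω + κ p * m p)⁻¹ * coef g ν p := by
  classical
  suffices h : (∀ ν, LB S σ (fun p => if ν = 0 then 0 else (κ p : ℂ) * (Complex.I * dot ν ω + κ p * m p)⁻¹)
      (ENNReal.ofReal (if ν = 0 then 0 else Y * (3 * X ^ 3 * nm ν ^ (2 * τ + 1))))) ∧
      ∀ ν : d → ℤ, (if ν = 0 then 0 else Y * (3 * X ^ 3 * nm ν ^ (2 * τ + 1))) ≤
        Y * X ^ (2 * τ + 6) * Real.exp (δ * nm ν) by
    obtain ⟨v, hv, -, hc⟩ := hg.mult hδρ h.1 h.2 (by positivity)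
    refine ⟨v, hv, fun p hp ν => ?_⟩
    rw [hc p hp ν]; split_ifs <;> simp
  refine ⟨fun ν => ?_, fun ν => ?_⟩
  · by_cases h : ν = 0
    · simpa [h] using LB.const (S := S) (σ := σ) 0
    · simpa [h] using mult_LB hnr hγ (by linarith) hγX hω hY hκ hY1 hm ν h
  · split_ifs with h
    · positivity
    · rw [mul_assoc Y]
      refine mul_le_mul_of_nonneg_left ?_ hY
      have h1 := Real.pow_div_factorial_le_exp (δ * nm ν) (mul_nonneg hδ.le (nm_nonneg ν)) (2 * τ + 1)
      rw [div_le_iff₀ (by positivity)] at h1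
      have h2 : nm ν ≤ X * (δ * nm ν) := by
        have : 1 ≤ X * δ := by rwa [div_le_iff₀ hδ] at hδX
        nlinarith [nm_nonneg ν]
      have h3 := Real.exp_pos (δ * nm ν)
      calc 3 * X ^ 3 * nm ν ^ (2 * τ + 1) ≤ X * X ^ 3 * (X * (δ * nm ν)) ^ (2 * τ + 1) := by
            have hn0 := nm_nonneg ν; gcongr
        _ = X ^ (2 * τ + 5) * (δ * nm ν) ^ (2 * τ + 1) := by ring
        _ ≤ X ^ (2 * τ + 5) * (Real.exp (δ * nm ν) * X) := by
            refine mul_le_mul_of_nonneg_left (h1.trans ?_) (by positivity)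
            exact mul_le_mul_of_nonneg_left hτ h3.le
        _ = _ := by ring
end solve
end
section
structure Cx (T : Type) [Fintype T] where
  S : Set ℝ
  σ : ℝ≥0∞
  ρ : ℝ
  δ : ℝ
  X : ℝ
  γ : ℝ
  τ : ℕ
  N : ℕ
  κ : ℝ → ℝ
  ω : T → ℝ
  hδ : 0 < δ
  hρ : 21 * δ ≤ ρ
  hXδ : 1 / δ ≤ X
  hX : 3 ≤ X
  hγ : 0 < γ
  hγX : 1 / γ ≤ X
  hω : ‖ω‖ ≤ X
  hτ : ((2 * τ + 1).factorial : ℝ) ≤ X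
  hN : (N : ℝ) ≤ X
  hκ : LB S σ (fun p => (κ p : ℂ)) (ENNReal.ofReal 1)
  κpos : ∀ p ∈ S, 0 < κ p
namespace Cx
variable {T : Type} [Fintype T] (c : Cx T)
def O (j : ℕ) (u : Fn T) (k : ℕ) (e : ℝ≥0) : Prop := Bd c.S c.σ (c.ρ - j * c.δ) u (c.X ^ k * e)
variable {c} {j k k' : ℕ} {e e' : ℝ≥0} {u v g : Fn T}
lemma X1 : 1 ≤ c.X := by linarith [c.hX]
lemma X0 : 0 ≤ c.X := by linarith [c.hX]
lemma Xk0 : 0 ≤ c.X ^ k * e := mul_nonneg (pow_nonneg X0 _) e.2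
lemma lev {j : ℕ} (hj : j ≤ 20) : c.δ ≤ c.ρ - j * c.δ := by
  have : (j : ℝ) ≤ 20 := by exact_mod_cast hj
  nlinarith [c.hδ, c.hρ]
lemma lev0 {j : ℕ} (hj : j ≤ 20) : 0 < c.ρ - j * c.δ := c.hδ.trans_le (lev hj)
lemma O.up {j' : ℕ} (h : c.O j u k e) (h' : j ≤ j' ∧ j' ≤ 20 ∧ k ≤ k' := by omega) : c.O j' u k' e := by
  refine (Bd.rho (ρ' := c.ρ - j' * c.δ) h (lev0 h'.2.1).le ?_).mono ?_
  · have : (j : ℝ) ≤ j' := by exact_mod_cast h'.1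
    nlinarith [c.hδ]
  · exact mul_le_mul_of_nonneg_right (pow_le_pow_right₀ X1 h'.2.2) e.2
lemma O.congr (h : c.O j u k e) (h' : ∀ p ∈ c.S, ∀ ψ, v p ψ = u p ψ) : c.O j v k e := Bd.congr h h'
lemma O.mul (h : c.O j u k e) (h' : c.O j v k' e') : c.O j (fun p ψ => u p ψ * v p ψ) (k + k') (e * e') := by
  refine (Bd.mul h h' Xk0).mono (le_of_eq ?_)
  push_cast; ring
lemma O.mulr (h : c.O j u k e) (h' : c.O j v k' 1) : c.O j (fun p ψ => u p ψ * v p ψ) (k + k') e := by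
  simpa using h.mul h'
lemma O.mull (h : c.O j u k 1) (h' : c.O j v k' e) : c.O j (fun p ψ => u p ψ * v p ψ) (k + k') e := by
  simpa using h.mul h'
lemma O.neg (h : c.O j u k e) : c.O j (fun p ψ => - u p ψ) k e := Bd.neg h
lemma O.add (h : c.O j u k e) (h' : c.O j v k e) : c.O j (fun p ψ => u p ψ + v p ψ) (k + 1) e := by
  refine (Bd.add h h' Xk0 Xk0).mono ?_
  have : 0 ≤ c.X ^ k * e := Xk0
  have := c.hX
  rw [pow_succ]; nlinarith
lemma O.sub (h : c.O j u k e) (h' : c.O j v k e) : c.O j (fun p ψ => u p ψ - v p ψ) (k + 1) e := by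
  simpa [sub_eq_add_neg] using h.add h'.neg
lemma O.sum {ι : Type} [Fintype ι] (hι : Fintype.card ι ≤ c.N) {w : ι → Fn T} (h : ∀ i, c.O j (w i) k e)
    (hj : j ≤ 20 := by omega) : c.O j (fun p ψ => ∑ i, w i p ψ) (k + 1) e := by
  refine (Bd.fsum Finset.univ (lev0 hj).le (C := fun _ => c.X ^ k * e) (fun _ => Xk0) h).mono ?_
  rw [Finset.sum_const, Finset.card_univ, nsmul_eq_mul, pow_succ]
  have : (Fintype.card ι : ℝ) ≤ c.X := le_trans (by exact_mod_cast hι) c.hN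
  have h2 : 0 ≤ c.X ^ k * e := Xk0
  nlinarith
lemma O.conj (h : c.O j u k e) : c.O j (fun p ψ => conj (u p ψ)) k e := Bd.conj h
lemma O.re (h : c.O j u k e) : c.O j (fun p ψ => ((u p ψ).re : ℂ)) k e := by
  have := (Bd.add h h.conj Xk0 Xk0).smul (1 / 2)
  refine Bd.congr (this.mono (le_of_eq ?_)) fun p _ ψ => ?_
  · norm_num; ring
  · rw [Complex.add_conj]; push_cast; ring
lemma O.of_LB {f : ℝ → ℂ} (h : LB c.S c.σ f (ENNReal.ofReal (c.X ^ k * e))) (hj : j ≤ 20 := by omega) :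
    c.O j (fun p _ => f p) k e := Bd.of_LB (lev0 hj).le h
lemma O.mean (h : c.O j u k e) : LB c.S c.σ (KAM.mean u) (ENNReal.ofReal (c.X ^ k * e)) := Bd.mean h
lemma O.zero (hj : j ≤ 20 := by omega) : c.O j (fun _ _ => 0) k e :=
  (Bd.zero (lev0 hj).le).mono Xk0
lemma O.dif (h : c.O j u k e) {p : ℝ} (hp : p ∈ c.S) (hj : j ≤ 20 := by omega) : Dif u p := Bd.dif h (lev0 hj) hp
lemma O.dv (h : c.O j u k e) {w : T → ℝ} (hw : ‖w‖ ≤ 1) (hj : j < 20 := by omega) : c.O (j + 1) (dv w u) (k + 1) e := by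
  have := Bd.dv h c.hδ (lev hj.le) w
  unfold O
  have e1 : c.ρ - ((j + 1 : ℕ) : ℝ) * c.δ = c.ρ - j * c.δ - c.δ := by push_cast; ring
  rw [e1]
  refine this.mono ?_
  have h1 : ‖w‖ / c.δ ≤ c.X := le_trans (by gcongr; exact c.hδ.le) c.hXδ
  have h2 : 0 ≤ c.X ^ k * e := Xk0
  rw [pow_succ]; nlinarith
variable (c) in
abbrev K : ℕ := 2 * c.τ + 6
lemma DD_coef (h : c.O j u k e) (hj : j ≤ 20) (m : ℝ → ℂ) {p : ℝ} (hp : p ∈ c.S) (ν : T → ℤ) :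
    coef (fun p ψ => DD c.κ c.ω u p ψ + m p * u p ψ) ν p =
      ((c.κ p : ℂ))⁻¹ * (Complex.I * dot ν c.ω + c.κ p * m p) * coef u ν p := by
  have h1 := Bd.dv h c.hδ (lev hj) c.ω
  have hk : (c.κ p : ℂ) ≠ 0 := by exact_mod_cast (c.κpos p hp).ne'
  have e1 : coef (fun p ψ => DD c.κ c.ω u p ψ + m p * u p ψ) ν p =
      coef (fun q ψ => ((c.κ p : ℂ))⁻¹ * KAM.dv c.ω u q ψ + m p * u q ψ) ν p := coef_congr (fun ψ => rfl) ν
  rw [e1, coef_add (h1.smul _) (Bd.smul h _) hp, coef_smul (fun _ => (c.κ p : ℂ)⁻¹), coef_smul (fun _ => m p),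
    Bd.coef_dv h (lev0 hj) hp]
  field_simp
lemma mul_aux {m : ℝ → ℂ} (hnr : NR c.S c.κ c.ω c.γ c.τ m) (hm : LB c.S c.σ m (ENNReal.ofReal c.X))
    (hg : c.O j g k e) (hj : j < 20 := by omega) : ∃ v, c.O (j + 1) v (k + c.K) e ∧
      (∀ p ∈ c.S, ∀ ν, coef v ν p = if ν = 0 then 0 else
        (c.κ p : ℂ) * (Complex.I * dot ν c.ω + c.κ p * m p)⁻¹ * coef g ν p) ∧
      ∀ p ∈ c.S, ∀ ν ≠ 0, Complex.I * dot ν c.ω + c.κ p * m p ≠ 0 := by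
  obtain ⟨v, hv, hc⟩ := solve_aux hnr c.hγ c.hX c.hγX c.hω zero_le_one c.hκ le_rfl hm c.hδ c.hXδ (lev hj.le) c.hτ hg
  refine ⟨v, ?_, hc, fun p hp ν hν h0 => ?_⟩
  · unfold O
    have e1 : c.ρ - ((j + 1 : ℕ) : ℝ) * c.δ = c.ρ - j * c.δ - c.δ := by push_cast; ring
    rw [e1]
    refine hv.mono (le_of_eq ?_)
    rw [pow_add]; ring
  · have := hnr p hp ν hν
    rw [h0] at this; simp at this; linarith [c.hγ]
lemma solve {m : ℝ → ℂ} (hnr : NR c.S c.κ c.ω c.γ c.τ m) (hm : LB c.S c.σ m (ENNReal.ofReal c.X))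
    (hg : c.O j g k e) (hj : j < 20 := by omega) : ∃ v, c.O (j + 1) v (k + c.K) e ∧
      ∀ p ∈ c.S, ∀ ψ, DD c.κ c.ω v p ψ + m p * v p ψ = g p ψ - mean g p := by
  obtain ⟨v, hv, hc, hne⟩ := mul_aux hnr hm hg hj
  refine ⟨v, hv, fun p hp ψ => ?_⟩
  have hk : (c.κ p : ℂ) ≠ 0 := by exact_mod_cast (c.κpos p hp).ne'
  have hD := ((Bd.dv hv c.hδ (lev (by omega)) c.ω).smul ((c.κ p : ℂ)⁻¹)).rho (ρ' := 0) le_rfl (by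
    have := lev (c := c) (show j + 1 ≤ 20 by omega); linarith)
  have hv0 := (Bd.smul hv (m p)).rho (ρ' := 0) le_rfl (lev0 (by omega)).le
  have hB1 := (hD.add hv0 (mul_nonneg (norm_nonneg _) (mul_nonneg (div_nonneg (norm_nonneg _) c.hδ.le) Xk0)) (mul_nonneg (norm_nonneg _) Xk0)).subset (Set.singleton_subset_iff.mpr hp)
  have hB2 := (Bd.add hg (Bd.of_LB hg.1 hg.mean.neg) Xk0 Xk0).subset (Set.singleton_subset_iff.mpr hp)
  have := hB1.ext (p := p) hB2 rfl (fun ν => ?_) ψ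
  · rw [← sub_eq_add_neg] at this; exact this
  · have e1 := DD_coef hv (by omega) m hp ν
    rw [coef_congr (v := fun p ψ => DD c.κ c.ω v p ψ + m p * v p ψ) (fun ψ => rfl) ν, e1, hc p hp ν,
      coef_add hg (Bd.of_LB (d := T) hg.1 hg.mean.neg) hp, coef_const (fun p => - KAM.mean g p)]
    split_ifs with h0
    · rw [h0, coef_zero]; ring
    · have := hne p hp ν h0
      field_simp; ring
lemma apriori {m : ℝ → ℂ} (hnr : NR c.S c.κ c.ω c.γ c.τ m) (hm : LB c.S c.σ m (ENNReal.ofReal c.X))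
    (hu : c.O j u k' e') (hg : c.O j g k e)
    (heq : ∀ p ∈ c.S, ∀ ψ, DD c.κ c.ω u p ψ + m p * u p ψ = g p ψ) (hj : j < 20 := by omega) :
    c.O (j + 1) (fun p ψ => u p ψ - mean u p) (k + c.K) e ∧ ∀ p ∈ c.S, m p * mean u p = mean g p := by
  obtain ⟨v, hv, hc, hne⟩ := mul_aux hnr hm hg hj
  have hco : ∀ p ∈ c.S, ∀ ν, coef g ν p =
      ((c.κ p : ℂ))⁻¹ * (Complex.I * dot ν c.ω + c.κ p * m p) * coef u ν p := fun p hp ν => by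
    rw [← DD_coef hu (by omega) m hp ν]; exact coef_congr (fun ψ => (heq p hp ψ).symm) ν
  refine ⟨hv.congr fun p hp ψ => ?_, fun p hp => ?_⟩
  · have hB := Bd.add hu (Bd.of_LB hu.1 hu.mean.neg) Xk0 Xk0
    have := hB.ext hv hp (fun ν => ?_) ψ
    · rw [← sub_eq_add_neg] at this; exact this
    · rw [hc p hp ν, coef_add hu (Bd.of_LB (d := T) hu.1 hu.mean.neg) hp, coef_const (fun p => - KAM.mean u p)]
      have hk : (c.κ p : ℂ) ≠ 0 := by exact_mod_cast (c.κpos p hp).ne'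
      split_ifs with h0
      · rw [h0, coef_zero]; ring
      · rw [hco p hp ν]
        have := hne p hp ν h0
        field_simp; simp
  · have hk : (c.κ p : ℂ) ≠ 0 := by exact_mod_cast (c.κpos p hp).ne'
    have := hco p hp 0
    rw [coef_zero, coef_zero] at this
    rw [this]; simp [dot, hk]
lemma LB_mul {f f' : ℝ → ℂ} (h : LB c.S c.σ f (ENNReal.ofReal (c.X ^ k * e)))
    (h' : LB c.S c.σ f' (ENNReal.ofReal (c.X ^ k' * e'))) :
    LB c.S c.σ (fun p => f p * f' p) (ENNReal.ofReal (c.X ^ (k + k') * ((e * e' : ℝ≥0) : ℝ))) := by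
  refine (h.mul h').mono (le_of_eq ?_)
  rw [← ENNReal.ofReal_mul Xk0]; congr 1; push_cast; ring
lemma solve' {m : ℝ → ℂ} (hnr : NR c.S c.κ c.ω c.γ c.τ m) (hm : LB c.S c.σ m (ENNReal.ofReal c.X))
    (hmi : LB c.S c.σ (fun p => (m p)⁻¹) (ENNReal.ofReal c.X)) (hm0 : ∀ p ∈ c.S, m p ≠ 0)
    (hg : c.O j g k e) (hj : j < 20 := by omega) : ∃ v, c.O (j + 1) v (k + c.K + 1) e ∧
      ∀ p ∈ c.S, ∀ ψ, DD c.κ c.ω v p ψ + m p * v p ψ = g p ψ := by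
  obtain ⟨v, hv, hc⟩ := solve hnr hm hg hj
  have h1 := LB_mul hg.mean (k' := 1) (e' := 1) (by simpa using hmi)
  have h2 := O.of_LB (j := j + 1) h1
  rw [mul_one] at h2
  refine ⟨_, hv.add (h2.up ⟨le_rfl, by omega, by unfold K; omega⟩), fun p hp ψ => ?_⟩
  have := hc p hp ψ
  simp only [DD] at this ⊢
  rw [dv_add (hv.dif hp) (Dif.const _ p), dv_const (fun p => KAM.mean g p * (m p)⁻¹), add_zero, mul_add, ← add_assoc, this]
  have := hm0 p hp
  field_simp; ring
lemma apriori' {m : ℝ → ℂ} (hnr : NR c.S c.κ c.ω c.γ c.τ m) (hm : LB c.S c.σ m (ENNReal.ofReal c.X))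
    (hmi : LB c.S c.σ (fun p => (m p)⁻¹) (ENNReal.ofReal c.X)) (hm0 : ∀ p ∈ c.S, m p ≠ 0)
    (hu : c.O j u k' e') (hg : c.O j g k e)
    (heq : ∀ p ∈ c.S, ∀ ψ, DD c.κ c.ω u p ψ + m p * u p ψ = g p ψ) (hj : j < 20 := by omega) :
    c.O (j + 1) u (k + c.K + 1) e := by
  obtain ⟨h1, h2⟩ := apriori hnr hm hu hg heq hj
  have h3 := O.of_LB (j := j + 1) (LB_mul hg.mean (k' := 1) (e' := 1) (by simpa using hmi))
  rw [mul_one] at h3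
  refine (h1.add (h3.up ⟨le_rfl, by omega, by unfold K; omega⟩)).congr fun p hp ψ => ?_
  have := hm0 p hp
  rw [← h2 p hp]; field_simp; ring
end Cx
end
section
section comp
variable {T Bt : Type} [Fintype T] [Fintype Bt] {S : Set ℝ} {σ : ℝ≥0∞} {ρ R η θ δ C D : ℝ}
variable {β₀ : Bt → ℝ} {g : Fn (T ⊕ Bt)} {u ξ : T ⊕ Bt → Fn T}
def xx (β₀ : Bt → ℝ) (u : T ⊕ Bt → Fn T) (p : ℝ) (ψ : T → ℝ) : T ⊕ Bt → ℝ :=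
  Sum.elim ψ β₀ + fun j => (u j p ψ).re
def cmp (β₀ : Bt → ℝ) (g : Fn (T ⊕ Bt)) (u : T ⊕ Bt → Fn T) : Fn T := fun p ψ => g p (xx β₀ u p ψ)
lemma comp_core {J : Type} [Fintype J] {g : Fn J} (hg : Bd S σ R g C) (w : (J → ℤ) → Fn T) (F : Fn T) (hρ : 0 ≤ ρ) (hD : 0 ≤ D)
    (hw : ∀ ν, Bd S σ ρ (w ν) (D * Real.exp (R * nm ν)))
    (hF : ∀ p ∈ S, ∀ ψ, HasSum (fun ν => coef g ν p * w ν p ψ) (F p ψ)) : Bd S σ ρ F (D * C) := by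
  obtain ⟨h0, -, -, b, hb, hC⟩ := hg.spec
  have hfin : ∀ ν, b ν ≠ ⊤ := fun ν =>
    ne_top_of_le_ne_top ENNReal.ofReal_ne_top
      (((le_mul_of_one_le_right' (one_le_wt h0 ν)).trans (ENNReal.le_tsum ν)).trans hC)
  refine Bd.tsum (w := fun ν p ψ => coef g ν p * w ν p ψ)
    (C := fun ν => (b ν).toReal * (D * Real.exp (R * nm ν))) hρ (fun ν => ?_) hF ?_
  · exact (Bd.of_LB hρ (by rw [ENNReal.ofReal_toReal (hfin ν)]; exact hb ν)).mul (hw ν) ENNReal.toReal_nonneg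
  · rw [ENNReal.ofReal_mul hD]
    refine le_trans ?_ (mul_le_mul_right hC _)
    rw [← ENNReal.tsum_mul_left]
    refine ENNReal.tsum_le_tsum fun ν => le_of_eq ?_
    rw [ENNReal.ofReal_mul ENNReal.toReal_nonneg, ENNReal.ofReal_toReal (hfin ν), ENNReal.ofReal_mul hD, wt]
    ring
def Rl (S : Set ℝ) (u : Fn T) : Prop := ∀ p ∈ S, ∀ ψ, (u p ψ).im = 0
lemma Rl.re {u : Fn T} (h : Rl S u) {p : ℝ} (hp : p ∈ S) (ψ : T → ℝ) : (((u p ψ).re : ℝ) : ℂ) = u p ψ :=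
  Complex.ext (by simp) (by simp [h p hp ψ])
lemma Bd.idot {J : Type} [Fintype J] {u : J → Fn T} (hρ : 0 ≤ ρ) (hη : 0 ≤ η) (hu : ∀ j, Bd S σ ρ (u j) η) (ν : J → ℤ) :
    Bd S σ ρ (fun p ψ => ∑ j, Complex.I * (ν j : ℂ) * u j p ψ) (η * nm ν) := by
  refine (Bd.fsum Finset.univ hρ (C := fun j => |(ν j : ℝ)| * η) (fun j => by positivity) (fun j => ?_)).mono ?_
  · refine ((hu j).smul (Complex.I * (ν j : ℂ))).mono (le_of_eq ?_)
    simp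
  · rw [← Finset.sum_mul, mul_comm, nm]
lemma ee_exp {J : Type} [Fintype J] (ν : J → ℤ) (x : J → ℝ) : KAM.ee ν x = Complex.exp (∑ j, Complex.I * (ν j : ℂ) * (x j : ℂ)) := by
  rw [ee, dot]; congr 1; push_cast; rw [Finset.sum_mul]; exact Finset.sum_congr rfl fun j _ => by ring
lemma Bd.ee_xx (hρ : 0 ≤ ρ) (hη : 0 ≤ η) (hu : ∀ j, Bd S σ ρ (u j) η) (hr : ∀ j, Rl S (u j)) (ν : T ⊕ Bt → ℤ) :
    Bd S σ ρ (fun p ψ => KAM.ee ν (xx β₀ u p ψ)) (Real.exp ((ρ + η) * nm ν)) := by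
  have h1 : Bd S σ ρ (fun p (ψ : T → ℝ) => KAM.ee ν (Sum.elim ψ β₀)) (Real.exp (ρ * nm ν)) := by
    have := (Bd.ee (S := S) (σ := σ) hρ (fun t => ν (Sum.inl t))).smul (KAM.ee (fun b => ν (Sum.inr b)) β₀)
    refine (this.mono ?_).congr fun p _ ψ => ?_
    · rw [ee_norm, one_mul]
      refine Real.exp_le_exp.mpr (mul_le_mul_of_nonneg_left ?_ hρ)
      rw [nm, nm, Fintype.sum_sum_type]
      exact le_add_of_nonneg_right (Finset.sum_nonneg fun _ _ => abs_nonneg _)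
    · rw [KAM.ee, KAM.ee, KAM.ee, ← Complex.exp_add]; congr 1
      rw [dot, dot, dot, Fintype.sum_sum_type]; push_cast; simp; ring
  have h2 := (Bd.idot hρ hη hu ν).exp (mul_nonneg hη (nm_nonneg ν))
  refine ((h1.mul h2 (Real.exp_pos _).le).mono (le_of_eq ?_)).congr fun p hp ψ => ?_
  · rw [← Real.exp_add]; ring_nf
  · rw [ee_exp, ee_exp, ← Complex.exp_add]; congr 1
    rw [← Finset.sum_add_distrib]
    refine Finset.sum_congr rfl fun j _ => ?_
    rw [← mul_add]; congr 1
    simp only [xx, Pi.add_apply]; push_cast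
    rw [(hr j).re hp]
lemma Bd.cmp (hg : Bd S σ R g C) (hρ : 0 ≤ ρ) (hη : 0 ≤ η) (hR : ρ + η ≤ R) (hu : ∀ j, Bd S σ ρ (u j) η)
    (hr : ∀ j, Rl S (u j)) : Bd S σ ρ (cmp β₀ g u) C := by
  have := comp_core hg (fun ν p ψ => KAM.ee ν (xx β₀ u p ψ)) (KAM.cmp β₀ g u) hρ zero_le_one (fun ν => ?_)
    (fun p hp ψ => hg.spec.2.1 p hp _)
  · simpa using this
  · refine (Bd.ee_xx hρ hη hu hr ν).mono ?_
    rw [one_mul]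
    exact Real.exp_le_exp.mpr (mul_le_mul_of_nonneg_right hR (nm_nonneg ν))
lemma xx_add (p : ℝ) (ψ : T → ℝ) : xx β₀ (fun j p ψ => u j p ψ + ξ j p ψ) p ψ = xx β₀ u p ψ + fun j => (ξ j p ψ).re := by
  funext j; simp [xx]; ring
lemma nm_mul_exp (hδ : 0 < δ) (ν : T → ℤ) : nm ν ≤ δ⁻¹ * Real.exp (δ * nm ν) := by
  simpa using nm_le_exp hδ ν
lemma Bd.cmp1 (hg : Bd S σ R g C) (hρ : 0 ≤ ρ) (hη : 0 ≤ η) (hθ : 0 ≤ θ) (hδ : 0 < δ) (hR : ρ + η + θ + δ ≤ R)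
    (hu : ∀ j, Bd S σ ρ (u j) η) (hξ : ∀ j, Bd S σ ρ (ξ j) θ)
    (hr : ∀ j, Rl S (u j)) (hr' : ∀ j, Rl S (ξ j)) :
    Bd S σ ρ (fun p ψ => KAM.cmp β₀ g (fun j p ψ => u j p ψ + ξ j p ψ) p ψ - KAM.cmp β₀ g u p ψ) (θ / δ * C) := by
  refine comp_core hg (fun ν p ψ => KAM.ee ν (xx β₀ u p ψ) * (Complex.exp (∑ j, Complex.I * (ν j : ℂ) * ξ j p ψ) - 1)) _ hρ
    (by positivity) (fun ν => ?_) (fun p hp ψ => ?_)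
  · have h2 := (Bd.idot hρ hθ hξ ν).exp1 (mul_nonneg hθ (nm_nonneg ν))
    refine ((Bd.ee_xx (β₀ := β₀) hρ hη hu hr ν).mul h2 (Real.exp_pos _).le).mono ?_
    have h3 := nm_mul_exp hδ ν
    calc Real.exp ((ρ + η) * nm ν) * (θ * nm ν * Real.exp (θ * nm ν))
        ≤ Real.exp ((ρ + η) * nm ν) * (θ * (δ⁻¹ * Real.exp (δ * nm ν)) * Real.exp (θ * nm ν)) := by gcongr
      _ = θ / δ * Real.exp ((ρ + η + θ + δ) * nm ν) := by
          rw [show (ρ + η + θ + δ) * nm ν = (ρ + η) * nm ν + (δ * nm ν + θ * nm ν) by ring, Real.exp_add, Real.exp_add]; ring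
      _ ≤ _ := by
          refine mul_le_mul_of_nonneg_left (Real.exp_le_exp.mpr (mul_le_mul_of_nonneg_right hR (nm_nonneg ν))) (by positivity)
  · refine hs_congr ((hg.spec.2.1 p hp _).sub (hg.spec.2.1 p hp _)) fun ν => ?_
    rw [xx_add, ee_exp, ee_exp]
    rw [← mul_sub, mul_sub, mul_one, ← Complex.exp_add, ← Finset.sum_add_distrib]
    congr 3
    refine Finset.sum_congr rfl fun j _ => ?_
    simp only [Pi.add_apply]; push_cast
    rw [(hr' j).re hp]; ring
lemma Bd.hasFDerivAt {J : Type} [Fintype J] {g : Fn J} (hg : Bd S σ R g C) (hR : 0 < R) {p : ℝ} (hp : p ∈ S) (x : J → ℝ) :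
    DifferentiableAt ℝ (g p) x := by
  classical
  obtain ⟨h0, hrep, hs, -⟩ := hg.spec
  have hb := hg.deriv_aux hR hp
  obtain ⟨w, hw, hwR, hwc⟩ := hg.mult (m := fun ν _ => (nm ν : ℂ)) (t := fun ν => nm ν) (K := 1 / R)
    (δ := R) le_rfl (fun ν => by
      refine (LB.const _).mono (le_of_eq ?_)
      rw [← ofReal_norm, Complex.norm_real, Real.norm_of_nonneg (nm_nonneg ν)]) (nm_le_exp hR) (by positivity)
  have hsum := hw.spec.2.2.1 p hp
  have key := hasFDerivAt_tsum (𝕜 := ℝ) (f := fun ν x => coef g ν p * KAM.ee ν x)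
    (f' := fun ν x => (coef g ν p * KAM.ee ν x * Complex.I) • (Complex.ofRealCLM.comp
      (∑ k, (ν k : ℝ) • ContinuousLinearMap.proj (R := ℝ) (φ := fun _ : J => ℝ) k)))
    (u := fun ν => ‖coef w ν p‖) (x₀ := 0) hsum (fun ν x => ?_) (fun ν x => ?_) (hrep p hp 0).summable x
  · have e : (g p) = fun y => ∑' ν, coef g ν p * KAM.ee ν y := funext fun y => (hrep p hp y).tsum_eq.symm
    rw [e]; exact key.differentiableAt
  · have e1 : HasFDerivAt (fun x : J → ℝ => dot ν x) (∑ k, (ν k : ℝ) • ContinuousLinearMap.proj (R := ℝ) (φ := fun _ : J => ℝ) k) x := by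
      unfold dot
      refine HasFDerivAt.fun_sum fun k _ => ?_
      exact (hasFDerivAt_apply (𝕜 := ℝ) k x).const_mul _
    have e2 := ((Complex.ofRealCLM.hasFDerivAt.comp x e1).mul_const Complex.I).cexp.const_mul (coef g ν p)
    refine e2.congr_fderiv ?_
    rw [smul_smul, smul_smul]; rfl
  · rw [hwc p hp ν]
    refine (ContinuousLinearMap.opNorm_le_bound _ (by positivity) fun v => ?_)
    have : (∑ k, (ν k : ℝ) * v k) = dot ν v := rfl
    simp only [smul_apply, ContinuousLinearMap.comp_apply, sum_apply,
      ContinuousLinearMap.proj_apply, smul_eq_mul, Complex.ofRealCLM_apply, this]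
    rw [norm_mul, norm_mul, norm_mul, ee_norm, Complex.norm_I, Complex.norm_real, norm_mul, Complex.norm_real,
      Real.norm_eq_abs, Real.norm_of_nonneg (nm_nonneg ν)]
    have := mul_le_mul_of_nonneg_left (abs_dot_le ν v) (norm_nonneg (coef g ν p))
    linarith
lemma dv_fderiv {J : Type} [Fintype J] {g : Fn J} {p : ℝ} {x : J → ℝ} (h : DifferentiableAt ℝ (g p) x) (v : J → ℝ) :
    dv v g p x = fderiv ℝ (g p) x v := by
  have h1 : HasDerivAt (fun t : ℝ => x + t • v) v 0 := by
    simpa using ((hasDerivAt_id (0 : ℝ)).smul_const v).const_add x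
  have h2 : HasFDerivAt (g p) (fderiv ℝ (g p) x) (x + (0 : ℝ) • v) := by simpa using h.hasFDerivAt
  exact (h2.comp_hasDerivAt (0 : ℝ) h1).deriv
lemma Bd.chain (hg : Bd S σ R g C) (hR : 0 < R) {p : ℝ} (hu : ∀ j, Dif (u j) p) (hp : p ∈ S)
    (hr : ∀ j, Rl S (u j)) [DecidableEq (T ⊕ Bt)] (w ψ : T → ℝ) :
    Dif (KAM.cmp β₀ g u) p ∧
    KAM.dv w (KAM.cmp β₀ g u) p ψ = ∑ j, KAM.cmp β₀ (KAM.dv (Pi.single j 1) g) u p ψ *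
      (((Sum.elim w (0 : Bt → ℝ) j : ℝ) : ℂ) + KAM.dv w (u j) p ψ) := by
  have hG := hg.hasFDerivAt hR hp
  have h1 : ∀ w ψ, HasDerivAt (fun t : ℝ => xx β₀ u p (ψ + t • w))
      (fun j => Sum.elim w (0 : Bt → ℝ) j + (KAM.dv w (u j) p ψ).re) 0 := fun w ψ => by
    rw [hasDerivAt_pi]
    intro j
    have a := (Complex.reCLM.hasFDerivAt (x := u j p (ψ + (0 : ℝ) • w))).comp_hasDerivAt (0 : ℝ) (hu j ψ w).hasDerivAt
    refine HasDerivAt.add ?_ a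
    rcases j with j | j
    · simpa using ((hasDerivAt_id (0 : ℝ)).mul_const (w j)).const_add (ψ j)
    · simpa using hasDerivAt_const (0 : ℝ) (β₀ j)
  have h2 : ∀ w ψ, HasDerivAt (fun t : ℝ => KAM.cmp β₀ g u p (ψ + t • w))
      (fderiv ℝ (g p) (xx β₀ u p ψ) (fun j => Sum.elim w (0 : Bt → ℝ) j + (KAM.dv w (u j) p ψ).re)) 0 := fun w ψ => by
    have : HasFDerivAt (g p) (fderiv ℝ (g p) (xx β₀ u p ψ)) (xx β₀ u p (ψ + (0 : ℝ) • w)) := by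
      simpa using (hG _).hasFDerivAt
    exact this.comp_hasDerivAt (0 : ℝ) (h1 w ψ)
  refine ⟨fun ψ w => (h2 w ψ).differentiableAt, ?_⟩
  rw [KAM.dv, (h2 w ψ).deriv]
  have him : ∀ j, (KAM.dv w (u j) p ψ).im = 0 := fun j => by
    have a := (Complex.imCLM.hasFDerivAt (x := u j p (ψ + (0 : ℝ) • w))).comp_hasDerivAt (0 : ℝ) (hu j ψ w).hasDerivAt
    have b : (Complex.imCLM ∘ fun t : ℝ => u j p (ψ + t • w)) = fun _ => 0 := funext fun t => hr j p hp _
    rw [b] at a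
    exact a.unique (hasDerivAt_const _ _)
  set V := fun j => Sum.elim w (0 : Bt → ℝ) j + (KAM.dv w (u j) p ψ).re with hV
  rw [← Finset.univ_sum_single V, map_sum]
  refine Finset.sum_congr rfl fun j _ => ?_
  rw [KAM.cmp, dv_fderiv (hG _), show Pi.single j (V j) = V j • (Pi.single j (1 : ℝ) : T ⊕ Bt → ℝ) by
    rw [← Pi.single_smul]; simp, map_smul, hV]
  have : (((KAM.dv w (u j) p ψ).re : ℝ) : ℂ) = KAM.dv w (u j) p ψ := Complex.ext (by simp) (by simp [him j])
  rw [Complex.real_smul, mul_comm]; push_cast; rw [this]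
lemma Rl.dv {u : Fn T} (hr : Rl S u) {p : ℝ} (hp : p ∈ S) (hu : Dif u p) (w ψ : T → ℝ) : (dv w u p ψ).im = 0 := by
  have a := (Complex.imCLM.hasFDerivAt (x := u p (ψ + (0 : ℝ) • w))).comp_hasDerivAt (0 : ℝ) (hu ψ w).hasDerivAt
  have b : (Complex.imCLM ∘ fun t : ℝ => u p (ψ + t • w)) = fun _ => 0 := funext fun t => hr p hp _
  rw [b] at a
  exact a.unique (hasDerivAt_const _ _)
lemma Bd.cmp2 [DecidableEq (T ⊕ Bt)] (hg : Bd S σ R g C) (hρ : 0 ≤ ρ) (hη : 0 ≤ η) (hθ : 0 ≤ θ) (hδ : 0 < δ) (hR : ρ + η + θ + δ ≤ R)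
    (hu : ∀ j, Bd S σ ρ (u j) η) (hξ : ∀ j, Bd S σ ρ (ξ j) θ)
    (hr : ∀ j, Rl S (u j)) (hr' : ∀ j, Rl S (ξ j)) :
    Bd S σ ρ (fun p ψ => KAM.cmp β₀ g (fun j p ψ => u j p ψ + ξ j p ψ) p ψ - KAM.cmp β₀ g u p ψ
      - ∑ j, KAM.cmp β₀ (KAM.dv (Pi.single j 1) g) u p ψ * ξ j p ψ) (2 * (θ / δ) ^ 2 * C) := by
  refine comp_core hg (fun ν p ψ => KAM.ee ν (xx β₀ u p ψ) * (Complex.exp (∑ j, Complex.I * (ν j : ℂ) * ξ j p ψ) - 1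
    - ∑ j, Complex.I * (ν j : ℂ) * ξ j p ψ)) _ hρ (by positivity) (fun ν => ?_) (fun p hp ψ => ?_)
  · have h2 := (Bd.idot hρ hθ hξ ν).exp2 (mul_nonneg hθ (nm_nonneg ν))
    refine ((Bd.ee_xx (β₀ := β₀) hρ hη hu hr ν).mul h2 (Real.exp_pos _).le).mono ?_
    have h3 : (nm ν) ^ 2 ≤ 2 / δ ^ 2 * Real.exp (δ * nm ν) := by
      have := Real.quadratic_le_exp_of_nonneg (mul_nonneg hδ.le (nm_nonneg ν))
      rw [div_mul_eq_mul_div, le_div_iff₀ (by positivity)]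
      nlinarith [mul_nonneg hδ.le (nm_nonneg ν)]
    calc Real.exp ((ρ + η) * nm ν) * ((θ * nm ν) ^ 2 * Real.exp (θ * nm ν))
        = Real.exp ((ρ + η) * nm ν) * (θ ^ 2 * nm ν ^ 2 * Real.exp (θ * nm ν)) := by ring
      _ ≤ Real.exp ((ρ + η) * nm ν) * (θ ^ 2 * (2 / δ ^ 2 * Real.exp (δ * nm ν)) * Real.exp (θ * nm ν)) := by gcongr
      _ = 2 * (θ / δ) ^ 2 * Real.exp ((ρ + η + θ + δ) * nm ν) := by
          rw [show (ρ + η + θ + δ) * nm ν = (ρ + η) * nm ν + (δ * nm ν + θ * nm ν) by ring, Real.exp_add, Real.exp_add]; ring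
      _ ≤ _ := by
          refine mul_le_mul_of_nonneg_left (Real.exp_le_exp.mpr (mul_le_mul_of_nonneg_right hR (nm_nonneg ν))) (by positivity)
  · have hR0 : 0 < R := by linarith
    have hd := hasSum_sum (s := Finset.univ) fun j _ =>
      ((hg.deriv_aux hR0 hp (xx β₀ u p ψ) (Pi.single j 1)).2.mul_right (ξ j p ψ))
    refine hs_congr (((hg.spec.2.1 p hp _).sub (hg.spec.2.1 p hp _)).sub hd) fun ν => ?_
    have e2 : KAM.ee ν (xx β₀ (fun j p ψ => u j p ψ + ξ j p ψ) p ψ) =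
        KAM.ee ν (xx β₀ u p ψ) * Complex.exp (∑ j, Complex.I * (ν j : ℂ) * ξ j p ψ) := by
      rw [xx_add, ee_exp, ee_exp, ← Complex.exp_add, ← Finset.sum_add_distrib]
      congr 1
      refine Finset.sum_congr rfl fun j _ => ?_
      simp only [Pi.add_apply]; push_cast
      rw [(hr' j).re hp]; ring
    have e3 : ∀ j, dot ν (Pi.single j 1) = ν j := fun j => by simp [dot, Pi.single_apply]
    rw [e2, mul_sub, Finset.mul_sum, mul_sub, mul_sub, Finset.mul_sum]
    congr 1
    · ring
    · refine Finset.sum_congr rfl fun j _ => ?_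
      rw [e3]; push_cast; ring
end comp
end
section
abbrev Ix (T Bt : Type) := (T ⊕ Bt) ⊕ (T ⊕ Bt)
abbrev Fr (T L : Type) := T ⊕ (T ⊕ L)
structure St (T Bt L : Type) where
  K : Ix T Bt → Fn T
  lam : T → ℝ → ℂ
  V : L → Ix T Bt → Fn T
  μ : L → ℝ → ℂ
section defs
variable {T Bt L : Type} [Fintype T] [Fintype Bt] [Fintype L] [DecidableEq T] [DecidableEq Bt] [DecidableEq L]
noncomputable def mo (μ : L → ℝ → ℂ) : Option L → ℝ → ℂ
  | none => fun _ => 0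
  | some l => μ l
noncomputable def gr (f : Fn (T ⊕ Bt)) (j : T ⊕ Bt) : Fn (T ⊕ Bt) := dv (Pi.single j 1) f
noncomputable def QQ (β₀ : Bt → ℝ) (f : Fn (T ⊕ Bt)) (K : Ix T Bt → Fn T) (j i : T ⊕ Bt) : Fn T :=
  cmp β₀ (dv (Pi.single i 1) (gr f j)) (fun j => K (.inl j))
noncomputable def BB (Q : T ⊕ Bt → T ⊕ Bt → Fn T) (ξ : Ix T Bt → Fn T) : Ix T Bt → Fn T
  | .inl j => ξ (.inr j)
  | .inr j => fun p ψ => - ∑ i, Q j i p ψ * ξ (.inl i) p ψ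
noncomputable def er (κ : ℝ → ℝ) (ω : T → ℝ) (β₀ : Bt → ℝ) (f : Fn (T ⊕ Bt)) (s : St T Bt L) : Ix T Bt → Fn T
  | .inl j => fun p ψ => DD κ ω (s.K (.inl j)) p ψ - s.K (.inr j) p ψ
  | .inr j => fun p ψ => DD κ ω (s.K (.inr j)) p ψ + cmp β₀ (gr f j) (fun j => s.K (.inl j)) p ψ
      - Sum.elim (fun t => s.lam t p) (fun _ => 0) j
noncomputable def dl (i : Ix T Bt) (k : T) : ℂ := if i = .inl (.inl k) then 1 else 0
noncomputable def dn (i : Ix T Bt) (k : T) : ℂ := if i = .inr (.inl k) then 1 else 0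
noncomputable def MM (s : St T Bt L) (k : T) (i : Ix T Bt) : Fn T := fun p ψ => dv (Pi.single k 1) (s.K i) p ψ + dl i k
noncomputable def PP (s : St T Bt L) (i : Ix T Bt) : Fr T L → Fn T
  | .inl k => MM s k i
  | .inr (.inl k) => fun _ _ => dn i k
  | .inr (.inr l) => s.V l i
noncomputable def P0 (V₀ : L → Ix T Bt → ℂ) (i : Ix T Bt) : Fr T L → ℂ
  | .inl k => dl i k
  | .inr (.inl k) => dn i k
  | .inr (.inr l) => V₀ l i
noncomputable def FF (κ : ℝ → ℝ) (ω : T → ℝ) (β₀ : Bt → ℝ) (f : Fn (T ⊕ Bt)) (s : St T Bt L) (l : L) (i : Ix T Bt) : Fn T :=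
  fun p ψ => DD κ ω (s.V l i) p ψ - BB (QQ β₀ f s.K) (s.V l) i p ψ + s.μ l p * s.V l i p ψ
def fo : Fr T L → Option L
  | .inl _ => none
  | .inr (.inl _) => none
  | .inr (.inr l) => some l
structure Div (c : Cx T) (μ : L → ℝ → ℂ) : Prop where
  hm : ∀ o o', LB c.S c.σ (fun p => mo μ o p - mo μ o' p) (ENNReal.ofReal c.X)
  hnr : ∀ o o', NR c.S c.κ c.ω c.γ c.τ (fun p => mo μ o p - mo μ o' p)
  hi : ∀ o o', o ≠ o' → LB c.S c.σ (fun p => (mo μ o p - mo μ o' p)⁻¹) (ENNReal.ofReal c.X) ∧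
    ∀ p ∈ c.S, mo μ o p - mo μ o' p ≠ 0
variable {c : Cx T} {μ : L → ℝ → ℂ} {j k : ℕ} {E e : ℝ≥0}
lemma K6 (c : Cx T) : 6 ≤ c.K := by unfold Cx.K; omega
lemma Div.solve (h : Div c μ) (o o' : Option L) {g : Fn T} (hg : c.O j g k E) (hj : j < 20 := by omega) :
    ∃ v, c.O (j + 1) v (k + c.K + 1) E ∧ ∀ p ∈ c.S, ∀ ψ,
      DD c.κ c.ω v p ψ + (mo μ o p - mo μ o' p) * v p ψ = g p ψ - if o = o' then mean g p else 0 := by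
  by_cases ho : o = o'
  · obtain ⟨v, hv, h2⟩ := Cx.solve (h.hnr o o') (h.hm o o') hg hj
    refine ⟨v, hv.up, fun p hp ψ => ?_⟩
    rw [h2 p hp ψ, if_pos ho]
  · obtain ⟨v, hv, h2⟩ := Cx.solve' (h.hnr o o') (h.hm o o') (h.hi o o' ho).1 (h.hi o o' ho).2 hg hj
    refine ⟨v, hv, fun p hp ψ => ?_⟩
    rw [h2 p hp ψ, if_neg ho, sub_zero]
variable {κ : ℝ → ℝ} {ω : T → ℝ} {u v : Fn T} {p : ℝ}
lemma DD_add (h : Dif u p) (h' : Dif v p) (ψ : T → ℝ) :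
    DD κ ω (fun p ψ => u p ψ + v p ψ) p ψ = DD κ ω u p ψ + DD κ ω v p ψ := by
  simp only [DD]; rw [dv_add h h']; ring
lemma DD_mul (h : Dif u p) (h' : Dif v p) (ψ : T → ℝ) :
    DD κ ω (fun p ψ => u p ψ * v p ψ) p ψ = DD κ ω u p ψ * v p ψ + u p ψ * DD κ ω v p ψ := by
  simp only [DD]; rw [dv_mul h h']; ring
lemma DD_const (a : ℝ → ℂ) (ψ : T → ℝ) : DD κ ω (fun p _ => a p) p ψ = 0 := by
  simp only [DD]; rw [dv_const a]; ring
lemma DD_sum {ι : Type} [Fintype ι] {w : ι → Fn T} (h : ∀ i, Dif (w i) p) (ψ : T → ℝ) :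
    DD κ ω (fun p ψ => ∑ i, w i p ψ) p ψ = ∑ i, DD κ ω (w i) p ψ := by
  simp only [DD]; rw [dv_sum _ h, Finset.mul_sum]
lemma DD_congr (h : ∀ ψ, u p ψ = v p ψ) (ψ : T → ℝ) : DD κ ω u p ψ = DD κ ω v p ψ := by
  simp only [DD]; rw [dv_congr h]
variable {Q : T ⊕ Bt → T ⊕ Bt → Fn T}
lemma BB_sum {ι : Type} [Fintype ι] {P : Ix T Bt → ι → Fn T} {z : ι → Fn T} (i : Ix T Bt) (ψ : T → ℝ) :
    BB Q (fun i p ψ => ∑ a, P i a p ψ * z a p ψ) i p ψ = ∑ a, BB Q (fun i => P i a) i p ψ * z a p ψ := by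
  rcases i with i | i
  · rfl
  · simp only [BB, Finset.mul_sum, neg_mul, Finset.sum_mul, Finset.sum_neg_distrib, ← mul_assoc]
    rw [Finset.sum_comm]
lemma leib {ι : Type} [Fintype ι] {P : Ix T Bt → ι → Fn T} {z : ι → Fn T} (hP : ∀ i a, Dif (P i a) p)
    (hz : ∀ a, Dif (z a) p) (m : ℂ) (i : Ix T Bt) (ψ : T → ℝ) :
    DD κ ω (fun p ψ => ∑ a, P i a p ψ * z a p ψ) p ψ + m * (∑ a, P i a p ψ * z a p ψ)
      - BB Q (fun i p ψ => ∑ a, P i a p ψ * z a p ψ) i p ψ =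
    ∑ a, ((DD κ ω (P i a) p ψ - BB Q (fun i => P i a) i p ψ) * z a p ψ
      + P i a p ψ * (DD κ ω (z a) p ψ + m * z a p ψ)) := by
  rw [DD_sum (fun a => (hP i a).mul (hz a)), BB_sum, Finset.mul_sum, ← Finset.sum_add_distrib, ← Finset.sum_sub_distrib]
  refine Finset.sum_congr rfl fun a _ => ?_
  rw [DD_mul (hP i a) (hz a)]; ring
lemma lin_id {s : St T Bt L} {W : Fr T L → Ix T Bt → Fn T} {z G ν : Fr T L → Fn T} {de : T → Ix T Bt → Fn T}
    {F : L → Ix T Bt → Fn T} {m : ℂ} {ψ : T → ℝ} {a : Fr T L → ℂ}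
    (hP : ∀ i a, Dif (PP s i a) p) (hz : ∀ a, Dif (z a) p)
    (hM : ∀ k i, DD κ ω (MM s k i) p ψ - BB Q (MM s k) i p ψ = de k i p ψ)
    (hV : ∀ l i, DD κ ω (s.V l i) p ψ - BB Q (s.V l) i p ψ = F l i p ψ - s.μ l p * s.V l i p ψ)
    (hW : ∀ i k, ∑ b, PP s i b p ψ * W b (.inl (.inl k)) p ψ = dl i k)
    (hb : ∀ b, DD κ ω (z b) p ψ + (m - mo s.μ (fo b) p) * z b p ψ =
      G b p ψ + ∑ k, W b (.inl (.inl k)) p ψ * z (.inr (.inl k)) p ψ - ν b p ψ - a b) (i : Ix T Bt) :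
    DD κ ω (fun p ψ => ∑ a, PP s i a p ψ * z a p ψ) p ψ + m * (∑ a, PP s i a p ψ * z a p ψ)
      - BB Q (fun i p ψ => ∑ a, PP s i a p ψ * z a p ψ) i p ψ =
    (∑ b, PP s i b p ψ * G b p ψ) - (∑ b, PP s i b p ψ * a b) + ((∑ k, de k i p ψ * z (.inl k) p ψ)
      + (∑ l, F l i p ψ * z (.inr (.inr l)) p ψ) - ∑ b, PP s i b p ψ * ν b p ψ) := by
  rw [leib hP hz]
  have e0 : ∀ b, PP s i b p ψ * (DD κ ω (z b) p ψ + m * z b p ψ) =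
      PP s i b p ψ * G b p ψ + (∑ k, PP s i b p ψ * W b (.inl (.inl k)) p ψ * z (.inr (.inl k)) p ψ)
        - PP s i b p ψ * ν b p ψ - PP s i b p ψ * a b + PP s i b p ψ * (mo s.μ (fo b) p * z b p ψ) := fun b => by
    have : DD κ ω (z b) p ψ + m * z b p ψ = G b p ψ + ∑ k, W b (.inl (.inl k)) p ψ * z (.inr (.inl k)) p ψ - ν b p ψ - a b
      + mo s.μ (fo b) p * z b p ψ := by rw [← hb b]; ring
    rw [this]
    simp only [mul_assoc, ← Finset.mul_sum]; ring
  have e1 : (∑ b, ∑ k, PP s i b p ψ * W b (.inl (.inl k)) p ψ * z (.inr (.inl k)) p ψ) =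
      ∑ k, dl i k * z (.inr (.inl k)) p ψ := by
    rw [Finset.sum_comm]
    exact Finset.sum_congr rfl fun k _ => by rw [← Finset.sum_mul, hW]
  have e2 : (∑ b, ((DD κ ω (PP s i b) p ψ - BB Q (fun i => PP s i b) i p ψ) * z b p ψ
      + PP s i b p ψ * (mo s.μ (fo b) p * z b p ψ))) = (∑ k, de k i p ψ * z (.inl k) p ψ)
      + (∑ l, F l i p ψ * z (.inr (.inr l)) p ψ) - ∑ k, dl i k * z (.inr (.inl k)) p ψ := by
    rw [Fintype.sum_sum_type, Fintype.sum_sum_type]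
    have a1 : ∀ k, DD κ ω (PP s i (.inl k)) p ψ - BB Q (fun i => PP s i (.inl k)) i p ψ = de k i p ψ := fun k => hM k i
    have a2 : ∀ k, DD κ ω (PP s i (.inr (.inl k))) p ψ - BB Q (fun i => PP s i (.inr (.inl k))) i p ψ = - dl i k := fun k => by
      have : DD κ ω (PP s i (.inr (.inl k))) p ψ = 0 := DD_const (fun _ => dn i k) ψ
      rw [this, zero_sub]; congr 1
      rcases i with i | i
      · simp [BB, PP, dl, dn]
      · simp [BB, PP, dl, dn]
    have a3 : ∀ l, DD κ ω (PP s i (.inr (.inr l))) p ψ - BB Q (fun i => PP s i (.inr (.inr l))) i p ψ =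
      F l i p ψ - s.μ l p * s.V l i p ψ := fun l => hV l i
    simp only [a1, a2, a3]
    simp only [fo, mo, PP, zero_mul, mul_zero, add_zero, neg_mul]
    rw [Finset.sum_neg_distrib]
    have : (∑ l, ((F l i p ψ - s.μ l p * s.V l i p ψ) * z (.inr (.inr l)) p ψ +
        s.V l i p ψ * (s.μ l p * z (.inr (.inr l)) p ψ))) = ∑ l, F l i p ψ * z (.inr (.inr l)) p ψ :=
      Finset.sum_congr rfl fun l _ => by ring
    rw [this]; ring
  simp only [e0]
  simp only [Finset.sum_add_distrib, Finset.sum_sub_distrib] at e2 ⊢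
  rw [e1]
  linear_combination e2
end defs
end
section
section frame
variable {T Bt L : Type} [Fintype T] [Fintype Bt] [Fintype L] [DecidableEq T] [DecidableEq Bt] [DecidableEq L]
structure Dat (T Bt L : Type) where
  β₀ : Bt → ℝ
  f : Fn (T ⊕ Bt)
  V₀ : L → Ix T Bt → ℂ
  W₀ : Fr T L → Ix T Bt → ℂ
  R : ℝ
  w : ℝ
  C : ℝ
structure Env (D : Dat T Bt L) (c : Cx T) : Prop where
  hR : 0 < D.R
  ρR : 4 * c.ρ ≤ D.R
  hf : Bd c.S c.σ D.R D.f D.C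
  hg : ∀ j, Bd c.S c.σ D.R (gr D.f j) c.X
  hQ : ∀ i j, Bd c.S c.σ D.R (dv (Pi.single i 1) (gr D.f j)) c.X
  fr : ∀ p x, (D.f p x).im = 0
  hW : ∀ b b', ∑ i, D.W₀ b i * P0 D.V₀ i b' = if b = b' then 1 else 0
  card : Fintype.card (Ix T Bt) = Fintype.card (Fr T L)
  hN : Fintype.card (Ix T Bt) ≤ c.N
  w1 : 1 ≤ D.w
  wX : 2 * D.w ≤ c.X
  hw : ∀ b i, ‖D.W₀ b i‖ ≤ D.w
  hv : ∀ b i, ‖D.V₀ b i‖ ≤ D.w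
structure Good (D : Dat T Bt L) (c : Cx T) (η : ℝ) (s : St T Bt L) (E : ℝ≥0) : Prop where
  η0 : 0 ≤ η
  hη : 12 * (c.N : ℝ) ^ 4 * D.w ^ 2 * η ≤ 1
  ηR : 4 * η ≤ D.R
  hK : ∀ i, Bd c.S c.σ c.ρ (s.K i) η
  rK : ∀ i, Rl c.S (s.K i)
  hdK : ∀ k i, Bd c.S c.σ c.ρ (dv (Pi.single k 1) (s.K i)) η
  hV : ∀ l i, Bd c.S c.σ c.ρ (fun p ψ => s.V l i p ψ - D.V₀ l i) η
  hdiv : Div c s.μ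
  rlam : ∀ t, ∀ p ∈ c.S, (s.lam t p).im = 0
  he : ∀ i, c.O 0 (er c.κ c.ω D.β₀ D.f s i) 0 E
  hF : ∀ l i, c.O 0 (FF c.κ c.ω D.β₀ D.f s l i) 0 E
lemma mean_sum {S : Set ℝ} {σ : ℝ≥0∞} {ρ : ℝ} {ι : Type} (s : Finset ι) {w : ι → Fn T} {B : ℝ} (hB : 0 ≤ B) (hρ : 0 ≤ ρ)
    (h : ∀ i, Bd S σ ρ (w i) B) {p : ℝ} (hp : p ∈ S) :
    mean (fun p ψ => ∑ i ∈ s, w i p ψ) p = ∑ i ∈ s, mean (w i) p := by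
  classical
  induction s using Finset.induction_on with
  | empty => simpa using mean_const (d := T) (fun _ => 0) p
  | insert a s ha ih =>
    simp only [Finset.sum_insert ha]
    rw [mean_add (h a) (Bd.fsum s hρ (fun _ => hB) h) hp, ih]
lemma neu {S : Set ℝ} {σ : ℝ≥0∞} {ρ : ℝ} {ι : Type} [Fintype ι] [DecidableEq ι] (A : ι → ι → Fn T) {η : ℝ} (hη : 0 ≤ η)
    (hN : Fintype.card ι * η ≤ 1 / 2) (hρ : 0 ≤ ρ)
    (h : ∀ i j, Bd S σ ρ (fun p ψ => A i j p ψ - if i = j then 1 else 0) η) :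
    ∃ W : ι → ι → Fn T, (∀ i j, Bd S σ ρ (fun p ψ => W i j p ψ - if i = j then 1 else 0) (2 * η)) ∧
      ∀ p ∈ S, ∀ ψ, (∀ i j, ∑ k, A i k p ψ * W k j p ψ = if i = j then 1 else 0) ∧
        ∀ i j, ∑ k, W i k p ψ * A k j p ψ = if i = j then 1 else 0 := by
  obtain ⟨W, h1, h2⟩ := neumann A hη hN hρ h
  refine ⟨W, h1, fun p hp ψ => ⟨fun i j => ?_, fun i j => ?_⟩⟩
  · have := congrFun (congrFun (h2 p hp ψ) i) j
    simpa [Matrix.mul_apply, Matrix.one_apply] using this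
  · have := congrFun (congrFun ((mul_eq_one_comm (M := Matrix ι ι ℂ)).mp (h2 p hp ψ)) i) j
    simpa [Matrix.mul_apply, Matrix.one_apply] using this
variable {D : Dat T Bt L} {c : Cx T} {η : ℝ} {s : St T Bt L} {E : ℝ≥0}
lemma Bd.of_sub {S : Set ℝ} {σ : ℝ≥0∞} {ρ B B' X : ℝ} {u : Fn T} {z : ℂ} (h : Bd S σ ρ (fun p ψ => u p ψ - z) B) (hB : 0 ≤ B)
    (hz : ‖z‖ ≤ B') (hX : B + B' ≤ X) : Bd S σ ρ u X := by
  refine ((h.add (Bd.const h.1 z) hB (norm_nonneg z)).mono (by linarith)).congr fun p _ ψ => by ring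
lemma Cx.O.of_sub {B B' : ℝ} {u : Fn T} {z : ℂ} (h : Bd c.S c.σ c.ρ (fun p ψ => u p ψ - z) B) (hB : 0 ≤ B)
    (hz : ‖z‖ ≤ B') (hX : B + B' ≤ c.X) : c.O 0 u 1 1 := by
  have := h.of_sub hB hz hX
  simpa [Cx.O] using this
lemma norm_single (k : T) : ‖(Pi.single k 1 : T → ℝ)‖ ≤ 1 := by
  rw [Pi.norm_single]; simp
structure Cards (T Bt L : Type) [Fintype T] [Fintype Bt] [Fintype L] (N : ℕ) : Prop where
  t : Fintype.card T ≤ N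
  j : Fintype.card (T ⊕ Bt) ≤ N
  l : Fintype.card L ≤ N
  i : Fintype.card (Ix T Bt) ≤ N
  f : Fintype.card (Fr T L) ≤ N
lemma Env.cards (h : Env D c) : Cards T Bt L c.N := by
  have h1 := h.hN
  have h2 := h.card
  simp only [Fintype.card_sum] at h1 h2
  constructor <;> (try simp only [Fintype.card_sum]) <;> omega
lemma c0 (c : Cx T) : 0 < c.ρ := by have := c.hρ; have := c.hδ; linarith
lemma Good.smalls (h : Good D c η s E) (hE : Env D c) (t : T) : (1:ℝ) ≤ c.N ∧ η ≤ 1 / 12 ∧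
    12 * (c.N : ℝ) ^ 3 * D.w ^ 2 * η ≤ 1 ∧ 12 * (c.N : ℝ) ^ 2 * D.w ^ 2 * η ≤ 1 ∧ 12 * (c.N : ℝ) ^ 2 * D.w * η ≤ 1 := by
  have hN : (1:ℝ) ≤ c.N := by
    have h1 := hE.cards.t
    have : 0 < Fintype.card T := Fintype.card_pos_iff.mpr ⟨t⟩
    exact_mod_cast (show 1 ≤ c.N by omega)
  have hw := hE.w1
  have h0 := h.η0
  have hh := h.hη
  have p1 : (c.N:ℝ)^3 ≤ (c.N:ℝ)^4 := pow_le_pow_right₀ hN (by norm_num)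
  have p2 : (c.N:ℝ)^2 ≤ (c.N:ℝ)^4 := pow_le_pow_right₀ hN (by norm_num)
  have p3 : D.w ≤ D.w ^ 2 := by nlinarith
  have p4 : 1 ≤ (c.N:ℝ)^4 := one_le_pow₀ hN
  have q : ∀ a b : ℝ, 0 ≤ a → 0 ≤ b → a ≤ (c.N:ℝ)^4 → b ≤ D.w^2 → 12 * a * b * η ≤ 1 := fun a b ha hb h1 h2 => by
    refine le_trans ?_ hh
    gcongr
  refine ⟨hN, ?_, q _ _ (by positivity) (by positivity) p1 le_rfl, q _ _ (by positivity) (by positivity) p2 le_rfl,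
    q _ _ (by positivity) (by positivity) p2 p3⟩
  have := q 1 1 (by norm_num) (by norm_num) p4 (by nlinarith); linarith
lemma Good.dP (h : Good D c η s E) (i : Ix T Bt) (b : Fr T L) : Bd c.S c.σ c.ρ (fun p ψ => PP s i b p ψ - P0 D.V₀ i b) η := by
  rcases b with k | k | l
  · exact (h.hdK k i).congr fun p _ ψ => by simp [PP, P0, MM]
  · exact ((Bd.zero (c0 c).le).mono h.η0).congr fun p _ ψ => by simp [PP, P0]
  · exact h.hV l i
lemma norm_P0 (hE : Env D c) (i : Ix T Bt) (b : Fr T L) : ‖P0 D.V₀ i b‖ ≤ D.w := by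
  have := hE.w1
  rcases b with k | k | l
  · simp only [P0, dl]; split_ifs <;> simp <;> linarith
  · simp only [P0, dn]; split_ifs <;> simp <;> linarith
  · exact hE.hv l i
lemma Good.oP (h : Good D c η s E) (hE : Env D c) (t : T) (i : Ix T Bt) (b : Fr T L) : c.O 0 (PP s i b) 1 1 :=
  Cx.O.of_sub (h.dP i b) h.η0 (norm_P0 hE i b) (by have := (h.smalls hE t).2.1; have := hE.w1; have := hE.wX; linarith)
lemma Good.exW (h : Good D c η s E) (hE : Env D c) (t : T) : ∃ W : Fr T L → Ix T Bt → Fn T,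
    (∀ b i, Bd c.S c.σ c.ρ (fun p ψ => W b i p ψ - D.W₀ b i) (2 * c.N ^ 2 * D.w ^ 2 * η)) ∧
    (∀ p ∈ c.S, ∀ ψ, ∀ i i', ∑ b, PP s i b p ψ * W b i' p ψ = if i = i' then 1 else 0) ∧
    (∀ p ∈ c.S, ∀ ψ, ∀ b b', ∑ i, W b i p ψ * PP s i b' p ψ = if b = b' then 1 else 0) := by
  obtain ⟨hN, -, -, s2, s1⟩ := h.smalls hE t
  have hw := hE.w1
  have h0 := h.η0
  have hρ := (c0 c).le
  have ci : (Fintype.card (Ix T Bt) : ℝ) ≤ c.N := by exact_mod_cast hE.cards.i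
  have cf : (Fintype.card (Fr T L) : ℝ) ≤ c.N := by exact_mod_cast hE.cards.f
  have hA : ∀ b b' : Fr T L, Bd c.S c.σ c.ρ (fun p ψ => (∑ i, D.W₀ b i * PP s i b' p ψ) - if b = b' then 1 else 0)
      (c.N * (D.w * η)) := fun b b' => by
    refine ((Bd.fsum Finset.univ hρ (C := fun _ => D.w * η) (fun _ => by positivity) (fun i =>
      ((h.dP i b').smul (D.W₀ b i)).mono (mul_le_mul_of_nonneg_right (hE.hw b i) h0))).mono ?_).congr fun p _ ψ => ?_
    · rw [Finset.sum_const, Finset.card_univ, nsmul_eq_mul]; gcongr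
    · rw [← hE.hW, ← Finset.sum_sub_distrib]
      exact Finset.sum_congr rfl fun i _ => by ring
  obtain ⟨Y, hY, hYA⟩ := neu (fun b b' p ψ => ∑ i, D.W₀ b i * PP s i b' p ψ) (by positivity) (by
    calc (Fintype.card (Fr T L) : ℝ) * (c.N * (D.w * η)) ≤ c.N * (c.N * (D.w * η)) := by gcongr
      _ ≤ 1 / 2 := by nlinarith) hρ hA
  refine ⟨fun b i p ψ => ∑ b', Y b b' p ψ * D.W₀ b' i, fun b i => ?_, ?_⟩
  · refine ((Bd.fsum Finset.univ hρ (C := fun _ => 2 * (c.N * (D.w * η)) * D.w) (fun _ => by positivity) (fun b' =>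
      ((hY b b').mul (Bd.const hρ (D.W₀ b' i)) (by positivity)).mono
        (mul_le_mul_of_nonneg_left (hE.hw b' i) (by positivity)))).mono ?_).congr fun p _ ψ => ?_
    · rw [Finset.sum_const, Finset.card_univ, nsmul_eq_mul]
      calc (Fintype.card (Fr T L) : ℝ) * (2 * (c.N * (D.w * η)) * D.w) ≤ c.N * (2 * (c.N * (D.w * η)) * D.w) := by gcongr
        _ = _ := by ring
    · simp [sub_mul]
  · have key : ∀ p ∈ c.S, ∀ ψ, (Matrix.of fun i b => PP s i b p ψ) *
        ((Matrix.of fun b b' => Y b b' p ψ) * (Matrix.of D.W₀)) = 1 := fun p hp ψ => by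
      have : (Matrix.of D.W₀) * ((Matrix.of fun i b => PP s i b p ψ) * (Matrix.of fun b b' => Y b b' p ψ)) = 1 := by
        rw [← Matrix.mul_assoc]
        ext i j
        simpa [Matrix.mul_apply, Matrix.one_apply] using (hYA p hp ψ).1 i j
      rw [← Matrix.mul_assoc]
      exact (Matrix.mul_eq_one_comm_of_card_eq _ _ _ hE.card.symm).mp this
    refine ⟨fun p hp ψ i i' => ?_, fun p hp ψ b b' => ?_⟩
    · have := congrFun (congrFun (key p hp ψ) i) i'
      simpa [Matrix.mul_apply, Matrix.one_apply] using this
    · have := congrFun (congrFun ((Matrix.mul_eq_one_comm_of_card_eq _ _ _ hE.card).mp (key p hp ψ)) b) b'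
      simpa [Matrix.mul_apply, Matrix.one_apply] using this
structure Frm (D : Dat T Bt L) (c : Cx T) (s : St T Bt L) (W : Fr T L → Ix T Bt → Fn T) (hi : T → T → Fn T)
    (Dm : T → T → ℝ → ℂ) : Prop where
  oW : ∀ b i, c.O 0 (W b i) 1 1
  PW : ∀ p ∈ c.S, ∀ ψ, ∀ i i', ∑ b, PP s i b p ψ * W b i' p ψ = if i = i' then 1 else 0
  WP : ∀ p ∈ c.S, ∀ ψ, ∀ b b', ∑ i, W b i p ψ * PP s i b' p ψ = if b = b' then 1 else 0
  oh : ∀ j k, c.O 0 (hi j k) 1 1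
  hhi : ∀ p ∈ c.S, ∀ ψ, ∀ j k, ∑ k', MM s j (.inl (.inl k')) p ψ * hi k' k p ψ = if j = k then 1 else 0
  hih : ∀ p ∈ c.S, ∀ ψ, ∀ j k, ∑ k', hi j k' p ψ * MM s k' (.inl (.inl k)) p ψ = if j = k then 1 else 0
  oD : ∀ j k, LB c.S c.σ (Dm j k) (ENNReal.ofReal (c.X ^ 1 * (1 : ℝ≥0)))
  hD : ∀ p ∈ c.S, ∀ j k, ∑ k', mean (fun p ψ => ∑ i, W (.inl j) (.inl (.inl i)) p ψ * hi i k' p ψ) p * Dm k' k p =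
    if j = k then 1 else 0
lemma Good.frm (h : Good D c η s E) (hE : Env D c) (t : T) : ∃ W hi Dm, Frm D c s W hi Dm := by
  obtain ⟨W, hW, PW, WP⟩ := h.exW hE t
  obtain ⟨hN, s0, s3, s2, s1⟩ := h.smalls hE t
  have hw := hE.w1
  have hwX := hE.wX
  have h0 := h.η0
  have hρ := (c0 c).le
  have ct : (Fintype.card T : ℝ) ≤ c.N := by exact_mod_cast hE.cards.t
  have n4 : 12 * (c.N : ℝ) ^ 4 * η ≤ 1 := by
    refine le_trans ?_ h.hη
    have : 12 * (c.N : ℝ) ^ 4 * 1 * η ≤ 12 * (c.N : ℝ) ^ 4 * D.w ^ 2 * η := by gcongr; nlinarith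
    linarith
  have n1 : 12 * (c.N : ℝ) * η ≤ 1 := by
    refine le_trans ?_ n4
    have : (c.N:ℝ)^1 ≤ (c.N:ℝ)^4 := pow_le_pow_right₀ hN (by norm_num)
    rw [pow_one] at this; gcongr
  obtain ⟨hi, hh, hhi⟩ := neu (fun j k => MM s j (.inl (.inl k))) (S := c.S) (σ := c.σ) (ρ := c.ρ) h0 (by
    calc (Fintype.card T : ℝ) * η ≤ c.N * η := by gcongr
      _ ≤ 1 / 2 := by nlinarith) hρ (fun j k => (h.hdK j (.inl (.inl k))).congr fun p _ ψ => by
        simp [MM, dl, eq_comm])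
  set ζ := 2 * (c.N : ℝ) ^ 2 * D.w ^ 2 * η with hζ
  have ζ0 : 0 ≤ ζ := by positivity
  have W0a : ∀ j k : T, D.W₀ (.inl j) (.inl (.inl k)) = if j = k then 1 else 0 := fun j k => by
    have := hE.hW (.inl j) (.inl k)
    simpa [P0, dl] using this
  have hiB : ∀ j k, Bd c.S c.σ c.ρ (hi j k) 2 := fun j k =>
    Bd.of_sub (B' := 1) (hh j k) (by positivity) (by split_ifs <;> simp) (by linarith)
  set A : T → T → Fn T := fun j k p ψ => ∑ i, W (.inl j) (.inl (.inl i)) p ψ * hi i k p ψ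
  have hA : ∀ j k, Bd c.S c.σ c.ρ (fun p ψ => A j k p ψ - if j = k then 1 else 0) (c.N * (ζ * 2) + 2 * η) := fun j k => by
    have a1 := Bd.fsum (Finset.univ : Finset T) hρ (C := fun _ => ζ * 2) (fun _ => by positivity) (fun i =>
      (hW (.inl j) (.inl (.inl i))).mul (hiB i k) ζ0)
    refine ((a1.add (hh j k) (Finset.sum_nonneg fun _ _ => by positivity) (by positivity)).mono ?_).congr fun p hp ψ => ?_
    · rw [Finset.sum_const, Finset.card_univ, nsmul_eq_mul]; gcongr
    · simp only [W0a, sub_mul, Finset.sum_sub_distrib, ite_mul, one_mul, zero_mul, Finset.sum_ite_eq, Finset.mem_univ, if_true, A]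
      ring
  have sm : (Fintype.card T : ℝ) * (c.N * (ζ * 2) + 2 * η) ≤ 1 / 2 := by
    have : (Fintype.card T : ℝ) * (c.N * (ζ * 2) + 2 * η) ≤ c.N * (c.N * (ζ * 2) + 2 * η) := by gcongr
    have e : c.N * (c.N * (ζ * 2) + 2 * η) = (12 * (c.N : ℝ) ^ 4 * D.w ^ 2 * η) / 3 + (12 * (c.N : ℝ) * η) / 6 := by
      rw [hζ]; ring
    have := h.hη
    linarith
  have hAb : ∀ j k, Bd c.S c.σ c.ρ (A j k) (c.N * (ζ * 2) + 2 * η + 1) := fun j k =>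
    Bd.of_sub (B' := 1) (hA j k) (by positivity) (by split_ifs <;> simp) le_rfl
  have hmA : ∀ j k, Bd c.S c.σ c.ρ (fun p (_ : T → ℝ) => mean (A j k) p - if j = k then 1 else 0) (c.N * (ζ * 2) + 2 * η) := fun j k => by
    have := Bd.of_LB (d := T) hρ (hA j k).mean
    refine this.congr fun p hp ψ => ?_
    have a := mean_add (hAb j k) (Bd.const (σ := c.σ) hρ (-(if j = k then (1:ℂ) else 0))) hp
    rw [mean_const (fun _ => -(if j = k then (1:ℂ) else 0))] at a
    rw [sub_eq_add_neg, ← a]; exact mean_congr fun ψ => by ring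
  obtain ⟨Y, hY, hYA⟩ := neu (fun j k p _ => mean (A j k) p) (by positivity) sm hρ hmA
  have hc1 : (c.N * (ζ * 2) + 2 * η) ≤ 1 / 2 := by
    have c1 : (1:ℝ) ≤ Fintype.card T := by
      have : 0 < Fintype.card T := Fintype.card_pos_iff.mpr ⟨t⟩
      exact_mod_cast this
    have : 0 ≤ (c.N * (ζ * 2) + 2 * η) := by positivity
    nlinarith
  have hYb : ∀ j k, Bd c.S c.σ c.ρ (Y j k) c.X := fun j k =>
    Bd.of_sub (B' := 1) (hY j k) (by positivity) (by split_ifs <;> simp) (by linarith)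
  refine ⟨W, hi, fun j k => mean (Y j k), ⟨fun b i => ?_, PW, WP, fun j k => ?_, fun p hp ψ => (hhi p hp ψ).1,
    fun p hp ψ => (hhi p hp ψ).2, fun j k => ?_, fun p hp j k => ?_⟩⟩
  · exact Cx.O.of_sub (hW b i) ζ0 (hE.hw b i) (by rw [hζ]; linarith)
  · have := (hiB j k).mono (show 2 ≤ c.X by linarith)
    simpa [Cx.O] using this
  · simpa using (hYb j k).mean
  · have X0 := Cx.X0 (c := c)
    have e1 : ∀ k', mean (A j k') p * mean (Y k' k) p = mean (fun p ψ => mean (A j k') p * Y k' k p ψ) p := fun k' =>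
      (mean_smul (mean (A j k')) (Y k' k) p).symm
    have e2 := mean_sum Finset.univ (B := (c.N * (ζ * 2) + 2 * η + 1) * c.X) (by positivity) hρ (fun k' =>
      (Bd.of_LB (d := T) hρ (hAb j k').mean).mul (hYb k' k) (by positivity)) hp
    have e3 := mean_congr (p := p) (u := fun p ψ => ∑ k', mean (A j k') p * Y k' k p ψ) (v := fun _ (_ : T → ℝ) => if j = k then 1 else 0) (fun ψ => (hYA p hp ψ).1 j k)
    rw [mean_const (fun _ => if j = k then (1:ℂ) else 0)] at e3
    rw [e2] at e3
    rw [← e3]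
    exact Finset.sum_congr rfl fun k' _ => e1 k'
end frame
end
section
section sympl
variable {T Bt L : Type} [Fintype T] [Fintype Bt] [Fintype L] [DecidableEq T] [DecidableEq Bt] [DecidableEq L]
variable {D : Dat T Bt L} {c : Cx T} {η : ℝ} {s : St T Bt L} {E : ℝ≥0}
lemma dv_sub {u v : Fn T} {p : ℝ} (h : Dif u p) (h' : Dif v p) (w ψ : T → ℝ) :
    dv w (fun p ψ => u p ψ - v p ψ) p ψ = dv w u p ψ - dv w v p ψ := deriv_fun_sub (h ψ w) (h' ψ w)
lemma Dif.sub {u v : Fn T} {p : ℝ} (h : Dif u p) (h' : Dif v p) : Dif (fun p ψ => u p ψ - v p ψ) p :=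
  fun ψ w => (h ψ w).sub (h' ψ w)
noncomputable abbrev de (D : Dat T Bt L) (c : Cx T) (s : St T Bt L) (k : T) (i : Ix T Bt) : Fn T :=
  dv (Pi.single k 1) (er c.κ c.ω D.β₀ D.f s i)
lemma Good.dK (h : Good D c η s E) {p : ℝ} (hp : p ∈ c.S) (i) : Dif (s.K i) p := (h.hK i).dif (c0 c) hp
lemma Good.dMM (h : Good D c η s E) {p : ℝ} (hp : p ∈ c.S) (k i) : Dif (MM s k i) p :=
  ((h.hdK k i).dif (c0 c) hp).add (Dif.const (fun _ => dl i k) p)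
lemma Good.dV (h : Good D c η s E) (hE : Env D c) (t : T) {p : ℝ} (hp : p ∈ c.S) (l i) : Dif (s.V l i) p :=
  (h.oP hE t i (.inr (.inr l))).dif hp
lemma Good.dPP (h : Good D c η s E) (hE : Env D c) (t : T) {p : ℝ} (hp : p ∈ c.S) (i a) : Dif (PP s i a) p :=
  (h.oP hE t i a).dif hp
lemma Good.dDK (h : Good D c η s E) {p : ℝ} (hp : p ∈ c.S) (i) : Dif (DD c.κ c.ω (s.K i)) p :=
  (Dif.const (fun p => ((c.κ p : ℝ) : ℂ)⁻¹) p).mul (((h.hK i).dv (δ := c.ρ / 2) (by linarith [c0 c]) (by linarith [c0 c]) c.ω).dif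
    (by linarith [c0 c]) hp)
lemma Good.dv_DD (h : Good D c η s E) {p : ℝ} (hp : p ∈ c.S) (i) (k : T) (ψ) :
    dv (Pi.single k 1) (DD c.κ c.ω (s.K i)) p ψ = DD c.κ c.ω (MM s k i) p ψ := by
  have e1 : dv (Pi.single k 1) (DD c.κ c.ω (s.K i)) p ψ = ((c.κ p : ℝ) : ℂ)⁻¹ * dv (Pi.single k 1) (dv c.ω (s.K i)) p ψ :=
    dv_smul (fun p => ((c.κ p : ℝ) : ℂ)⁻¹) (dv c.ω (s.K i)) p _ ψ
  have e2 : DD c.κ c.ω (MM s k i) p ψ = DD c.κ c.ω (dv (Pi.single k 1) (s.K i)) p ψ + DD c.κ c.ω (fun _ _ => dl i k) p ψ :=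
    DD_add ((h.hdK k i).dif (c0 c) hp) (Dif.const (fun _ => dl i k) p) ψ
  rw [e1, e2, DD_const (fun _ => dl i k), add_zero, (h.hK i).dv_comm (c0 c) hp, DD]
lemma Good.hM (h : Good D c η s E) (hE : Env D c) {p : ℝ} (hp : p ∈ c.S) (k : T) (i : Ix T Bt) (ψ : T → ℝ) :
    DD c.κ c.ω (MM s k i) p ψ - BB (QQ D.β₀ D.f s.K) (MM s k) i p ψ = de D c s k i p ψ := by
  rcases i with j | j
  · have : de D c s k (.inl j) p ψ = dv (Pi.single k 1) (DD c.κ c.ω (s.K (.inl j))) p ψ - dv (Pi.single k 1) (s.K (.inr j)) p ψ :=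
      dv_sub (h.dDK hp _) (h.dK hp _) _ ψ
    rw [this, h.dv_DD hp]
    simp [BB, MM, dl]
  · have hc := (hE.hg j).chain hE.hR (u := fun j => s.K (.inl j)) (β₀ := D.β₀) (fun j => h.dK hp _) hp (fun j => h.rK _) (Pi.single k 1) ψ
    have e0 := dv_sub ((h.dDK hp (.inr j)).add hc.1)
      (Dif.const (fun p => Sum.elim (fun t => s.lam t p) (fun _ => 0) j) p) (Pi.single k 1) ψ
    rw [dv_const (fun p => Sum.elim (fun t => s.lam t p) (fun _ => 0) j), dv_add (h.dDK hp (.inr j)) hc.1, hc.2,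
      h.dv_DD hp, sub_zero] at e0
    have e1 : de D c s k (.inr j) p ψ = _ := e0
    rw [e1]
    simp only [BB, sub_neg_eq_add, add_right_inj]
    refine Finset.sum_congr rfl fun i _ => ?_
    simp only [QQ, MM, dl]
    rcases i with i | i
    · by_cases hik : i = k <;> simp [Pi.single_apply, hik, add_comm]
    · simp
noncomputable def sg (v w : Ix T Bt → Fn T) : Fn T := fun p ψ =>
  ∑ i, (v (.inl i) p ψ * w (.inr i) p ψ - v (.inr i) p ψ * w (.inl i) p ψ)
lemma O.sg (hE : Env D c) {v w : Ix T Bt → Fn T} {j k k' : ℕ} {e : ℝ≥0} (hv : ∀ i, c.O j (v i) k e) (hw : ∀ i, c.O j (w i) k' 1)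
    (hj : j ≤ 20 := by omega) : c.O j (sg v w) (k + k' + 2) e :=
  Cx.O.sum hE.cards.j (fun i => ((hv _).mulr (hw _)).sub ((hv _).mulr (hw _))) hj
lemma O.sg' (hE : Env D c) {v w : Ix T Bt → Fn T} {j k k' : ℕ} {e : ℝ≥0} (hv : ∀ i, c.O j (v i) k 1) (hw : ∀ i, c.O j (w i) k' e)
    (hj : j ≤ 20 := by omega) : c.O j (KAM.sg v w) (k + k' + 2) e :=
  Cx.O.sum hE.cards.j (fun i => ((hv _).mull (hw _)).sub ((hv _).mull (hw _))) hj
lemma QQ_symm (h : Good D c η s E) (hE : Env D c) {p : ℝ} (hp : p ∈ c.S) (i j) (ψ : T → ℝ) :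
    QQ D.β₀ D.f s.K i j p ψ = QQ D.β₀ D.f s.K j i p ψ :=
  hE.hf.dv_comm hE.hR hp _ _ _
lemma Dsg {v w a b : Ix T Bt → Fn T} {Q : T ⊕ Bt → T ⊕ Bt → Fn T} {p : ℝ} {ψ : T → ℝ} (hQ : ∀ i j, Q i j p ψ = Q j i p ψ)
    (hv : ∀ i, Dif (v i) p) (hw : ∀ i, Dif (w i) p)
    (h1 : ∀ i, DD c.κ c.ω (v i) p ψ - BB Q v i p ψ = a i p ψ) (h2 : ∀ i, DD c.κ c.ω (w i) p ψ - BB Q w i p ψ = b i p ψ) :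
    DD c.κ c.ω (sg v w) p ψ = sg a w p ψ + sg v b p ψ := by
  have e0 : ∀ i, DD c.κ c.ω (fun p ψ => v (.inl i) p ψ * w (.inr i) p ψ - v (.inr i) p ψ * w (.inl i) p ψ) p ψ =
      DD c.κ c.ω (v (.inl i)) p ψ * w (.inr i) p ψ + v (.inl i) p ψ * DD c.κ c.ω (w (.inr i)) p ψ
      - (DD c.κ c.ω (v (.inr i)) p ψ * w (.inl i) p ψ + v (.inr i) p ψ * DD c.κ c.ω (w (.inl i)) p ψ) := fun i => by
    rw [← DD_mul (hv _) (hw _), ← DD_mul (hv _) (hw _)]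
    simp only [DD]; rw [dv_sub ((hv _).mul (hw _)) ((hv _).mul (hw _))]; ring
  have e1 : DD c.κ c.ω (sg v w) p ψ = _ := DD_sum (fun i => ((hv (.inl i)).mul (hw (.inr i))).sub ((hv (.inr i)).mul (hw (.inl i)))) ψ
  rw [e1]; simp only [e0]
  have a1 : ∀ i, DD c.κ c.ω (v i) p ψ = BB Q v i p ψ + a i p ψ := fun i => by rw [← h1]; ring
  have a2 : ∀ i, DD c.κ c.ω (w i) p ψ = BB Q w i p ψ + b i p ψ := fun i => by rw [← h2]; ring
  simp only [a1, a2, sg, BB]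
  have key : (∑ i, ∑ k, v (.inl i) p ψ * (Q i k p ψ * w (.inl k) p ψ)) = ∑ i, ∑ k, Q i k p ψ * v (.inl k) p ψ * w (.inl i) p ψ := by
    rw [Finset.sum_comm]
    refine Finset.sum_congr rfl fun i _ => Finset.sum_congr rfl fun k _ => ?_
    rw [hQ k i]; ring
  simp only [← Finset.mul_sum, ← Finset.sum_mul] at key
  rw [← Finset.sum_add_distrib, ← sub_eq_zero, ← Finset.sum_sub_distrib]
  rw [← sub_eq_zero, ← Finset.sum_sub_distrib] at key
  rw [← neg_eq_zero, ← Finset.sum_neg_distrib, ← key]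
  exact Finset.sum_congr rfl fun i _ => by ring
lemma Good.ode (h : Good D c η s E) (hj : T) (i : Ix T Bt) : c.O 1 (de D c s hj i) 1 E :=
  (h.he i).dv (norm_single _)
lemma Good.oG (h : Good D c η s E) (hE : Env D c) (j k : T) : c.O 2 (sg (MM s j) (MM s k)) (5 + c.K) E := by
  have oM : ∀ k i, c.O 0 (MM s k i) 1 1 := fun k i => h.oP hE k i (.inl k)
  have hG : c.O 1 (fun p ψ => sg (de D c s j) (MM s k) p ψ + sg (MM s j) (de D c s k) p ψ) 5 E :=
    (O.sg hE (k := 1) (k' := 1) (fun i => h.ode j i) (fun i => (oM k i).up)).add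
      (O.sg' hE (fun i => (oM j i).up) (fun i => h.ode k i))
  have hu : c.O 1 (sg (MM s j) (MM s k)) 4 1 := O.sg hE (k := 1) (k' := 1) (fun i => (oM j i).up) (fun i => (oM k i).up)
  obtain ⟨h1, -⟩ := Cx.apriori (h.hdiv.hnr none none) (h.hdiv.hm none none) hu hG (fun p hp ψ => by
    rw [Dsg (QQ_symm h hE hp · · ψ) (h.dMM hp j) (h.dMM hp k) (fun i => h.hM hE hp j i ψ) (fun i => h.hM hE hp k i ψ)]
    simp)
  refine h1.congr fun p hp ψ => ?_
  suffices mean (sg (MM s j) (MM s k)) p = 0 by rw [this, sub_zero]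
  have bA : ∀ j i, c.O 0 (fun p ψ => MM s j (.inl i) p ψ * s.K (.inr i) p ψ) 2 1 := fun j i => (oM j _).mulr (k' := 1) (by
    have := (h.smalls hE j).2.1
    have := c.hX
    have := (h.hK (.inr i)).mono (show η ≤ c.X by linarith)
    simpa [Cx.O] using this)
  have bS : ∀ j, c.O 0 (fun p ψ => ∑ i, MM s j (.inl i) p ψ * s.K (.inr i) p ψ) 3 1 := fun j => Cx.O.sum hE.cards.j (bA j)
  have bD : ∀ k j, c.O 1 (dv (Pi.single k 1) (fun p ψ => ∑ i, MM s j (.inl i) p ψ * s.K (.inr i) p ψ)) 4 1 := fun k j =>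
    (bS j).dv (norm_single k)
  have z : ∀ k j, mean (dv (Pi.single k 1) (fun p ψ => ∑ i, MM s j (.inl i) p ψ * s.K (.inr i) p ψ)) p = 0 := fun k j =>
    Bd.mean_dv (bS j) (Cx.lev0 (by omega)) hp _
  have e := mean_add (bD k j) (bD j k).neg hp
  have e2 := mean_smul (fun _ => -1) (dv (Pi.single j 1) (fun p ψ => ∑ i, MM s k (.inl i) p ψ * s.K (.inr i) p ψ)) p
  simp only [neg_mul, one_mul] at e2
  rw [e2, z, z, neg_zero, add_zero] at e
  rw [← e]
  refine mean_congr fun ψ => ?_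
  have x : ∀ k j, dv (Pi.single k 1) (fun p ψ => ∑ i, MM s j (.inl i) p ψ * s.K (.inr i) p ψ) p ψ =
      ∑ i, (dv (Pi.single k 1) (MM s j (.inl i)) p ψ * s.K (.inr i) p ψ + MM s j (.inl i) p ψ * dv (Pi.single k 1) (s.K (.inr i)) p ψ) :=
    fun k j => by
      rw [dv_sum _ (fun i => (h.dMM hp j (.inl i)).mul (h.dK hp (.inr i)))]
      exact Finset.sum_congr rfl fun i _ => dv_mul (h.dMM hp j (.inl i)) (h.dK hp (.inr i)) _ _
  rw [x, x, ← sub_eq_add_neg, ← Finset.sum_sub_distrib]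
  refine Finset.sum_congr rfl fun i _ => ?_
  have y : ∀ k j, dv (Pi.single k 1) (MM s j (.inl i)) p ψ = dv (Pi.single k 1) (dv (Pi.single j 1) (s.K (.inl i))) p ψ := fun k j => by
    have : dv (Pi.single k 1) (MM s j (.inl i)) p ψ = _ := dv_add ((h.hdK j (.inl i)).dif (c0 c) hp) (Dif.const (fun _ => dl (.inl i) j) p) (Pi.single k 1) ψ
    rw [this, dv_const (fun _ => dl (.inl i) j), add_zero]
  rw [y, y, (h.hK _).dv_comm (c0 c) hp (Pi.single k 1)]
  simp [MM, dl]; ring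
lemma Good.oH (h : Good D c η s E) (hE : Env D c) (j : T) (l : L) : c.O 2 (sg (MM s j) (s.V l)) (6 + c.K) E := by
  have oM : ∀ k i, c.O 0 (MM s k i) 1 1 := fun k i => h.oP hE k i (.inl k)
  have oV : ∀ i, c.O 0 (s.V l i) 1 1 := fun i => h.oP hE j i (.inr (.inr l))
  have hG : c.O 1 (fun p ψ => sg (de D c s j) (s.V l) p ψ + sg (MM s j) (FF c.κ c.ω D.β₀ D.f s l) p ψ) 5 E :=
    (O.sg hE (k := 1) (k' := 1) (fun i => h.ode j i) (fun i => (oV i).up)).add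
      (O.sg' hE (fun i => (oM j i).up) (fun i => (h.hF l i).up))
  have hu : c.O 1 (sg (MM s j) (s.V l)) 4 1 := O.sg hE (k := 1) (k' := 1) (fun i => (oM j i).up) (fun i => (oV i).up)
  have := Cx.apriori' (h.hdiv.hnr (some l) none) (h.hdiv.hm _ _) (h.hdiv.hi (some l) none (by simp)).1 (h.hdiv.hi (some l) none (by simp)).2
    hu hG (fun p hp ψ => by
      rw [Dsg (b := fun i p ψ => FF c.κ c.ω D.β₀ D.f s l i p ψ - s.μ l p * s.V l i p ψ) (QQ_symm h hE hp · · ψ) (h.dMM hp j)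
        (h.dV hE j hp l) (fun i => h.hM hE hp j i ψ) (fun i => by simp [FF])]
      simp only [sg, mo, sub_zero, add_assoc, add_right_inj]
      rw [Finset.mul_sum, ← Finset.sum_add_distrib]
      exact Finset.sum_congr rfl fun i _ => by ring)
  exact this.up
noncomputable def th (D : Dat T Bt L) (c : Cx T) (s : St T Bt L) (W : Fr T L → Ix T Bt → Fn T) (j k : T) : Fn T := fun p ψ =>
  de D c s j (.inl (.inl k)) p ψ - ((∑ k', sg (MM s j) (MM s k') p ψ * W (.inl k') (.inl (.inl k)) p ψ)
    + ∑ l, sg (MM s j) (s.V l) p ψ * W (.inr (.inr l)) (.inl (.inl k)) p ψ)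
variable {W : Fr T L → Ix T Bt → Fn T} {hi : T → T → Fn T} {Dm : T → T → ℝ → ℂ}
lemma Good.oth (h : Good D c η s E) (hE : Env D c) (F : Frm D c s W hi Dm) (j k : T) : c.O 2 (th D c s W j k) (10 + c.K) E := by
  have a1 : c.O 2 (fun p ψ => ∑ k', sg (MM s j) (MM s k') p ψ * W (.inl k') (.inl (.inl k)) p ψ) (8 + c.K) E :=
    (Cx.O.sum hE.cards.t (fun k' => (h.oG hE j k').mulr ((F.oW (.inl k') (.inl (.inl k))).up (k' := 1)))).up
      ⟨le_rfl, by omega, by unfold Cx.K; omega⟩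
  have a2 : c.O 2 (fun p ψ => ∑ l, sg (MM s j) (s.V l) p ψ * W (.inr (.inr l)) (.inl (.inl k)) p ψ) (8 + c.K) E :=
    (Cx.O.sum hE.cards.l (fun l => (h.oH hE j l).mulr ((F.oW (.inr (.inr l)) (.inl (.inl k))).up (k' := 1)))).up
      ⟨le_rfl, by omega, by unfold Cx.K; omega⟩
  exact ((h.ode j (.inl (.inl k))).up.sub (a1.add a2)).up ⟨le_rfl, by omega, by unfold Cx.K; omega⟩
lemma Good.Dh (h : Good D c η s E) (hE : Env D c) (F : Frm D c s W hi Dm) {p : ℝ} (hp : p ∈ c.S) (j k : T) (ψ : T → ℝ) :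
    DD c.κ c.ω (MM s j (.inl (.inl k))) p ψ =
      th D c s W j k p ψ - ∑ k', MM s j (.inl (.inl k')) p ψ * W (.inr (.inl k')) (.inl (.inl k)) p ψ := by
  have e := h.hM hE hp j (.inl (.inl k)) ψ
  have key : - MM s j (.inr (.inl k)) p ψ = ∑ b, (∑ i, (MM s j (.inl i) p ψ * PP s (.inr i) b p ψ
      - MM s j (.inr i) p ψ * PP s (.inl i) b p ψ)) * W b (.inl (.inl k)) p ψ := by
    have : ∀ b, (∑ i, (MM s j (.inl i) p ψ * PP s (.inr i) b p ψ
      - MM s j (.inr i) p ψ * PP s (.inl i) b p ψ)) * W b (.inl (.inl k)) p ψ =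
        ∑ i, (MM s j (.inl i) p ψ * (PP s (.inr i) b p ψ * W b (.inl (.inl k)) p ψ)
          - MM s j (.inr i) p ψ * (PP s (.inl i) b p ψ * W b (.inl (.inl k)) p ψ)) := fun b => by
      rw [Finset.sum_mul]; exact Finset.sum_congr rfl fun i _ => by ring
    simp only [this]
    rw [Finset.sum_comm]
    simp only [Finset.sum_sub_distrib, ← Finset.mul_sum, F.PW p hp ψ]
    simp [Finset.sum_ite_eq']
  rw [Fintype.sum_sum_type, Fintype.sum_sum_type] at key
  have a2 : ∀ k', (∑ i, (MM s j (.inl i) p ψ * PP s (.inr i) (.inr (.inl k')) p ψ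
      - MM s j (.inr i) p ψ * PP s (.inl i) (.inr (.inl k')) p ψ)) = MM s j (.inl (.inl k')) p ψ := fun k' => by
    simp [PP, dn]
  simp only [a2] at key
  have e' : BB (QQ D.β₀ D.f s.K) (MM s j) (.inl (.inl k)) p ψ = MM s j (.inr (.inl k)) p ψ := rfl
  rw [e'] at e
  unfold th sg
  simp only [PP] at key
  linear_combination e - key
end sympl
end
section
section lin
variable {T Bt L : Type} [Fintype T] [Fintype Bt] [Fintype L] [DecidableEq T] [DecidableEq Bt] [DecidableEq L]
variable {D : Dat T Bt L} {c : Cx T} {η : ℝ} {s : St T Bt L} {E : ℝ≥0}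
variable {W : Fr T L → Ix T Bt → Fn T} {hi : T → T → Fn T} {Dm : T → T → ℝ → ℂ}
lemma mean_sumO {ι : Type} [Fintype ι] {j k : ℕ} {e : ℝ≥0} {w : ι → Fn T} (h : ∀ i, c.O j (w i) k e) (hj : j ≤ 20) {p : ℝ} (hp : p ∈ c.S) :
    mean (fun p ψ => ∑ i, w i p ψ) p = ∑ i, mean (w i) p :=
  mean_sum Finset.univ Cx.Xk0 (Cx.lev0 hj).le h hp
lemma Good.lin (h : Good D c η s E) (hE : Env D c) (F : Frm D c s W hi Dm) (t : T) (o : Option L) {G : Fr T L → Fn T} {j k : ℕ} {e : ℝ≥0}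
    (hG : ∀ b, c.O j (G b) k e) (hj : 2 ≤ j ∧ j ≤ 16)
    (ho : o = none → ∀ p ∈ c.S, ∀ j, mean (fun p ψ => ∑ k, MM s j (.inl (.inl k)) p ψ * G (.inr (.inl k)) p ψ) p = 0) :
    ∃ (ξ J : Ix T Bt → Fn T) (α : L → ℝ → ℂ), (∀ i, c.O (j + 2) (ξ i) (k + 6 * c.K) e) ∧
      (∀ i, c.O (j + 2) (J i) (k + 7 * c.K) (E * e)) ∧
      (∀ l, LB c.S c.σ (α l) (ENNReal.ofReal (c.X ^ (k + 4 * c.K) * e))) ∧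
      ∀ p ∈ c.S, ∀ ψ i, DD c.κ c.ω (ξ i) p ψ + mo s.μ o p * ξ i p ψ - BB (QQ D.β₀ D.f s.K) ξ i p ψ =
        (∑ b, PP s i b p ψ * G b p ψ) - (∑ l, s.V l i p ψ * if o = some l then α l p else 0) + J i p ψ := by
  have hK := K6 c
  have oM : ∀ k k', c.O 0 (MM s k (.inl (.inl k'))) 1 1 := fun k k' => h.oP hE k (.inl (.inl k')) (.inl k)
  have j3 : j + 2 ≤ 20 := by omega
  have h1 : ∀ i, c.O j (fun p ψ => ∑ k, MM s i (.inl (.inl k)) p ψ * G (.inr (.inl k)) p ψ) (1 + k + 1) e := fun i =>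
    Cx.O.sum hE.cards.t (fun k => ((oM i k).up (k' := 1)).mull (hG (.inr (.inl k))))
  choose nt hnt hnt2 using fun i => h.hdiv.solve o none (h1 i)
  have ont : ∀ i, c.O (j + 1) (nt i) (k + c.K + 3) e := fun i => (hnt i).up
  have Xn : ∀ i, c.O (j + 1) (fun p ψ => ∑ k', hi i k' p ψ * nt k' p ψ) (k + c.K + 5) e := fun i =>
    (Cx.O.sum hE.cards.t (fun k' => ((F.oh i k').up (k' := 1)).mull (ont k'))).up ⟨le_rfl, by omega, by omega⟩
  have oWx : ∀ b i j, j ≤ 20 → c.O j (W b i) 1 1 := fun b i j hj => (F.oW b i).up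
  set r : T → Fn T := fun i p ψ => G (.inl i) p ψ + ∑ k, W (.inl i) (.inl (.inl k)) p ψ * ∑ k', hi k k' p ψ * nt k' p ψ with hr
  have or : ∀ i, c.O (j + 1) (r i) (k + c.K + 8) e := fun i =>
    (((hG (.inl i)).up (k' := k + c.K + 7)).add ((Cx.O.sum hE.cards.t (fun k' => (oWx (.inl i) (.inl (.inl k')) _ (by omega)).mull (Xn k'))).up
      ⟨le_rfl, by omega, by omega⟩)).up
  set C : T → ℝ → ℂ := fun i p => if o = none then - ∑ k, Dm i k p * mean (r k) p else 0 with hC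
  have oC : ∀ i, c.O (j + 1) (fun p (_ : T → ℝ) => C i p) (k + c.K + 10) e := fun i => by
    by_cases hn : o = none
    · simp only [hC, if_pos hn]
      have a1 := fun k => (Cx.O.of_LB (j := j + 1) (F.oD i k)).mull (Cx.O.of_LB (j := j + 1) (or k).mean)
      exact ((Cx.O.sum hE.cards.t a1).neg).up ⟨le_rfl, by omega, by omega⟩
    · simp only [hC, if_neg hn]; exact Cx.O.zero
  set n : T → Fn T := fun i p ψ => ∑ k', hi i k' p ψ * (nt k' p ψ + C k' p) with hn
  have on : ∀ i, c.O (j + 1) (n i) (k + c.K + 13) e := fun i =>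
    (Cx.O.sum hE.cards.t (fun k' => ((F.oh i k').up (k' := 1)).mull (((ont k').up (k' := k + c.K + 10)).add (oC k')))).up
      ⟨le_rfl, by omega, by omega⟩
  have hnn : ∀ p ∈ c.S, ∀ ψ, ∀ i, ∑ k, MM s i (.inl (.inl k)) p ψ * n k p ψ = nt i p ψ + C i p := fun p hp ψ i => by
    simp only [hn, Finset.mul_sum]
    rw [Finset.sum_comm]
    simp only [← mul_assoc, ← Finset.sum_mul, F.hhi p hp ψ]
    simp
  set ν : T → Fn T := fun i p ψ => ∑ j, hi i j p ψ * ∑ k, th D c s W j k p ψ * n k p ψ with hν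
  have oν : ∀ i, c.O (j + 1) (ν i) (k + 2 * c.K + 26) (E * e) := fun i =>
    (Cx.O.sum hE.cards.t (fun j' => ((F.oh i j').up (k' := 1)).mull (Cx.O.sum hE.cards.t (fun k' =>
      ((h.oth hE F j' k').up (j' := j + 1) (k' := 10 + c.K)).mul (on k'))))).up ⟨le_rfl, by omega, by omega⟩
  have eqn : ∀ p ∈ c.S, ∀ ψ i, DD c.κ c.ω (n i) p ψ + mo s.μ o p * n i p ψ =
      G (.inr (.inl i)) p ψ + (∑ k, W (.inr (.inl i)) (.inl (.inl k)) p ψ * n k p ψ) - ν i p ψ := fun p hp ψ i => by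
    have a1 : ∀ i, DD c.κ c.ω (nt i) p ψ + mo s.μ o p * (nt i p ψ + C i p) = ∑ k, MM s i (.inl (.inl k)) p ψ * G (.inr (.inl k)) p ψ :=
      fun i => by
        have := hnt2 i p hp ψ
        by_cases hno : o = none
        · have h0 := ho hno p hp i
          rw [if_pos hno, h0] at this
          subst hno
          simp only [mo] at this ⊢
          linear_combination this
        · rw [if_neg hno] at this
          simp only [hC, if_neg hno]
          simp only [mo] at this ⊢
          linear_combination this
    have a2 : ∀ i, (∑ k, (DD c.κ c.ω (MM s i (.inl (.inl k))) p ψ * n k p ψ + MM s i (.inl (.inl k)) p ψ * DD c.κ c.ω (n k) p ψ)) =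
        DD c.κ c.ω (nt i) p ψ := fun i => by
      have b1 := DD_sum (κ := c.κ) (ω := c.ω) (fun k => (h.dMM hp i (.inl (.inl k))).mul ((on k).dif hp)) ψ
      rw [DD_congr (v := fun p ψ => nt i p ψ + C i p) (fun ψ => hnn p hp ψ i), DD_add ((ont i).dif hp) (Dif.const (C i) p),
        DD_const (C i), add_zero] at b1
      rw [b1]
      exact Finset.sum_congr rfl fun k _ => (DD_mul (h.dMM hp i (.inl (.inl k))) ((on k).dif hp) ψ).symm
    have a3 : ∀ i, (∑ k, MM s i (.inl (.inl k)) p ψ * (DD c.κ c.ω (n k) p ψ + mo s.μ o p * n k p ψ - G (.inr (.inl k)) p ψ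
        - ∑ k', W (.inr (.inl k)) (.inl (.inl k')) p ψ * n k' p ψ)) = - ∑ k, th D c s W i k p ψ * n k p ψ := fun i => by
      have b2 := a2 i
      simp only [h.Dh hE F hp, sub_mul, Finset.sum_add_distrib, Finset.sum_sub_distrib, Finset.sum_mul] at b2
      rw [Finset.sum_comm (f := fun x i_1 => MM s i (.inl (.inl i_1)) p ψ * W (.inr (.inl i_1)) (.inl (.inl x)) p ψ * n x p ψ)] at b2
      have b1 := a1 i
      rw [← hnn p hp ψ i] at b1
      simp only [mul_sub, mul_add, Finset.sum_add_distrib, Finset.sum_sub_distrib, Finset.mul_sum, ← mul_assoc] at b1 b2 ⊢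
      have b3 : ∑ k, MM s i (.inl (.inl k)) p ψ * mo s.μ o p * n k p ψ = ∑ k, mo s.μ o p * MM s i (.inl (.inl k)) p ψ * n k p ψ :=
        Finset.sum_congr rfl fun k _ => by ring
      rw [b3]
      linear_combination b1 + b2
    have a4 : ν i p ψ = - ∑ j, hi i j p ψ * (∑ k, MM s j (.inl (.inl k)) p ψ * (DD c.κ c.ω (n k) p ψ + mo s.μ o p * n k p ψ - G (.inr (.inl k)) p ψ
        - ∑ k', W (.inr (.inl k)) (.inl (.inl k')) p ψ * n k' p ψ)) := by
      simp only [a3, hν]; simp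
    have a5 : (∑ j, hi i j p ψ * (∑ k, MM s j (.inl (.inl k)) p ψ * (DD c.κ c.ω (n k) p ψ + mo s.μ o p * n k p ψ - G (.inr (.inl k)) p ψ
        - ∑ k', W (.inr (.inl k)) (.inl (.inl k')) p ψ * n k' p ψ))) = DD c.κ c.ω (n i) p ψ + mo s.μ o p * n i p ψ - G (.inr (.inl i)) p ψ
        - ∑ k', W (.inr (.inl i)) (.inl (.inl k')) p ψ * n k' p ψ := by
      simp only [Finset.mul_sum]
      rw [Finset.sum_comm]
      simp only [← mul_assoc, ← Finset.sum_mul, F.hih p hp ψ]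
      simp [mul_assoc]
    rw [a4, a5]; ring
  have orr : ∀ b, c.O (j + 1) (fun p ψ => G b p ψ + ∑ k, W b (.inl (.inl k)) p ψ * n k p ψ) (k + c.K + 16) e := fun b =>
    (((hG b).up (k' := k + c.K + 15)).add ((Cx.O.sum hE.cards.t (fun k' => (oWx b (.inl (.inl k')) _ (by omega)).mull (on k'))).up
      ⟨le_rfl, by omega, by omega⟩)).up
  have mr : o = none → ∀ p ∈ c.S, ∀ i, mean (fun p ψ => G (.inl i) p ψ + ∑ k, W (.inl i) (.inl (.inl k)) p ψ * n k p ψ) p = 0 := fun hno p hp i => by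
    have oA : ∀ k', c.O (j + 1) (fun p ψ => ∑ m, W (.inl i) (.inl (.inl m)) p ψ * hi m k' p ψ) (1 + 1 + 1) 1 := fun k' =>
      Cx.O.sum hE.cards.t (fun m => (oWx (.inl i) (.inl (.inl m)) _ (by omega)).mull ((F.oh m k').up))
    have a0 := mean_congr (p := p) (u := fun p ψ => G (.inl i) p ψ + ∑ k, W (.inl i) (.inl (.inl k)) p ψ * n k p ψ)
      (v := fun p ψ => r i p ψ + ∑ k', C k' p * ∑ m, W (.inl i) (.inl (.inl m)) p ψ * hi m k' p ψ) (fun ψ => by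
        simp only [hr, hn, mul_add, Finset.sum_add_distrib, Finset.mul_sum]
        rw [add_assoc]; congr 2
        rw [Finset.sum_comm]
        exact Finset.sum_congr rfl fun _ _ => Finset.sum_congr rfl fun _ _ => by ring)
    have a2 : ∀ k', c.O (j + 1) (fun p ψ => C k' p * ∑ m, W (.inl i) (.inl (.inl m)) p ψ * hi m k' p ψ) (k + c.K + 10 + (1 + 1 + 1)) e :=
      fun k' => (oC k').mulr (oA k')
    have a1 : mean _ p = _ := mean_add (or i) (Cx.O.sum hE.cards.t a2) hp
    rw [a0, a1, mean_sumO a2 (by omega) hp]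
    simp only [mean_smul]
    have a3 : ∀ k', C k' p = - ∑ k, Dm k' k p * mean (r k) p := fun k' => by simp only [hC, if_pos hno]
    simp only [a3, neg_mul, Finset.sum_neg_distrib, Finset.sum_mul]
    rw [Finset.sum_comm]
    have a4 : ∀ k, (∑ k', Dm k' k p * mean (r k) p * mean (fun p ψ => ∑ m, W (.inl i) (.inl (.inl m)) p ψ * hi m k' p ψ) p) =
        (if i = k then 1 else 0) * mean (r k) p := fun k => by
      rw [← F.hD p hp i k, Finset.sum_mul]
      exact Finset.sum_congr rfl fun _ _ => by ring
    simp only [a4]; simp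
  choose P hP hP2 using fun i => h.hdiv.solve o none (orr (.inl i))
  choose q hq hq2 using fun l => h.hdiv.solve o (some l) (orr (.inr (.inr l)))
  set z : Fr T L → Fn T := Sum.elim P (Sum.elim n q) with hz
  have oz : ∀ b, c.O (j + 2) (z b) (k + 2 * c.K + 17) e := by
    rintro (b | b | b)
    · exact (hP b).up ⟨le_rfl, by omega, by omega⟩
    · exact (on b).up ⟨by omega, by omega, by omega⟩
    · exact (hq b).up ⟨le_rfl, by omega, by omega⟩
  have oP : ∀ i b, c.O (j + 2) (PP s i b) 1 1 := fun i b => (h.oP hE t i b).up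
  refine ⟨fun i p ψ => ∑ b, PP s i b p ψ * z b p ψ, fun i p ψ => (∑ k, de D c s k i p ψ * z (.inl k) p ψ)
    + (∑ l, FF c.κ c.ω D.β₀ D.f s l i p ψ * z (.inr (.inr l)) p ψ) - ∑ b, PP s i b p ψ * (Sum.elim (fun _ _ _ => 0) (Sum.elim ν (fun _ _ _ => 0)) b : Fn T) p ψ,
    fun l => mean (fun p ψ => G (.inr (.inr l)) p ψ + ∑ k, W (.inr (.inr l)) (.inl (.inl k)) p ψ * n k p ψ), fun i => ?_, fun i => ?_, fun l => ?_, fun p hp ψ i => ?_⟩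
  · exact (Cx.O.sum hE.cards.f (fun b => (oP i b).mull (oz b))).up ⟨le_rfl, by omega, by omega⟩
  · have a1 : c.O (j + 2) (fun p ψ => ∑ k, de D c s k i p ψ * z (.inl k) p ψ) (k + 2 * c.K + 28) (E * e) :=
      (Cx.O.sum hE.cards.t (fun k' => ((h.ode k' i).up (j' := j + 2) (k' := 1)).mul (oz (.inl k')))).up ⟨le_rfl, by omega, by omega⟩
    have a2 : c.O (j + 2) (fun p ψ => ∑ l, FF c.κ c.ω D.β₀ D.f s l i p ψ * z (.inr (.inr l)) p ψ) (k + 2 * c.K + 28) (E * e) :=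
      (Cx.O.sum hE.cards.l (fun l => ((h.hF l i).up (j' := j + 2) (k' := 1)).mul (oz (.inr (.inr l))))).up ⟨le_rfl, by omega, by omega⟩
    have a3 : ∀ b : Fr T L, c.O (j + 2) (Sum.elim (fun _ _ _ => 0) (Sum.elim ν (fun _ _ _ => 0)) b : Fn T) (k + 2 * c.K + 26) (E * e) := by
      rintro (b | b | b)
      · exact Cx.O.zero
      · exact (oν b).up ⟨by omega, by omega, le_rfl⟩
      · exact Cx.O.zero
    have a4 := Cx.O.sum hE.cards.f (fun b => (oP i b).mull (a3 b))
    exact ((a1.add a2).sub (a4.up ⟨le_rfl, by omega, by omega⟩)).up ⟨le_rfl, by omega, by omega⟩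
  · refine (orr (.inr (.inr l))).mean.mono (ENNReal.ofReal_le_ofReal (mul_le_mul_of_nonneg_right ?_ e.2))
    exact pow_le_pow_right₀ Cx.X1 (by omega)
  · have := lin_id (κ := c.κ) (ω := c.ω) (Q := QQ D.β₀ D.f s.K) (s := s) (W := W) (z := z) (G := G)
      (ν := (Sum.elim (fun _ _ _ => 0) (Sum.elim ν (fun _ _ _ => 0)) : Fr T L → Fn T)) (de := de D c s)
      (F := FF c.κ c.ω D.β₀ D.f s) (m := mo s.μ o p) (ψ := ψ) (p := p)
      (a := Sum.elim (fun _ => 0) (Sum.elim (fun _ => 0) (fun l => if o = some l then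
        mean (fun p ψ => G (.inr (.inr l)) p ψ + ∑ k, W (.inr (.inr l)) (.inl (.inl k)) p ψ * n k p ψ) p else 0)))
      (fun i a => h.dPP hE t hp i a) (fun a => (oz a).dif hp) (fun k i => h.hM hE hp k i ψ) (fun l i => by simp [FF])
      (fun i k => by rw [F.PW p hp ψ]; rfl) (by
        rintro (b | b | b)
        · have e1 := hP2 b p hp ψ
          by_cases hno : o = none
          · rw [if_pos hno, mr hno p hp] at e1
            simpa [fo, hz] using e1
          · rw [if_neg hno] at e1; simpa [fo, hz] using e1
        · have e1 := eqn p hp ψ b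
          simpa [fo, mo, hz] using e1
        · have e1 := hq2 b p hp ψ
          simpa [fo, hz] using e1) i
    rw [this]
    congr 2
    rw [Fintype.sum_sum_type, Fintype.sum_sum_type]
    simp [PP]
end lin
end
section
section step
variable {T Bt L : Type} [Fintype T] [Fintype Bt] [Fintype L] [DecidableEq T] [DecidableEq Bt] [DecidableEq L]
variable {D : Dat T Bt L} {c : Cx T} {η : ℝ} {s : St T Bt L} {E : ℝ≥0}
variable {W : Fr T L → Ix T Bt → Fn T} {hi : T → T → Fn T} {Dm : T → T → ℝ → ℂ}
lemma dv_re {u : Fn T} {p : ℝ} (h : Dif u p) (v ψ : T → ℝ) :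
    dv v (fun p ψ => ((u p ψ).re : ℂ)) p ψ = ((dv v u p ψ).re : ℂ) := by
  have := (Complex.ofRealCLM.comp Complex.reCLM).hasFDerivAt.comp_hasDerivAt (0:ℝ) (h ψ v).hasDerivAt
  exact this.deriv
lemma DD_re {κ : ℝ → ℝ} {ω : T → ℝ} {u : Fn T} {p : ℝ} (h : Dif u p) (ψ : T → ℝ) :
    DD κ ω (fun p ψ => ((u p ψ).re : ℂ)) p ψ = ((DD κ ω u p ψ).re : ℂ) := by
  simp only [DD]; rw [dv_re h, ← Complex.ofReal_inv, Complex.re_ofReal_mul]; push_cast; rfl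
lemma BB_re {Q : T ⊕ Bt → T ⊕ Bt → Fn T} {p : ℝ} {ψ : T → ℝ} (hQ : ∀ i j, (Q i j p ψ).im = 0) (ξ : Ix T Bt → Fn T) (i) :
    BB Q (fun i p ψ => ((ξ i p ψ).re : ℂ)) i p ψ = ((BB Q ξ i p ψ).re : ℂ) := by
  rcases i with i | i
  · rfl
  · simp only [BB, Complex.neg_re, Complex.re_sum, Complex.mul_re, hQ, zero_mul, sub_zero]
    push_cast; congr 1
    refine Finset.sum_congr rfl fun j _ => ?_
    congr 1
    exact Complex.ext (by simp) (by simp [hQ])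
lemma QQ_im (hE : Env D c) (K : Ix T Bt → Fn T) {p : ℝ} (hp : p ∈ c.S) (i j) (ψ : T → ℝ) : (QQ D.β₀ D.f K i j p ψ).im = 0 := by
  have h1 : Rl c.S D.f := fun p _ x => hE.fr p x
  have h2 : Rl c.S (gr D.f i) := fun p hp x => h1.dv hp (hE.hf.dif hE.hR hp) _ x
  exact h2.dv hp ((hE.hg i).dif hE.hR hp) _ _
lemma BB_sub (Q : T ⊕ Bt → T ⊕ Bt → Fn T) (ξ ξ' : Ix T Bt → Fn T) (i) (p ψ) : BB Q (fun i p ψ => ξ i p ψ + ξ' i p ψ) i p ψ =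
    BB Q ξ i p ψ + BB Q ξ' i p ψ := by
  rcases i with i | i
  · rfl
  · simp only [BB, mul_add, Finset.sum_add_distrib]; ring
lemma Good.Kstep (h : Good D c η s E) (hE : Env D c) (F : Frm D c s W hi Dm) (t : T) (hs : 4 * (c.X ^ (7 * c.K) * E) ≤ D.R) :
    ∃ (ξ : Ix T Bt → Fn T) (lam : T → ℝ → ℂ), (∀ i, c.O 4 (ξ i) (7 * c.K) E) ∧ (∀ i, Rl c.S (ξ i)) ∧ (∀ t p, (lam t p).im = 0) ∧
      ∀ (V : L → Ix T Bt → Fn T) (μ : L → ℝ → ℂ) i, c.O 4 (er c.κ c.ω D.β₀ D.f ⟨fun i p ψ => s.K i p ψ + ξ i p ψ, fun t p => s.lam t p + lam t p, V, μ⟩ i : Fn T)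
        (16 * c.K) (E * E) := by
  have hK := K6 c
  set e := er c.κ c.ω D.β₀ D.f s with he
  have oWe : ∀ b, c.O 0 (fun p ψ => ∑ i, W b i p ψ * e i p ψ) 2 E := fun b =>
    Cx.O.sum hE.cards.i (fun i => (F.oW b i).mull (h.he i))
  have oM : ∀ k k', c.O 0 (MM s k (.inl (.inl k'))) 1 1 := fun k k' => h.oP hE k (.inl (.inl k')) (.inl k)
  have om : ∀ k, c.O 0 (fun p ψ => ∑ k', MM s k (.inl (.inl k')) p ψ * ∑ i, W (.inr (.inl k')) i p ψ * e i p ψ) 4 E := fun k =>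
    Cx.O.sum hE.cards.t (fun k' => (oM k k').mull (oWe (.inr (.inl k'))))
  set lm : T → ℝ → ℂ := fun k => mean (fun p ψ => ∑ k', MM s k (.inl (.inl k')) p ψ * ∑ i, W (.inr (.inl k')) i p ψ * e i p ψ) with hlm
  have olm : ∀ k, c.O 0 (fun p (_ : T → ℝ) => lm k p) 4 E := fun k => Cx.O.of_LB (om k).mean
  set lb : Fr T L → ℝ → ℂ := Sum.elim (fun _ _ => 0) (Sum.elim lm (fun _ _ => 0)) with hlb
  have olb : ∀ b, c.O 0 (fun p (_ : T → ℝ) => lb b p) 4 E := by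
    rintro (b | b | b)
    · exact Cx.O.zero
    · exact olm b
    · exact Cx.O.zero
  have oG : ∀ b, c.O 2 (fun p ψ => lb b p - ∑ i, W b i p ψ * e i p ψ) 5 E := fun b =>
    ((olb b).sub ((oWe b).up)).up
  obtain ⟨ξ, J, α, hξ, hJ, -, heq⟩ := h.lin hE F t none oG (by omega) (fun _ p hp k => by
    have a0 := mean_congr (p := p) (u := fun p ψ => ∑ k', MM s k (.inl (.inl k')) p ψ * (lb (.inr (.inl k')) p - ∑ i, W (.inr (.inl k')) i p ψ * e i p ψ))
      (v := fun p ψ => (∑ k', lm k' p * MM s k (.inl (.inl k')) p ψ) + (-1) * ∑ k', MM s k (.inl (.inl k')) p ψ * ∑ i, W (.inr (.inl k')) i p ψ * e i p ψ)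
      (fun ψ => by
        simp only [mul_sub, Finset.sum_sub_distrib, hlb, Sum.elim_inl, Sum.elim_inr, neg_mul, one_mul, ← sub_eq_add_neg]
        congr 1; exact Finset.sum_congr rfl fun _ _ => by ring)
    have o1 : ∀ k', c.O 0 (fun p ψ => lm k' p * MM s k (.inl (.inl k')) p ψ) (4 + 1) E := fun k' => (olm k').mulr (oM k k')
    have a1 : mean _ p = _ := mean_add (Cx.O.sum hE.cards.t o1) (Bd.smul (om k) (-1)) hp
    rw [a0, a1, mean_sumO o1 (by omega) hp]
    simp only [mean_smul]
    have a2 : ∀ k', mean (MM s k (.inl (.inl k'))) p = if k' = k then 1 else 0 := fun k' => by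
      have b1 : mean (MM s k (.inl (.inl k'))) p = _ := mean_add (h.hdK k (.inl (.inl k'))) (Bd.const (σ := c.σ) (c0 c).le (dl (.inl (.inl k')) k)) hp
      rw [b1, (h.hK _).mean_dv (c0 c) hp, mean_const (fun _ => dl (.inl (.inl k')) k)]
      simp [dl]
    simp only [a2]
    simp [hlm])
  have hξ' : ∀ i, c.O 4 (fun p ψ => ((ξ i p ψ).re : ℂ)) (7 * c.K) E := fun i => (hξ i).re.up ⟨le_rfl, by omega, by omega⟩
  refine ⟨fun i p ψ => ((ξ i p ψ).re : ℂ), fun t p => ((lm t p).re : ℂ), hξ', fun i p _ ψ => by simp, fun t p => by simp, fun V μ i => ?_⟩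
  have rJ : c.O 4 (fun p ψ => ((J i p ψ).re : ℂ)) (15 * c.K) (E * E) := (hJ i).re.up ⟨le_rfl, by omega, by omega⟩
  have e1 : ∀ p ∈ c.S, ∀ ψ, DD c.κ c.ω (fun p ψ => ((ξ i p ψ).re : ℂ)) p ψ - BB (QQ D.β₀ D.f s.K) (fun i p ψ => ((ξ i p ψ).re : ℂ)) i p ψ =
      - e i p ψ + (∑ k, dn i k * ((lm k p).re : ℂ)) + ((J i p ψ).re : ℂ) := fun p hp ψ => by
    rw [DD_re ((hξ i).dif hp), BB_re (fun i j => QQ_im hE s.K hp i j ψ)]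
    have a := heq p hp ψ i
    have a1 : (∑ b, PP s i b p ψ * (lb b p - ∑ i, W b i p ψ * e i p ψ)) = (∑ k, dn i k * lm k p) - e i p ψ := by
      simp only [mul_sub, Finset.sum_sub_distrib, Finset.mul_sum]
      rw [Finset.sum_comm (f := fun x i_1 => PP s i x p ψ * (W x i_1 p ψ * e i_1 p ψ))]
      simp only [← mul_assoc, ← Finset.sum_mul, F.PW p hp ψ]
      rw [Fintype.sum_sum_type, Fintype.sum_sum_type]
      simp [hlb, PP]
    rw [a1] at a
    have ei : (e i p ψ).im = 0 := by
      have d1 : ∀ i, (DD c.κ c.ω (s.K i) p ψ).im = 0 := fun i => by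
        simp only [DD]; rw [← Complex.ofReal_inv, Complex.im_ofReal_mul, (h.rK i).dv hp (h.dK hp i), mul_zero]
      have h1 : Rl c.S D.f := fun p _ x => hE.fr p x
      rw [he]
      rcases i with i | i
      · simp [er, d1, h.rK (.inr i) p hp ψ]
      · have h2 : (cmp D.β₀ (gr D.f i) (fun j => s.K (.inl j)) p ψ).im = 0 := h1.dv hp (hE.hf.dif hE.hR hp) _ _
        simp only [er, Complex.sub_im, Complex.add_im, d1, h2]
        rcases i with i | i
        · simp [h.rlam i p hp]
        · simp
    have a2 : ((e i p ψ).re : ℂ) = e i p ψ := Complex.ext (by simp) (by simp [ei])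
    have dnr : ∀ k, dn i k = ((if i = .inr (.inl k) then (1:ℝ) else 0 : ℝ) : ℂ) := fun k => by unfold dn; split_ifs <;> simp
    have a3 := congrArg (fun z : ℂ => ((z.re : ℝ) : ℂ)) a
    simp only [mo, zero_mul, add_zero, reduceCtorEq, if_false, mul_zero, Finset.sum_const_zero, sub_zero, Complex.sub_re, Complex.add_re, Complex.re_sum] at a3
    simp only [dnr, Complex.re_ofReal_mul] at a3 ⊢
    push_cast at a3 ⊢
    rw [a3, a2]; ring
  have dDD : ∀ p ∈ c.S, ∀ ψ, DD c.κ c.ω (fun p ψ => s.K i p ψ + ((ξ i p ψ).re : ℂ)) p ψ = DD c.κ c.ω (s.K i) p ψ +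
      DD c.κ c.ω (fun p ψ => ((ξ i p ψ).re : ℂ)) p ψ := fun p hp ψ => DD_add (h.dK hp i) ((hξ' i).dif hp) ψ
  rcases i with i | i
  · refine (rJ.up (k' := 16 * c.K)).congr fun p hp ψ => ?_
    have := e1 p hp ψ
    simp only [er, dDD p hp ψ]
    simp only [BB, dn, he, er, reduceCtorEq, if_false, zero_mul, Finset.sum_const_zero] at this
    linear_combination this
  · set θ := c.X ^ (7 * c.K) * (E : ℝ)
    have hθ0 : 0 ≤ θ := Cx.Xk0
    have l4 := Cx.lev (c := c) (j := 4) (by omega)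
    have hδ := c.hδ
    have hρ := c.hρ
    have := hE.ρR
    have := h.ηR
    have R2 := (hE.hg i).cmp2 (β₀ := D.β₀) (ρ := c.ρ - (4:ℕ) * c.δ) (u := fun j => s.K (.inl j)) (ξ := fun j p ψ => ((ξ (.inl j) p ψ).re : ℂ))
      (η := η) (θ := θ) (δ := c.δ) (by linarith) h.η0 hθ0 hδ (by push_cast; linarith)
      (fun j => (h.hK _).rho (by push_cast; linarith) (by push_cast; linarith))
      (fun j => hξ' (.inl j)) (fun j => h.rK _) (fun j p _ ψ => by simp)
    have oR : c.O 4 _ (15 * c.K) (E * E) := R2.mono (by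
      have X1 := Cx.X1 (c := c)
      have := c.hX
      have d1 : θ / c.δ ≤ c.X * θ := by
        have := mul_le_mul_of_nonneg_right c.hXδ hθ0
        rwa [one_div_mul_eq_div] at this
      calc 2 * (θ / c.δ) ^ 2 * c.X ≤ c.X * (c.X * θ) ^ 2 * c.X := by gcongr; linarith
        _ = c.X ^ (14 * c.K + 4) * ((E * E : ℝ≥0) : ℝ) := by simp only [θ]; push_cast; ring
        _ ≤ _ := by gcongr; omega)
    refine ((rJ.add oR).up ⟨le_rfl, by omega, by omega⟩).congr fun p hp ψ => ?_
    have := e1 p hp ψ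
    simp only [er, dDD p hp ψ]
    simp only [BB, dn, he, er] at this
    have hd : (∑ k, (if (Sum.inr i : Ix T Bt) = .inr (.inl k) then (1:ℂ) else 0) * ((lm k p).re : ℂ)) =
      Sum.elim (fun k => ((lm k p).re : ℂ)) (fun _ => 0) i := by
      rcases i with i | i <;> simp
    rw [hd] at this
    have hd2 : (Sum.elim (fun t => s.lam t p + ((lm t p).re : ℂ)) (fun _ => 0) i : ℂ) =
      Sum.elim (fun t => s.lam t p) (fun _ => 0) i + Sum.elim (fun k => ((lm k p).re : ℂ)) (fun _ => 0) i := by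
      rcases i with i | i <;> simp
    rw [hd2]
    simp only [QQ] at this
    linear_combination this
lemma odB (hE : Env D c) {Q Q' : T ⊕ Bt → T ⊕ Bt → Fn T} {u : Ix T Bt → Fn T} {j k k' : ℕ} {e e' : ℝ≥0}
    (hQ : ∀ i i', c.O j (fun p ψ => Q' i i' p ψ - Q i i' p ψ) k e) (hu : ∀ i, c.O j (u i) k' e') (hj : j ≤ 20) (i) :
    c.O j (fun p ψ => BB Q' u i p ψ - BB Q u i p ψ) (k + k' + 1) (e * e') := by
  rcases i with i | i
  · exact Cx.O.congr (Cx.O.zero hj) fun p _ ψ => by simp [BB]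
  · refine (Cx.O.sum hE.cards.j (fun i' => (hQ i i').mul (hu (.inl i'))) hj).neg.congr fun p _ ψ => ?_
    simp only [BB, sub_mul, Finset.sum_sub_distrib]; ring
lemma Good.Vstep (h : Good D c η s E) (hE : Env D c) (F : Frm D c s W hi Dm) (t : T) (hs : 4 * (c.X ^ (7 * c.K) * E) ≤ D.R)
    {ξ : Ix T Bt → Fn T} (hξ : ∀ i, c.O 4 (ξ i) (7 * c.K) E) (rξ : ∀ i, Rl c.S (ξ i)) (l : L) :
    ∃ (ζ : Ix T Bt → Fn T) (α : ℝ → ℂ), (∀ i, c.O 6 (ζ i) (15 * c.K) E) ∧ LB c.S c.σ α (ENNReal.ofReal (c.X ^ (13 * c.K) * E)) ∧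
      ∀ i, c.O 6 (fun p ψ => DD c.κ c.ω (fun p ψ => s.V l i p ψ + ζ i p ψ) p ψ
        - BB (QQ D.β₀ D.f (fun i p ψ => s.K i p ψ + ξ i p ψ)) (fun i p ψ => s.V l i p ψ + ζ i p ψ) i p ψ
        + (s.μ l p + α p) * (s.V l i p ψ + ζ i p ψ)) (29 * c.K) (E * E) := by
  have hK := K6 c
  set Q := QQ D.β₀ D.f s.K with hQd
  set Q' := QQ D.β₀ D.f (fun i p ψ => s.K i p ψ + ξ i p ψ) with hQd'
  have oQ : ∀ i i', c.O 4 (fun p ψ => Q' i i' p ψ - Q i i' p ψ) (7 * c.K + 2) E := fun i i' => by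
    set θ := c.X ^ (7 * c.K) * (E : ℝ)
    have hθ0 : 0 ≤ θ := Cx.Xk0
    have l4 := Cx.lev (c := c) (j := 4) (by omega)
    have hδ := c.hδ
    have hρ := c.hρ
    have := hE.ρR
    have := h.ηR
    refine ((hE.hQ i' i).cmp1 (β₀ := D.β₀) (ρ := c.ρ - (4:ℕ) * c.δ) (u := fun j => s.K (.inl j)) (ξ := fun j => ξ (.inl j))
      (η := η) (θ := θ) (δ := c.δ) (by linarith) h.η0 hθ0 hδ (by push_cast; linarith)
      (fun j => (h.hK _).rho (by push_cast; linarith) (by push_cast; linarith))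
      (fun j => hξ (.inl j)) (fun j => h.rK _) (fun j => rξ _)).mono ?_
    have X0 := Cx.X0 (c := c)
    have d1 : θ / c.δ ≤ c.X * θ := by
      have := mul_le_mul_of_nonneg_right c.hXδ hθ0
      rwa [one_div_mul_eq_div] at this
    calc θ / c.δ * c.X ≤ c.X * θ * c.X := by gcongr
      _ = c.X ^ (7 * c.K + 2) * (E : ℝ) := by simp only [θ]; ring
  have oV : ∀ i, c.O 4 (s.V l i) 1 1 := fun i => (h.oP hE t i (.inr (.inr l))).up
  have oB : ∀ i, c.O 4 (fun p ψ => BB Q' (s.V l) i p ψ - BB Q (s.V l) i p ψ) (7 * c.K + 4) E := fun i => by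
    simpa using odB hE oQ oV (by omega) i
  have oF : ∀ i, c.O 4 (fun p ψ => (BB Q' (s.V l) i p ψ - BB Q (s.V l) i p ψ) - FF c.κ c.ω D.β₀ D.f s l i p ψ) (7 * c.K + 5) E :=
    fun i => (oB i).sub (h.hF l i).up
  have oG : ∀ b, c.O 4 (fun p ψ => ∑ i, W b i p ψ * ((BB Q' (s.V l) i p ψ - BB Q (s.V l) i p ψ) - FF c.κ c.ω D.β₀ D.f s l i p ψ)) (9 * c.K) E :=
    fun b => (Cx.O.sum hE.cards.i (fun i => ((F.oW b i).up (j' := 4) (k' := 1)).mull (oF i))).up ⟨le_rfl, by omega, by omega⟩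
  obtain ⟨ζ, J, α, hζ, hJ, hα, heq⟩ := h.lin hE F t (some l) oG (by omega) (fun h => by simp at h)
  have hζ' : ∀ i, c.O 6 (ζ i) (15 * c.K) E := fun i => (hζ i).up ⟨le_rfl, by omega, by omega⟩
  have hα' : LB c.S c.σ (α l) (ENNReal.ofReal (c.X ^ (13 * c.K) * E)) := by
    have := hα l; rwa [show 9 * c.K + 4 * c.K = 13 * c.K by ring] at this
  refine ⟨ζ, α l, hζ', hα', fun i => ?_⟩
  have o1 : c.O 6 (J i) (28 * c.K) (E * E) := (hJ i).up ⟨le_rfl, by omega, by omega⟩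
  have o2 : c.O 6 (fun p ψ => BB Q' ζ i p ψ - BB Q ζ i p ψ) (28 * c.K) (E * E) :=
    (odB hE (fun i i' => (oQ i i').up (j' := 6) (k' := 7 * c.K + 2)) hζ' (by omega) i).up ⟨le_rfl, by omega, by omega⟩
  have o3 : c.O 6 (fun p ψ => α l p * ζ i p ψ) (13 * c.K + 15 * c.K) (E * E) := (Cx.O.of_LB hα').mul (hζ' i)
  rw [show 13 * c.K + 15 * c.K = 28 * c.K by ring] at o3
  refine (((o1.sub o2).add (o3.up (j' := 6) (k' := 28 * c.K + 1))).up ⟨le_rfl, by omega, by omega⟩).congr fun p hp ψ => ?_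
  have a := heq p hp ψ i
  have a1 : (∑ b, PP s i b p ψ * ∑ i, W b i p ψ * ((BB Q' (s.V l) i p ψ - BB Q (s.V l) i p ψ) - FF c.κ c.ω D.β₀ D.f s l i p ψ)) =
      (BB Q' (s.V l) i p ψ - BB Q (s.V l) i p ψ) - FF c.κ c.ω D.β₀ D.f s l i p ψ := by
    simp only [Finset.mul_sum]
    rw [Finset.sum_comm]
    simp only [← mul_assoc, ← Finset.sum_mul, F.PW p hp ψ]
    simp
  rw [a1] at a
  simp only [Option.some.injEq, mul_ite, mul_zero, Finset.sum_ite_eq, Finset.mem_univ, if_true, mo, FF] at a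
  rw [DD_add (h.dV hE t hp l i) ((hζ' i).dif hp), BB_sub]
  linear_combination a
lemma Good.step (h : Good D c η s E) (hE : Env D c) (t : T) (hs : 4 * (c.X ^ (7 * c.K) * E) ≤ D.R) : ∃ s' : St T Bt L,
    (∀ i, c.O 6 (fun p ψ => s'.K i p ψ - s.K i p ψ) (15 * c.K) E) ∧
    (∀ k i, c.O 6 (fun p ψ => dv (Pi.single k 1) (s'.K i) p ψ - dv (Pi.single k 1) (s.K i) p ψ) (15 * c.K) E) ∧
    (∀ l i, c.O 6 (fun p ψ => s'.V l i p ψ - s.V l i p ψ) (15 * c.K) E) ∧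
    (∀ l, LB c.S c.σ (fun p => s'.μ l p - s.μ l p) (ENNReal.ofReal (c.X ^ (15 * c.K) * E))) ∧
    (∀ i, Rl c.S (s'.K i)) ∧ (∀ t, ∀ p ∈ c.S, (s'.lam t p).im = 0) ∧
    (∀ i, c.O 6 (er c.κ c.ω D.β₀ D.f s' i) (29 * c.K) (E * E)) ∧
    (∀ l i, c.O 6 (FF c.κ c.ω D.β₀ D.f s' l i) (29 * c.K) (E * E)) := by
  have hK := K6 c
  obtain ⟨W, hi, Dm, F⟩ := h.frm hE t
  obtain ⟨ξ, lam, hξ, rξ, rlam, her⟩ := h.Kstep hE F t hs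
  choose ζ α hζ hα hF using fun l => h.Vstep hE F t hs hξ rξ l
  refine ⟨⟨fun i p ψ => s.K i p ψ + ξ i p ψ, fun t p => s.lam t p + lam t p, fun l i p ψ => s.V l i p ψ + ζ l i p ψ,
    fun l p => s.μ l p + α l p⟩, fun i => ?_, fun k i => ?_, fun l i => ?_, fun l => ?_, fun i p hp ψ => ?_, fun t p hp => ?_, fun i => ?_, fun l i => ?_⟩
  · exact ((hξ i).up ⟨by omega, by omega, by omega⟩).congr fun p _ ψ => by simp
  · refine (((hξ i).dv (norm_single k)).up (j' := 6) (k' := 15 * c.K) ⟨by omega, by omega, by omega⟩).congr fun p hp ψ => ?_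
    rw [dv_add (h.dK hp i) ((hξ i).dif hp)]; ring
  · exact (hζ l i).congr fun p _ ψ => by simp
  · refine ((hα l).mono (ENNReal.ofReal_le_ofReal ?_)).congr fun p _ => by simp
    have := Cx.X1 (c := c)
    gcongr; omega
  · simp [h.rK i p hp ψ, rξ i p hp ψ]
  · simp [h.rlam t p hp, rlam]
  · exact (her _ _ i).up ⟨by omega, by omega, by omega⟩
  · exact hF l i
end step
end
section
section iter
variable {T Bt L : Type} [Fintype T] [Fintype Bt] [Fintype L] [DecidableEq T] [DecidableEq Bt] [DecidableEq L]
structure Par (D : Dat T Bt L) where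
  ω : T → ℝ
  τ : ℕ
  τ₁ : ℕ
  N : ℕ
  X : ℝ
  γ : ℝ
  M : ℝ
  χ : ℝ
  m : L → ℂ
  hR : 0 < D.R
  hf : ∀ S σ, Bd S σ D.R D.f D.C
  hg : ∀ S σ j, Bd S σ D.R (gr D.f j) X
  hQ : ∀ S σ i j, Bd S σ D.R (dv (Pi.single i 1) (gr D.f j)) X
  fr : ∀ p x, (D.f p x).im = 0
  hW : ∀ b b', ∑ i, D.W₀ b i * P0 D.V₀ i b' = if b = b' then 1 else 0
  card : Fintype.card (Ix T Bt) = Fintype.card (Fr T L)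
  hN : Fintype.card (Ix T Bt) ≤ N
  w1 : 1 ≤ D.w
  wX : 2 * D.w ≤ X
  hw : ∀ b i, ‖D.W₀ b i‖ ≤ D.w
  hv : ∀ b i, ‖D.V₀ b i‖ ≤ D.w
  hX : 3 ≤ X
  hRX : 192 / D.R ≤ X
  hγ : 0 < γ
  hγX : 1 / γ ≤ X
  hω : ‖ω‖ ≤ X
  hτ : ((2 * τ + 1).factorial : ℝ) ≤ X
  hNX : (N : ℝ) ≤ X
  hχ : 0 < χ
  hM : ∀ o o', ‖mo (fun l _ => m l) o 0 - mo (fun l _ => m l) o' 0‖ ≤ M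
  hM1 : M + 1 ≤ X
  hχX : 2 / χ + (M + 1) * (2 / χ) ^ 2 ≤ X
  hsep : ∀ o o', o ≠ o' → χ ≤ ‖mo (fun l _ => m l) o 0 - mo (fun l _ => m l) o' 0‖
  dio : ∀ ν : T → ℤ, ν ≠ 0 → 2 * γ ≤ |dot ν ω| * nm ν ^ τ₁
  hττ : 2 * τ₁ + 2 * Fintype.card T ≤ τ
variable {D : Dat T Bt L} (P : Par D)
def Par.k : ℕ := 29 * (2 * P.τ + 6)
noncomputable def Par.Θ (E : ℝ≥0) : ℝ := P.X ^ P.k * E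
noncomputable def Par.z (o : Option L) : ℂ := mo (fun l _ => P.m l) o 0
noncomputable def hh (n : ℕ) : ℝ := (1 / 2) ^ n
noncomputable def Par.rr (_ : Par D) (n : ℕ) : ℝ := D.R / 8 * (1 + hh n)
noncomputable def Par.ηη (E : ℝ≥0) (n : ℕ) : ℝ := P.Θ E * (3 - 2 * hh n)
noncomputable def Par.EE (E : ℝ≥0) (n : ℕ) : ℝ≥0 := E * ((1 / 2) ^ n) ^ P.k
structure Sm (b : ℝ) (E : ℝ≥0) : Prop where
  b0 : 0 < b
  b1 : √b ≤ 1 / 2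
  s1 : 2 ^ P.k * P.Θ E ≤ 1
  s2 : 12 * (P.N : ℝ) ^ 4 * D.w ^ 2 * (3 * P.Θ E) ≤ 1
  s3 : 4 * (3 * P.Θ E) ≤ D.R
  s4 : 6 * P.Θ E ≤ 1
  s5 : 36 * P.Θ E ≤ P.χ
structure Pre (b : ℝ) (E : ℝ≥0) (n : ℕ) (A : Set ℝ) (s : St T Bt L) : Prop where
  hA : A ⊆ Set.Icc (b / 4) b
  cA : IsClosed A
  hK : ∀ i, Bd A (ENNReal.ofReal b) (P.rr n) (s.K i) (P.ηη E n)
  rK : ∀ i, Rl A (s.K i)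
  hdK : ∀ k i, Bd A (ENNReal.ofReal b) (P.rr n) (dv (Pi.single k 1) (s.K i)) (P.ηη E n)
  hV : ∀ l i, Bd A (ENNReal.ofReal b) (P.rr n) (fun p ψ => s.V l i p ψ - D.V₀ l i) (P.ηη E n)
  hμ : ∀ l, LB A (ENNReal.ofReal b) (fun p => s.μ l p - P.m l) (ENNReal.ofReal (P.ηη E n))
  rlam : ∀ t, ∀ p ∈ A, (s.lam t p).im = 0
  he : ∀ i, Bd A (ENNReal.ofReal b) (P.rr n) (er Real.sqrt P.ω D.β₀ D.f s i) (P.EE E n)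
  hF : ∀ l i, Bd A (ENNReal.ofReal b) (P.rr n) (FF Real.sqrt P.ω D.β₀ D.f s l i) (P.EE E n)
lemma hh0 (n : ℕ) : 0 < hh n := by unfold hh; positivity
lemma hh1 (n : ℕ) : hh n ≤ 1 := by unfold hh; exact pow_le_one₀ (by norm_num) (by norm_num)
lemma hhs (n : ℕ) : hh (n + 1) = hh n / 2 := by unfold hh; rw [pow_succ]; ring
lemma hh2 (n : ℕ) : hh n * 2 ^ n = 1 := by unfold hh; rw [← mul_pow]; norm_num
lemma sqrt_LB {b : ℝ} (b0 : 0 < b) {S : Set ℝ} (hS : S ⊆ Set.Icc (b / 4) b) :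
    LB S (ENNReal.ofReal b) (fun p => ((√p : ℝ) : ℂ)) (ENNReal.ofReal (2 * √b)) := by
  have hb := Real.sqrt_nonneg b
  have hbb := Real.mul_self_sqrt b0.le
  refine ⟨ENNReal.ofReal √b, ENNReal.ofReal √b, ?_, fun p hp => ?_, fun p hp q hq => ?_⟩
  · rw [← ENNReal.ofReal_add hb hb]; exact ENNReal.ofReal_le_ofReal (by linarith)
  · rw [← ofReal_norm]; refine ENNReal.ofReal_le_ofReal ?_
    rw [Complex.norm_real, Real.norm_of_nonneg (Real.sqrt_nonneg _)]
    exact Real.sqrt_le_sqrt (hS hp).2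
  · rw [← ofReal_norm, ← Complex.ofReal_sub, Complex.norm_real, edist_dist, ← ENNReal.ofReal_mul b0.le, ← ENNReal.ofReal_mul hb]
    refine ENNReal.ofReal_le_ofReal ?_
    have h2 : ∀ p ∈ S, √b / 2 ≤ √p := fun p hp => by
      refine Real.le_sqrt_of_sq_le ?_
      have := (hS hp).1
      nlinarith
    have hp0 : 0 ≤ p := by have := (hS hp).1; linarith
    have hq0 : 0 ≤ q := by have := (hS hq).1; linarith
    have h3 : dist p q = ‖√p - √q‖ * (√p + √q) := by
      rw [Real.dist_eq, Real.norm_eq_abs, ← abs_of_nonneg (a := √p + √q) (by positivity), ← abs_mul]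
      congr 1
      nlinarith [Real.mul_self_sqrt hp0, Real.mul_self_sqrt hq0]
    rw [h3]
    have := h2 p hp; have := h2 q hq
    calc b * ‖√p - √q‖ = (√b * √b) * ‖√p - √q‖ := by rw [hbb]
      _ = √b * (‖√p - √q‖ * √b) := by ring
      _ ≤ _ := by gcongr; linarith
variable {P} {b : ℝ} {E : ℝ≥0} {n : ℕ} {A : Set ℝ} {s : St T Bt L}
lemma X0P : 0 < P.X := by linarith [P.hX]
lemma Θ0 : 0 ≤ P.Θ E := mul_nonneg (pow_nonneg X0P.le _) E.2
lemma ηη0 : 0 ≤ P.ηη E n := mul_nonneg Θ0 (by linarith [hh1 n])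
lemma ηη3 : P.ηη E n ≤ 3 * P.Θ E := by
  unfold Par.ηη; nlinarith [hh0 n, Θ0 (P := P) (E := E)]
noncomputable def Par.cx (P : Par D) (hs : Sm P b E) (n : ℕ) (S : Set ℝ) (hS : S ⊆ Set.Icc (b / 4) b) : Cx T where
  S := S
  σ := ENNReal.ofReal b
  ρ := P.rr n
  δ := D.R / 192 * hh n
  X := P.X * 2 ^ n
  γ := P.γ * hh n
  τ := P.τ
  N := P.N
  κ := Real.sqrt
  ω := P.ω
  hδ := mul_pos (div_pos P.hR (by norm_num)) (hh0 n)
  hρ := by unfold Par.rr; nlinarith [hh0 n, hh1 n, P.hR, mul_pos P.hR (hh0 n)]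
  hXδ := by
    have h1 := hh2 n
    have h0 := hh0 n
    have hR := P.hR
    rw [div_le_iff₀ (by positivity)]
    have : 192 ≤ P.X * D.R := (div_le_iff₀ P.hR).1 P.hRX
    calc (1:ℝ) ≤ P.X * D.R / 192 * (hh n * 2 ^ n) := by rw [h1]; linarith
      _ = _ := by ring
  hX := P.hX.trans (le_mul_of_one_le_right X0P.le (one_le_pow₀ (by norm_num)))
  hγ := mul_pos P.hγ (hh0 n)
  hγX := by
    have h1 := hh2 n
    have h0 := hh0 n
    have := P.hγ
    rw [div_le_iff₀ (by positivity)]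
    have : 1 ≤ P.X * P.γ := (div_le_iff₀ P.hγ).1 P.hγX
    calc (1:ℝ) ≤ P.X * P.γ * (hh n * 2 ^ n) := by rw [h1]; linarith
      _ = _ := by ring
  hω := P.hω.trans (le_mul_of_one_le_right X0P.le (one_le_pow₀ (by norm_num)))
  hτ := P.hτ.trans (le_mul_of_one_le_right X0P.le (one_le_pow₀ (by norm_num)))
  hN := P.hNX.trans (le_mul_of_one_le_right X0P.le (one_le_pow₀ (by norm_num)))
  hκ := (sqrt_LB hs.b0 hS).mono (ENNReal.ofReal_le_ofReal (by linarith [hs.b1]))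
  κpos := fun p hp => Real.sqrt_pos.2 (by have := (hS hp).1; linarith [hs.b0])
lemma XX : P.X ≤ P.X * 2 ^ n := le_mul_of_one_le_right X0P.le (one_le_pow₀ (by norm_num))
lemma Par.env (hs : Sm P b E) (n : ℕ) (S : Set ℝ) (hS : S ⊆ Set.Icc (b / 4) b) : Env D (P.cx hs n S hS) where
  hR := P.hR
  ρR := by simp only [Par.cx, Par.rr]; nlinarith [hh1 n, P.hR]
  hf := P.hf _ _
  hg := fun j => (P.hg _ _ j).mono XX
  hQ := fun i j => (P.hQ _ _ i j).mono XX
  fr := P.fr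
  hW := P.hW
  card := P.card
  hN := P.hN
  w1 := P.w1
  wX := P.wX.trans XX
  hw := P.hw
  hv := P.hv
lemma Pre.dm (h : Pre P b E n A s) (o o') : LB A (ENNReal.ofReal b) (fun p => (mo s.μ o p - mo s.μ o' p) - (P.z o - P.z o'))
    (ENNReal.ofReal (6 * P.Θ E)) := by
  have h1 : ∀ o, LB A (ENNReal.ofReal b) (fun p => mo s.μ o p - P.z o) (ENNReal.ofReal (3 * P.Θ E)) := by
    rintro (_ | l)
    · refine ((LB.const 0).mono (by simp)).congr fun p _ => by simp [mo, Par.z]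
    · exact (h.hμ l).mono (ENNReal.ofReal_le_ofReal ηη3)
  have h0 : 0 ≤ P.Θ E := Θ0
  refine (((h1 o).sub (h1 o')).mono ?_).congr fun p _ => by ring
  rw [← ENNReal.ofReal_add (by positivity) (by positivity)]
  exact ENNReal.ofReal_le_ofReal (by linarith)
lemma LB.norm {S : Set ℝ} {σ : ℝ≥0∞} {c : ℝ → ℂ} {B : ℝ} (h : LB S σ c (ENNReal.ofReal B)) (hB : 0 ≤ B) {p : ℝ} (hp : p ∈ S) :
    ‖c p‖ ≤ B := by
  have := h.enorm hp
  rwa [← ofReal_norm, ENNReal.ofReal_le_ofReal_iff hB] at this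
def Par.nx (P : Par D) (n : ℕ) (A : Set ℝ) (μ : L → ℝ → ℂ) : Set ℝ :=
  {p ∈ A | ∀ o o' : Option L, ∀ ν : T → ℤ, ν ≠ 0 →
    P.γ * hh n ≤ ‖Complex.I * (dot ν P.ω : ℂ) + (√p : ℂ) * (mo μ o p - mo μ o' p)‖ * nm ν ^ P.τ}
lemma Pre.div (h : Pre P b E n A s) (hs : Sm P b E) :
    Div (P.cx hs n (P.nx n A s.μ) ((Set.sep_subset _ _).trans h.hA)) s.μ := by
  have h0 : 0 ≤ P.Θ E := Θ0
  have hχ := P.hχ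
  have hM0 : 0 ≤ P.M := (norm_nonneg _).trans (P.hM none none)
  have hm : ∀ o o', LB (P.nx n A s.μ) (ENNReal.ofReal b) (fun p => mo s.μ o p - mo s.μ o' p) (ENNReal.ofReal (P.M + 1)) := fun o o' => by
    refine ((((h.dm o o').subset (Set.sep_subset _ _)).add (LB.const (P.z o - P.z o'))).mono ?_).congr fun p _ => by ring
    rw [← ofReal_norm, ← ENNReal.ofReal_add (by positivity) (norm_nonneg _)]
    exact ENNReal.ofReal_le_ofReal (by linarith [P.hM o o', hs.s4, show ‖P.z o - P.z o'‖ ≤ P.M from P.hM o o'])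
  refine ⟨fun o o' => (hm o o').mono (ENNReal.ofReal_le_ofReal (P.hM1.trans XX)), fun o o' p hp ν hν => hp.2 o o' ν hν, fun o o' ho => ?_⟩
  have hn : ∀ p ∈ P.nx n A s.μ, P.χ / 2 ≤ ‖mo s.μ o p - mo s.μ o' p‖ := fun p hp => by
    have h1 := (h.dm o o').norm (by positivity) hp.1
    have h2 : P.χ ≤ ‖P.z o - P.z o'‖ := P.hsep o o' ho
    have h3 := norm_sub_norm_le (P.z o - P.z o') ((P.z o - P.z o') - (mo s.μ o p - mo s.μ o' p))
    rw [sub_sub_cancel, norm_sub_rev (P.z o - P.z o')] at h3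
    linarith [hs.s5]
  have hn0 : ∀ p ∈ P.nx n A s.μ, mo s.μ o p - mo s.μ o' p ≠ 0 := fun p hp h0 => by
    have := hn p hp; rw [h0, norm_zero] at this; linarith
  refine ⟨((hm o o').inv (T := ENNReal.ofReal (2 / P.χ)) fun p hp => ⟨hn0 p hp, ?_⟩).mono ?_, hn0⟩
  · rw [← ofReal_norm]
    refine ENNReal.ofReal_le_ofReal ?_
    rw [norm_inv, ← inv_div]
    exact inv_anti₀ (by positivity) (hn p hp)
  · rw [← ENNReal.ofReal_pow (by positivity), ← ENNReal.ofReal_mul (by positivity), ← ENNReal.ofReal_add (by positivity) (by positivity)]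
    exact ENNReal.ofReal_le_ofReal (P.hχX.trans XX)
lemma Pre.good (h : Pre P b E n A s) (hs : Sm P b E) :
    Good D (P.cx hs n (P.nx n A s.μ) ((Set.sep_subset _ _).trans h.hA)) (P.ηη E n) s (P.EE E n) where
  η0 := ηη0
  hη := by
    refine le_trans ?_ hs.s2
    exact mul_le_mul_of_nonneg_left ηη3 (by positivity)
  ηR := by linarith [hs.s3, ηη3 (P := P) (E := E) (n := n)]
  hK := fun i => (h.hK i).subset (Set.sep_subset _ _)
  rK := fun i p hp => h.rK i p hp.1
  hdK := fun k i => (h.hdK k i).subset (Set.sep_subset _ _)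
  hV := fun l i => (h.hV l i).subset (Set.sep_subset _ _)
  hdiv := h.div hs
  rlam := fun t p hp => h.rlam t p hp.1
  he := fun i => by
    have := (h.he i).subset (show P.nx n A s.μ ⊆ A from Set.sep_subset _ _)
    simpa [Cx.O, Par.cx] using this
  hF := fun l i => by
    have := (h.hF l i).subset (show P.nx n A s.μ ⊆ A from Set.sep_subset _ _)
    simpa [Cx.O, Par.cx] using this
lemma Pre.cl (h : Pre P b E n A s) (hs : Sm P b E) : IsClosed (P.nx n A s.μ) := by
  have hc : ∀ o o', ContinuousOn (fun p => mo s.μ o p - mo s.μ o' p) A := fun o o' => by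
    have h1 : LipschitzOnWith (Real.toNNReal (6 * P.Θ E / b)) (fun p => (mo s.μ o p - mo s.μ o' p) - (P.z o - P.z o')) A := fun p hp q hq => by
      have h2 := (h.dm o o').lip hp hq
      rw [edist_eq_enorm_sub, ← ENNReal.ofReal, ENNReal.ofReal_div_of_pos hs.b0, ← ENNReal.mul_div_right_comm,
        ENNReal.le_div_iff_mul_le (by simp [hs.b0]) (by simp), mul_comm]
      exact h2
    have := h1.continuousOn.add (continuousOn_const (c := P.z o - P.z o'))
    exact this.congr fun p _ => by simp
  have : P.nx n A s.μ = A ∩ ⋂ (o : Option L) (o' : Option L) (ν : T → ℤ) (_ : ν ≠ 0), (A ∩ {p | P.γ * hh n ≤ ‖Complex.I * (dot ν P.ω : ℂ) + (√p : ℂ) * (mo s.μ o p - mo s.μ o' p)‖ * nm ν ^ P.τ}) := by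
    ext p; simp only [Par.nx, Set.mem_inter_iff, Set.mem_iInter, Set.mem_ofPred_eq]
    exact ⟨fun h => ⟨h.1, fun o o' ν hν => ⟨h.1, h.2 o o' ν hν⟩⟩, fun h => ⟨h.1, fun o o' ν hν => (h.2 o o' ν hν).2⟩⟩
  rw [this]
  refine h.cA.inter (isClosed_iInter fun o => isClosed_iInter fun o' => isClosed_iInter fun ν => isClosed_iInter fun _ => ?_)
  refine ContinuousOn.preimage_isClosed_of_isClosed (f := fun p => ‖Complex.I * (dot ν P.ω : ℂ) + (√p : ℂ) * (mo s.μ o p - mo s.μ o' p)‖ * nm ν ^ P.τ) ?_ h.cA (isClosed_Ici (a := P.γ * hh n))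
  refine ContinuousOn.mul (ContinuousOn.norm (continuousOn_const.add (ContinuousOn.mul ?_ (hc o o')))) continuousOn_const
  exact (Complex.continuous_ofReal.comp Real.continuous_sqrt).continuousOn
lemma Pre.step (h : Pre P b E n A s) (hs : Sm P b E) (t : T) : ∃ s', Pre P b E (n + 1) (P.nx n A s.μ) s' ∧
    ∀ i, Bd (P.nx n A s.μ) (ENNReal.ofReal b) (D.R / 8) (fun p ψ => s'.K i p ψ - s.K i p ψ) (P.Θ E * hh n) := by
  have hG := h.good hs
  have hE := Par.env hs n (P.nx n A s.μ) ((Set.sep_subset _ _).trans h.hA)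
  set c := P.cx hs n (P.nx n A s.μ) ((Set.sep_subset _ _).trans h.hA) with hc
  have hX0 := X0P (P := P)
  have hcX : c.X = P.X * 2 ^ n := rfl
  have hcK : c.K = 2 * P.τ + 6 := rfl
  have hX1 : 1 ≤ P.X := by linarith [P.hX]
  have h0 : 0 ≤ P.Θ E := Θ0
  have key : ∀ a ≤ P.k, c.X ^ a * (P.EE E n : ℝ) ≤ P.Θ E * hh n ^ (P.k - a) := fun a ha => by
    rw [hcX, mul_pow]
    have e1 : ((2:ℝ) ^ n) ^ a * hh n ^ a = 1 := by rw [← mul_pow, mul_comm, hh2, one_pow]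
    have e2 : ((P.EE E n : ℝ≥0) : ℝ) = E * (hh n ^ a * hh n ^ (P.k - a)) := by
      rw [← pow_add, Nat.add_sub_cancel' ha]; simp [Par.EE, hh]
    rw [e2]
    calc P.X ^ a * (2 ^ n) ^ a * ((E:ℝ) * (hh n ^ a * hh n ^ (P.k - a))) = P.X ^ a * E * hh n ^ (P.k - a) * ((2 ^ n) ^ a * hh n ^ a) := by ring
      _ ≤ P.X ^ P.k * E * hh n ^ (P.k - a) * 1 := by
        rw [e1]
        have := (hh0 n).le
        gcongr
      _ = _ := by rw [Par.Θ]; ring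
  have k15 : c.X ^ (15 * c.K) * (P.EE E n : ℝ) ≤ P.Θ E * hh n := by
    refine (key _ (by rw [hcK, Par.k]; omega)).trans ?_
    gcongr
    exact pow_le_of_le_one (hh0 n).le (hh1 n) (by rw [hcK, Par.k]; omega)
  have k7 : 4 * (c.X ^ (7 * c.K) * (P.EE E n : ℝ)) ≤ D.R := by
    have := (key (7 * c.K) (by rw [hcK, Par.k]; omega)).trans (mul_le_of_le_one_right h0 (pow_le_one₀ (hh0 n).le (hh1 n)))
    linarith [hs.s3]
  have k29 : c.X ^ (29 * c.K) * ((P.EE E n * P.EE E n : ℝ≥0) : ℝ) ≤ P.EE E (n + 1) := by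
    have h1 := key (29 * c.K) (by rw [hcK, Par.k])
    have h2 : P.k - 29 * c.K = 0 := by rw [hcK, Par.k]; omega
    rw [h2, pow_zero, mul_one] at h1
    have h3 : ((P.EE E (n + 1) : ℝ≥0) : ℝ) = P.EE E n * (1 / 2) ^ P.k := by
      simp only [Par.EE]; push_cast; rw [pow_succ, mul_pow]; ring
    have h4 : P.Θ E ≤ (1 / 2) ^ P.k := by
      rw [one_div, inv_pow, ← one_div, le_div_iff₀ (by positivity), mul_comm]; exact hs.s1
    rw [h3]; push_cast
    calc c.X ^ (29 * c.K) * ((P.EE E n : ℝ) * P.EE E n) = P.EE E n * (c.X ^ (29 * c.K) * P.EE E n) := by ring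
      _ ≤ _ := mul_le_mul_of_nonneg_left (h1.trans h4) (NNReal.coe_nonneg _)
  have hR := P.hR
  have r6 : P.rr (n + 1) ≤ c.ρ - (6 : ℕ) * c.δ := by
    simp only [hc, Par.cx, Par.rr, hhs]; push_cast
    nlinarith [hh0 n, mul_pos hR (hh0 n)]
  have r0 : ∀ n, D.R / 8 ≤ P.rr n := fun n => by unfold Par.rr; nlinarith [hh0 n]
  have r00 : ∀ n, 0 ≤ P.rr n := fun n => le_trans (by positivity) (r0 n)
  have rs : P.rr (n + 1) ≤ P.rr n := by simp only [Par.rr, hhs]; nlinarith [hh0 n, mul_pos hR (hh0 n)]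
  have eη : P.ηη E (n + 1) = P.Θ E * hh n + P.ηη E n := by simp only [Par.ηη, hhs]; ring
  have hη0 : 0 ≤ P.Θ E * hh n := mul_nonneg h0 (hh0 n).le
  have sub : P.nx n A s.μ ⊆ A := Set.sep_subset _ _
  have cv : ∀ {u : Fn T}, c.O 6 u (15 * c.K) (P.EE E n) → Bd (P.nx n A s.μ) (ENNReal.ofReal b) (P.rr (n + 1)) u (P.Θ E * hh n) :=
    fun hu => (Bd.rho hu (r00 _) r6).mono k15
  have cv2 : ∀ {u : Fn T}, c.O 6 u (29 * c.K) (P.EE E n * P.EE E n) → Bd (P.nx n A s.μ) (ENNReal.ofReal b) (P.rr (n + 1)) u (P.EE E (n + 1)) :=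
    fun hu => (Bd.rho hu (r00 _) r6).mono k29
  have cv3 : ∀ {u v w : Fn T}, c.O 6 u (15 * c.K) (P.EE E n) → Bd A (ENNReal.ofReal b) (P.rr n) v (P.ηη E n) → (∀ p ψ, w p ψ = u p ψ + v p ψ) →
      Bd (P.nx n A s.μ) (ENNReal.ofReal b) (P.rr (n + 1)) w (P.ηη E (n + 1)) := fun hu hv hw => by
    rw [eη]
    exact ((cv hu).add ((hv.subset sub).rho (r00 _) rs) hη0 ηη0).congr fun p _ ψ => hw p ψ
  obtain ⟨s', a1, a2, a3, a4, a5, a6, a7, a8⟩ := hG.step hE t k7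
  refine ⟨s', ⟨sub.trans h.hA, h.cl hs, fun i => cv3 (a1 i) (h.hK i) fun p ψ => by ring, a5, fun k i => cv3 (a2 k i) (h.hdK k i) fun p ψ => by ring,
    fun l i => cv3 (a3 l i) (h.hV l i) fun p ψ => by ring, fun l => ?_, a6, fun i => cv2 (a7 i), fun l i => cv2 (a8 l i)⟩, fun i => (cv (a1 i)).rho (by positivity) (r0 _)⟩
  refine (((a4 l).add ((h.hμ l).subset sub)).mono ?_).congr fun p _ => by ring
  rw [← ENNReal.ofReal_add Cx.Xk0 ηη0, eη]
  exact ENNReal.ofReal_le_ofReal (by linarith)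
lemma dep_seq {α : Type} (Q : ℕ → α → Prop) (Rr : ℕ → α → α → Prop) (a0 : α) (h0 : Q 0 a0)
    (hst : ∀ n a, Q n a → ∃ a', Q (n + 1) a' ∧ Rr n a a') : ∃ u : ℕ → α, u 0 = a0 ∧ ∀ n, Q n (u n) ∧ Rr n (u n) (u (n + 1)) := by
  choose g hg using hst
  let v : ∀ n, {a // Q n a} := fun n => Nat.rec ⟨a0, h0⟩ (fun n x => ⟨g n x.1 x.2, (hg n x.1 x.2).1⟩) n
  exact ⟨fun n => (v n).1, rfl, fun n => ⟨(v n).2, (hg n (v n).1 (v n).2).2⟩⟩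
lemma Pre.seq (hs : Sm P b E) (t : T) {s0 : St T Bt L} (h : Pre P b E 0 A s0) : ∃ (A' : ℕ → Set ℝ) (s : ℕ → St T Bt L), A' 0 = A ∧
    ∀ n, Pre P b E n (A' n) (s n) ∧ A' (n + 1) = P.nx n (A' n) (s n).μ ∧
      ∀ i, Bd (A' (n + 1)) (ENNReal.ofReal b) (D.R / 8) (fun p ψ => (s (n + 1)).K i p ψ - (s n).K i p ψ) (P.Θ E * hh n) := by
  obtain ⟨u, u0, hu⟩ := dep_seq (α := Set ℝ × St T Bt L) (fun n x => Pre P b E n x.1 x.2)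
    (fun n x y => y.1 = P.nx n x.1 x.2.μ ∧ ∀ i, Bd y.1 (ENNReal.ofReal b) (D.R / 8) (fun p ψ => y.2.K i p ψ - x.2.K i p ψ) (P.Θ E * hh n))
    (A, s0) h (fun n a ha => by
      obtain ⟨s', h1, h2⟩ := ha.step hs t
      exact ⟨(_, s'), h1, rfl, h2⟩)
  exact ⟨fun n => (u n).1, fun n => (u n).2, by simp [u0], fun n => hu n⟩
end iter
end
section
lemma summable_nm {T : Type} [Fintype T] {n : ℕ} (hn : Fintype.card T < n) : Summable (fun ν : T → ℤ => (nm ν ^ n)⁻¹) := by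
  classical
  let L := Submodule.span ℤ (Set.range (Pi.basisFun ℝ T))
  have hr : Module.finrank ℤ L = Fintype.card T := by
    rw [ZLattice.rank ℝ L, Module.finrank_fintype_fun_eq_card]
  have h1 := ZLattice.summable_norm_pow_inv L n (by rw [hr]; exact hn)
  have hm : ∀ ν : T → ℤ, (fun k => (ν k : ℝ)) ∈ L := fun ν => by
    rw [(Pi.basisFun ℝ T).mem_span_iff_repr_mem ℤ]
    intro i; exact ⟨ν i, by simp⟩
  have hi : Function.Injective (fun ν : T → ℤ => (⟨_, hm ν⟩ : L)) := fun ν ν' h => by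
    funext k
    have : (ν k : ℝ) = ν' k := congrFun (congrArg Subtype.val h) k
    exact_mod_cast this
  refine Summable.of_nonneg_of_le (fun ν => inv_nonneg.2 (pow_nonneg (nm_nonneg ν) _)) (fun ν => ?_) (h1.comp_injective hi)
  by_cases h0 : ν = 0
  · subst h0; rw [nm_zero, zero_pow (by omega), inv_zero]; simp only [Function.comp]; positivity
  · simp only [Function.comp]
    have hp : 0 < ‖(⟨_, hm ν⟩ : L)‖ := norm_pos_iff.2 (fun h => h0 (hi (by simp only [h]; ext; simp)))
    rw [inv_pow]
    refine inv_anti₀ (pow_pos hp _) (pow_le_pow_left₀ hp.le ?_ _)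
    show ‖(fun k => (ν k : ℝ))‖ ≤ nm ν
    refine (pi_norm_le_iff_of_nonneg (nm_nonneg ν)).2 fun k => ?_
    exact Finset.single_le_sum (f := fun k => |(ν k : ℝ)|) (fun _ _ => abs_nonneg _) (Finset.mem_univ k)
section meas
variable {T Bt L : Type} [Fintype T] [Fintype Bt] [Fintype L] [DecidableEq T] [DecidableEq Bt] [DecidableEq L]
variable {D : Dat T Bt L} {P : Par D} {b : ℝ} {E : ℝ≥0} {n : ℕ} {A : Set ℝ} {s : St T Bt L}
def Bad (P : Par D) (n : ℕ) (A : Set ℝ) (μ : L → ℝ → ℂ) (o o' : Option L) (ν : T → ℤ) : Set ℝ :=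
  {p ∈ A | ν ≠ 0 ∧ ‖Complex.I * (dot ν P.ω : ℂ) + (√p : ℂ) * (mo μ o p - mo μ o' p)‖ * nm ν ^ P.τ < P.γ * hh n}
lemma Pre.bad (h : Pre P b E n A s) (hs : Sm P b E) (o o') (ν : T → ℤ) : volume (Bad P n A s.μ o o' ν) ≤
    ENNReal.ofReal (8 * (P.M + 1) ^ 2 / (P.χ * P.γ) * (b * √b)) * ENNReal.ofReal (hh n) * ENNReal.ofReal ((nm ν ^ (2 * Fintype.card T))⁻¹) := by
  have h0 : 0 ≤ P.Θ E := Θ0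
  have hχ := P.hχ
  have hγ := P.hγ
  have hn0 := hh0 n
  have hb := hs.b0
  have hbb := Real.mul_self_sqrt hb.le
  have hb0 := Real.sqrt_pos.2 hb
  have hM0 : 0 ≤ P.M := (norm_nonneg _).trans (P.hM none none)
  refine (Real.volume_le_diam _).trans (Metric.ediam_le fun p hp q hq => ?_)
  obtain ⟨hpA, hν, hpb⟩ := hp
  obtain ⟨hqA, -, hqb⟩ := hq
  have hν1 := one_le_nm hν
  have hν0 : 0 < nm ν := by linarith
  set m := fun p => mo s.μ o p - mo s.μ o' p with hm
  have hz := P.hM o o'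
  have hsp : √p ≤ √b := Real.sqrt_le_sqrt (h.hA hpA).2
  have hsq : √q ≤ √b := Real.sqrt_le_sqrt (h.hA hqA).2
  have hd := P.dio ν hν
  have hmp := (h.dm o o').norm (by positivity) hpA
  have hmM : ‖m p‖ ≤ P.M + 1 := by
    have : m p = (m p - (P.z o - P.z o')) + (P.z o - P.z o') := by ring
    rw [this]
    exact (norm_add_le _ _).trans (by linarith [hs.s4, hmp, show ‖P.z o - P.z o'‖ ≤ P.M from hz])
  have e1 : P.γ ≤ √b * (P.M + 1) * nm ν ^ P.τ₁ := by
    have t1 : |dot ν P.ω| ≤ ‖Complex.I * (dot ν P.ω : ℂ) + (√p : ℂ) * m p‖ + √b * (P.M + 1) := by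
      have := norm_sub_le (Complex.I * (dot ν P.ω : ℂ) + (√p : ℂ) * m p) ((√p : ℂ) * m p)
      rw [add_sub_cancel_right, norm_mul, Complex.norm_I, one_mul, Complex.norm_real, Real.norm_eq_abs] at this
      refine this.trans (by gcongr; rw [norm_mul, Complex.norm_real, Real.norm_of_nonneg (Real.sqrt_nonneg _)]; gcongr)
    have t2 : nm ν ^ P.τ₁ ≤ nm ν ^ P.τ := pow_le_pow_right₀ hν1 (by have := P.hττ; omega)
    have t3 := mul_le_mul_of_nonneg_left t2 (norm_nonneg (Complex.I * (dot ν P.ω : ℂ) + (√p : ℂ) * m p))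
    have t4 := mul_le_mul_of_nonneg_right t1 (pow_nonneg hν0.le P.τ₁)
    have t5 : P.γ * hh n ≤ P.γ := mul_le_of_le_one_right hγ.le (hh1 n)
    linarith
  by_cases hoo : o = o'
  · exfalso
    subst hoo
    simp only [sub_self, mul_zero, add_zero, norm_mul, Complex.norm_I, one_mul, Complex.norm_real, Real.norm_eq_abs] at hpb
    have t2 : nm ν ^ P.τ₁ ≤ nm ν ^ P.τ := pow_le_pow_right₀ hν1 (by have := P.hττ; omega)
    have t3 := mul_le_mul_of_nonneg_left t2 (abs_nonneg (dot ν P.ω))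
    have t5 : P.γ * hh n ≤ P.γ := mul_le_of_le_one_right hγ.le (hh1 n)
    linarith
  have hmχ : P.χ - 6 * P.Θ E ≤ ‖m p‖ := by
    have h2 : P.χ ≤ ‖P.z o - P.z o'‖ := P.hsep o o' hoo
    have h3 := norm_sub_norm_le (P.z o - P.z o') ((P.z o - P.z o') - m p)
    rw [sub_sub_cancel, norm_sub_rev (P.z o - P.z o')] at h3
    linarith
  have hp0 : 0 ≤ p := by have := (h.hA hpA).1; linarith
  have hq0 : 0 ≤ q := by have := (h.hA hqA).1; linarith
  have hpq : |p - q| ≤ |√p - √q| * (2 * √b) := by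
    have : p - q = (√p - √q) * (√p + √q) := by nlinarith [Real.mul_self_sqrt hp0, Real.mul_self_sqrt hq0]
    rw [this, abs_mul]
    refine mul_le_mul_of_nonneg_left ?_ (abs_nonneg _)
    rw [abs_of_nonneg (by positivity)]; linarith
  have hlip : b * ‖m p - m q‖ ≤ 6 * P.Θ E * |p - q| := by
    have := (h.dm o o').lip hpA hqA
    rw [sub_sub_sub_cancel_right, ← ofReal_norm, edist_dist, ← ENNReal.ofReal_mul hb.le, ← ENNReal.ofReal_mul (by positivity), ENNReal.ofReal_le_ofReal_iff (by positivity)] at this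
    exact this
  have e2 : √b * ‖m p - m q‖ ≤ 12 * P.Θ E * |√p - √q| := by
    have : √b * (√b * ‖m p - m q‖) ≤ √b * (12 * P.Θ E * |√p - √q|) := by
      rw [← mul_assoc, hbb]
      refine hlip.trans ((mul_le_mul_of_nonneg_left hpq (by positivity)).trans (le_of_eq (by ring)))
    exact le_of_mul_le_mul_left this hb0
  have e3 : P.χ / 2 * |√p - √q| ≤ ‖(√p : ℂ) * m p - (√q : ℂ) * m q‖ := by
    have t1 : (√p : ℂ) * m p - (√q : ℂ) * m q = ((√p - √q : ℝ) : ℂ) * m p - (-((√q : ℂ) * (m p - m q))) := by push_cast; ring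
    have t2 := norm_sub_norm_le (((√p - √q : ℝ) : ℂ) * m p) (-((√q : ℂ) * (m p - m q)))
    rw [t1]; refine le_trans ?_ t2
    rw [norm_neg, norm_mul, norm_mul, Complex.norm_real, Complex.norm_real, Real.norm_of_nonneg (Real.sqrt_nonneg _), Real.norm_eq_abs]
    have t3 := mul_le_mul_of_nonneg_right hsq (norm_nonneg (m p - m q))
    have t4 := mul_le_mul_of_nonneg_left hmχ (abs_nonneg (√p - √q))
    have t5 := mul_le_mul_of_nonneg_right hs.s5 (abs_nonneg (√p - √q))
    linarith
  have e4 : ‖(√p : ℂ) * m p - (√q : ℂ) * m q‖ * nm ν ^ P.τ ≤ 2 * (P.γ * hh n) := by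
    have t1 : (√p : ℂ) * m p - (√q : ℂ) * m q = (Complex.I * (dot ν P.ω : ℂ) + (√p : ℂ) * m p) - (Complex.I * (dot ν P.ω : ℂ) + (√q : ℂ) * m q) := by ring
    rw [t1]
    have := mul_le_mul_of_nonneg_right (norm_sub_le (Complex.I * (dot ν P.ω : ℂ) + (√p : ℂ) * m p) (Complex.I * (dot ν P.ω : ℂ) + (√q : ℂ) * m q)) (pow_nonneg hν0.le P.τ)
    rw [add_mul] at this
    linarith
  rw [← ENNReal.ofReal_mul (by positivity), ← ENNReal.ofReal_mul (by positivity), edist_dist, Real.dist_eq]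
  refine ENNReal.ofReal_le_ofReal ?_
  set y := nm ν with hy
  have e5 : y ^ (2 * P.τ₁ + 2 * Fintype.card T) ≤ y ^ P.τ := pow_le_pow_right₀ hν1 P.hττ
  have e6 : P.χ / 2 * |√p - √q| * y ^ (2 * P.τ₁ + 2 * Fintype.card T) ≤ 2 * (P.γ * hh n) :=
    (mul_le_mul e3 e5 (by positivity) (by positivity)).trans e4
  have e7 : P.γ ^ 2 ≤ b * (P.M + 1) ^ 2 * y ^ (2 * P.τ₁) := by
    have := pow_le_pow_left₀ hγ.le e1 2
    refine this.trans (le_of_eq ?_)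
    rw [mul_pow, mul_pow, ← pow_mul, Real.sq_sqrt hb.le, mul_comm P.τ₁ 2]
  have e8 : P.χ * P.γ * |√p - √q| * y ^ (2 * Fintype.card T) ≤ 4 * hh n * (b * (P.M + 1) ^ 2) := by
    have t1 := mul_le_mul_of_nonneg_right e7 (show 0 ≤ P.χ * |√p - √q| * y ^ (2 * Fintype.card T) by positivity)
    have t2 := mul_le_mul_of_nonneg_left e6 (show 0 ≤ b * (P.M + 1) ^ 2 by positivity)
    rw [pow_add] at t2
    have : P.γ * (P.χ * P.γ * |√p - √q| * y ^ (2 * Fintype.card T)) ≤ P.γ * (4 * hh n * (b * (P.M + 1) ^ 2)) := by linarith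
    exact le_of_mul_le_mul_left this hγ
  rw [← div_eq_mul_inv, le_div_iff₀ (by positivity)]
  refine (mul_le_mul_of_nonneg_right hpq (by positivity)).trans ?_
  have : 8 * (P.M + 1) ^ 2 / (P.χ * P.γ) * (b * √b) * hh n = (4 * hh n * (b * (P.M + 1) ^ 2)) * (2 * √b) / (P.χ * P.γ) := by ring
  rw [this, le_div_iff₀ (by positivity)]
  have := mul_le_mul_of_nonneg_right e8 (show 0 ≤ 2 * √b by positivity)
  linarith
noncomputable def Par.KK (P : Par D) : ℝ≥0∞ := (Fintype.card (Option L) : ℝ≥0∞) * ((Fintype.card (Option L) : ℝ≥0∞) *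
  (∑' ν : T → ℤ, ENNReal.ofReal ((nm ν ^ (2 * Fintype.card T))⁻¹) * ENNReal.ofReal (8 * (P.M + 1) ^ 2 / (P.χ * P.γ)) * 2))
lemma Par.KK_ne (P : Par D) (t : T) : P.KK ≠ ⊤ := by
  have hT : 0 < Fintype.card T := Fintype.card_pos_iff.2 ⟨t⟩
  have h1 := (summable_nm (T := T) (n := 2 * Fintype.card T) (by omega)).tsum_ofReal_ne_top
  unfold Par.KK
  simp_rw [mul_assoc, ENNReal.tsum_mul_right]
  refine ENNReal.mul_ne_top (by simp) (ENNReal.mul_ne_top (by simp) (ENNReal.mul_ne_top h1 (ENNReal.mul_ne_top (by simp) (by simp))))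
lemma Pre.meas (hs : Sm P b E) {A' : ℕ → Set ℝ} {s : ℕ → St T Bt L} (h : ∀ n, Pre P b E n (A' n) (s n) ∧ A' (n + 1) = P.nx n (A' n) (s n).μ) :
    volume (A' 0 \ ⋂ n, A' n) ≤ P.KK * ENNReal.ofReal (b * √b) := by
  have hb := hs.b0
  have h1 : A' 0 \ ⋂ n, A' n ⊆ ⋃ n, ⋃ o, ⋃ o', ⋃ ν, Bad P n (A' n) (s n).μ o o' ν := fun p hp => by
    by_contra hc
    simp only [Set.mem_iUnion, not_exists] at hc
    refine hp.2 (Set.mem_iInter.2 fun n => ?_)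
    induction n with
    | zero => exact hp.1
    | succ n ih =>
      rw [(h n).2]
      exact ⟨ih, fun o o' ν hν => not_lt.1 fun hl => hc n o o' ν ⟨ih, hν, hl⟩⟩
  refine (measure_mono h1).trans ((measure_iUnion_le _).trans ?_)
  have hC : ENNReal.ofReal (8 * (P.M + 1) ^ 2 / (P.χ * P.γ) * (b * √b)) = ENNReal.ofReal (8 * (P.M + 1) ^ 2 / (P.χ * P.γ)) * ENNReal.ofReal (b * √b) :=
    ENNReal.ofReal_mul (by have := P.hχ; have := P.hγ; positivity)
  have hg : ∑' n, ENNReal.ofReal (hh n) = 2 := by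
    have := ENNReal.tsum_geometric_two
    convert this using 3 with n
    simp only [hh]; rw [ENNReal.ofReal_pow (by norm_num), one_div, ENNReal.ofReal_inv_of_pos (by norm_num)]; simp
  calc _ ≤ ∑' n, ∑' o : Option L, ∑' o' : Option L, ∑' ν : T → ℤ, ENNReal.ofReal (8 * (P.M + 1) ^ 2 / (P.χ * P.γ) * (b * √b)) * ENNReal.ofReal (hh n) * ENNReal.ofReal ((nm ν ^ (2 * Fintype.card T))⁻¹) := by
        refine ENNReal.tsum_le_tsum fun n => (measure_iUnion_le _).trans (ENNReal.tsum_le_tsum fun o => (measure_iUnion_le _).trans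
          (ENNReal.tsum_le_tsum fun o' => (measure_iUnion_le _).trans (ENNReal.tsum_le_tsum fun ν => (h n).1.bad hs o o' ν)))
    _ = P.KK * ENNReal.ofReal (b * √b) := by
      simp_rw [tsum_fintype, Finset.sum_const, nsmul_eq_mul, Finset.card_univ, ENNReal.tsum_mul_left, ENNReal.tsum_mul_right, ENNReal.tsum_mul_left, Par.KK, ENNReal.tsum_mul_right, hg, hC]
      ring
end meas
end
section
section lim
variable {T Bt L : Type} [Fintype T] [Fintype Bt] [Fintype L] [DecidableEq T] [DecidableEq Bt] [DecidableEq L]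
variable {D : Dat T Bt L} {P : Par D} {b : ℝ} {E : ℝ≥0} {n : ℕ} {A : Set ℝ}
def Bx (p : ℝ) (ρ : ℝ) (u : Fn T) : Prop := ∃ B, 0 ≤ B ∧ Bd {p} 0 ρ u B
variable {p ρ : ℝ} {u v : Fn T}
lemma Bx.add (h : Bx p ρ u) (h' : Bx p ρ v) : Bx p ρ (fun p ψ => u p ψ + v p ψ) :=
  let ⟨_, a, b⟩ := h; let ⟨_, a', b'⟩ := h'; ⟨_, add_nonneg a a', b.add b' a a'⟩
lemma Bx.mul (h : Bx p ρ u) (h' : Bx p ρ v) : Bx p ρ (fun p ψ => u p ψ * v p ψ) :=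
  let ⟨_, a, b⟩ := h; let ⟨_, a', b'⟩ := h'; ⟨_, mul_nonneg a a', b.mul b' a⟩
lemma Bx.smul (h : Bx p ρ u) (z : ℂ) : Bx p ρ (fun p ψ => z * u p ψ) :=
  let ⟨_, a, b⟩ := h; ⟨_, mul_nonneg (norm_nonneg z) a, b.smul z⟩
lemma Bx.sum {ι : Type} [Fintype ι] {w : ι → Fn T} (hρ : 0 ≤ ρ) (h : ∀ i, Bx p ρ (w i)) : Bx p ρ (fun p ψ => ∑ i, w i p ψ) := by
  choose C a b using h
  exact ⟨_, Finset.sum_nonneg fun i _ => a i, Bd.fsum _ hρ a b⟩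
lemma Bx.dif (h : Bx p ρ u) (hρ : 0 < ρ) : Dif u p := let ⟨_, a, b⟩ := h; b.dif hρ rfl
lemma Bx.mean_dv (h : Bx p ρ u) (hρ : 0 < ρ) (v) : mean (dv v u) p = 0 := let ⟨_, a, b⟩ := h; b.mean_dv hρ rfl v
lemma Bx.dv (h : Bx p ρ u) {δ : ℝ} (hδ : 0 < δ) (hδρ : δ ≤ ρ) (v) : Bx p (ρ - δ) (dv v u) :=
  let ⟨_, a, b⟩ := h; ⟨_, by positivity, b.dv hδ hδρ v⟩
lemma lam_zero {β₀ : Bt → ℝ} {f : Fn (T ⊕ Bt)} {C R η κ : ℝ} {ω : T → ℝ} {K : Ix T Bt → Fn T} {Λ : T → ℂ} (hρ : 0 < ρ) (hη : 0 ≤ η) (hC : 0 ≤ C)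
    (hf : Bd {p} 0 R f C) (hR : ρ + η ≤ R) (hK : ∀ i, Bd {p} 0 ρ (K i) η) (rK : ∀ i, Rl {p} (K i))
    (h1 : ∀ j ψ, DD (fun _ => κ) ω (K (.inl j)) p ψ = K (.inr j) p ψ)
    (h2 : ∀ j ψ, DD (fun _ => κ) ω (K (.inr j)) p ψ + cmp β₀ (gr f j) (fun j => K (.inl j)) p ψ = Sum.elim Λ (fun _ => 0) j) (t : T) :
    Λ t = 0 := by
  have hρ2 : 0 < ρ / 2 := by linarith
  have hρe : ρ - ρ / 2 = ρ / 2 := by ring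
  have hKx : ∀ i, Bx p (ρ / 2) (K i) := fun i => ⟨η, hη, (hK i).rho hρ2.le (by linarith)⟩
  have hKd : ∀ i, Dif (K i) p := fun i => (hK i).dif hρ rfl
  have hdx : ∀ i, Bx p (ρ / 2) (dv (Pi.single t 1) (K i)) := fun i => by
    have h : Bx p ρ (K i) := ⟨η, hη, hK i⟩
    have := h.dv hρ2 (by linarith) (Pi.single t 1)
    rwa [hρe] at this
  let e : T ⊕ Bt → ℂ := Sum.elim Λ (fun _ => 0)
  have hcx : Bx p (ρ / 2) (cmp β₀ f (fun j => K (.inl j))) :=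
    ⟨C, hC, (Bd.cmp hf hρ.le hη hR (fun j => hK _) (fun j => rK _)).rho hρ2.le (by linarith)⟩
  let G : Fn T := fun p ψ => (κ : ℂ)⁻¹ * (K (.inr (.inl t)) p ψ + ∑ j, dv (Pi.single t 1) (K (.inl j)) p ψ * K (.inr j) p ψ)
  let H : Fn T := fun p ψ => cmp β₀ f (fun j => K (.inl j)) p ψ + ∑ j, ((-1 / 2) * (K (.inr j) p ψ * K (.inr j) p ψ) + (-e j) * K (.inl j) p ψ)
  have hGs : Bx p (ρ / 2) (fun p ψ => ∑ j, dv (Pi.single t 1) (K (.inl j)) p ψ * K (.inr j) p ψ) := Bx.sum hρ2.le fun j => (hdx _).mul (hKx _)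
  have hG : Bx p (ρ / 2) G := ((hKx _).add hGs).smul _
  have hHs : ∀ j, Bx p (ρ / 2) (fun p ψ => (-1 / 2) * (K (.inr j) p ψ * K (.inr j) p ψ) + (-e j) * K (.inl j) p ψ) := fun j =>
    (((hKx _).mul (hKx _)).smul _).add ((hKx _).smul _)
  have hH : Bx p (ρ / 2) H := hcx.add (Bx.sum hρ2.le hHs)
  have key : ∀ ψ, dv ω G p ψ + dv (Pi.single t 1) H p ψ = Λ t := fun ψ => by
    have a1 : dv ω G p ψ = (κ : ℂ)⁻¹ * (dv ω (K (.inr (.inl t))) p ψ + ∑ j, (dv ω (dv (Pi.single t 1) (K (.inl j))) p ψ * K (.inr j) p ψ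
        + dv (Pi.single t 1) (K (.inl j)) p ψ * dv ω (K (.inr j)) p ψ)) := by
      simp only [G]
      rw [dv_smul (fun _ => (κ : ℂ)⁻¹), dv_add (hKd _) (hGs.dif hρ2), dv_sum _ (fun j => ((hdx _).mul (hKx _)).dif hρ2)]
      simp_rw [dv_mul ((hdx _).dif hρ2) (hKd _)]
    have a2 : dv (Pi.single t 1) H p ψ = dv (Pi.single t 1) (cmp β₀ f (fun j => K (.inl j))) p ψ + ∑ j, ((-1 / 2) *
        (dv (Pi.single t 1) (K (.inr j)) p ψ * K (.inr j) p ψ + K (.inr j) p ψ * dv (Pi.single t 1) (K (.inr j)) p ψ) + (-e j) * dv (Pi.single t 1) (K (.inl j)) p ψ) := by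
      simp only [H]
      rw [dv_add (hcx.dif hρ2) ((Bx.sum hρ2.le hHs).dif hρ2), dv_sum _ (fun j => (hHs j).dif hρ2)]
      congr 1
      refine Finset.sum_congr rfl fun j _ => ?_
      rw [dv_add ((((hKx _).mul (hKx _)).smul _).dif hρ2) (((hKx _).smul _).dif hρ2), dv_smul (fun _ => -1 / 2), dv_smul (fun _ => -e j), dv_mul (hKd _) (hKd _)]
    have a3 : ∀ j, (κ : ℂ)⁻¹ * dv ω (dv (Pi.single t 1) (K (.inl j))) p ψ = dv (Pi.single t 1) (K (.inr j)) p ψ := fun j => by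
      rw [(hK _).dv_comm hρ rfl, ← dv_congr (h1 j), ← dv_smul (fun _ => (κ : ℂ)⁻¹)]; rfl
    rw [a1, a2, (Bd.chain hf (by linarith) (fun j => hKd _) rfl (fun j => rK _) _ ψ).2]
    have a4 : ∀ j, cmp β₀ (dv (Pi.single j 1) f) (fun j => K (.inl j)) p ψ = e j - (κ : ℂ)⁻¹ * dv ω (K (.inr j)) p ψ := fun j => by
      rw [show e j = _ from (h2 j ψ).symm]; simp only [DD, gr]; ring
    simp_rw [a4]
    have a5 : ∑ j : T ⊕ Bt, (e j - (κ : ℂ)⁻¹ * dv ω (K (.inr j)) p ψ) * ((Sum.elim (Pi.single t 1) (0 : Bt → ℝ) j : ℝ) : ℂ)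
        = Λ t - (κ : ℂ)⁻¹ * dv ω (K (.inr (.inl t))) p ψ := by
      rw [Finset.sum_eq_single (Sum.inl t)]
      · simp [e]
      · rintro (j | j) _ hj
        · have : j ≠ t := fun h => hj (by rw [h])
          simp [Pi.single_eq_of_ne this]
        · simp
      · simp
    have a6 : (κ : ℂ)⁻¹ * ∑ j, (dv ω (dv (Pi.single t 1) (K (.inl j))) p ψ * K (.inr j) p ψ + dv (Pi.single t 1) (K (.inl j)) p ψ * dv ω (K (.inr j)) p ψ)
        + ∑ j, (e j - (κ : ℂ)⁻¹ * dv ω (K (.inr j)) p ψ) * dv (Pi.single t 1) (K (.inl j)) p ψ + ∑ j, ((-1 / 2) *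
        (dv (Pi.single t 1) (K (.inr j)) p ψ * K (.inr j) p ψ + K (.inr j) p ψ * dv (Pi.single t 1) (K (.inr j)) p ψ) + (-e j) * dv (Pi.single t 1) (K (.inl j)) p ψ) = 0 := by
      rw [Finset.mul_sum, ← Finset.sum_add_distrib, ← Finset.sum_add_distrib]
      refine Finset.sum_eq_zero fun j _ => ?_
      linear_combination K (.inr j) p ψ * a3 j
    have a7 : ∀ F G H : T ⊕ Bt → ℂ, ∑ j, F j * (G j + H j) = ∑ j, F j * G j + ∑ j, F j * H j := fun F G H => by simp only [mul_add, Finset.sum_add_distrib]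
    rw [a7, a5]
    linear_combination a6
  obtain ⟨_, -, b1⟩ := hG.dv (δ := ρ / 4) (by linarith) (by linarith) ω
  obtain ⟨_, -, b2⟩ := hH.dv (δ := ρ / 4) (by linarith) (by linarith) (Pi.single t 1)
  have := mean_add b1 b2 rfl
  rw [mean_congr (v := fun _ _ => Λ t) key, hG.mean_dv hρ2, hH.mean_dv hρ2, mean_const (fun _ => Λ t)] at this
  simpa using this
lemma Pre.lim (hs : Sm P b E) {A' : ℕ → Set ℝ} {s : ℕ → St T Bt L} (h : ∀ n, Pre P b E n (A' n) (s n) ∧ A' (n + 1) = P.nx n (A' n) (s n).μ ∧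
      ∀ i, Bd (A' (n + 1)) (ENNReal.ofReal b) (D.R / 8) (fun p ψ => (s (n + 1)).K i p ψ - (s n).K i p ψ) (P.Θ E * hh n)) (hp : ∀ n, p ∈ A' n) :
    ∃ K : Ix T Bt → Fn T, (∀ i, Bd {p} 0 (D.R / 8) (K i) (3 * P.Θ E)) ∧ (∀ i, Rl {p} (K i)) ∧
      (∀ j ψ, DD Real.sqrt P.ω (K (.inl j)) p ψ = K (.inr j) p ψ) ∧
      (∀ j ψ, DD Real.sqrt P.ω (K (.inr j)) p ψ = - cmp D.β₀ (gr D.f j) (fun j => K (.inl j)) p ψ) := by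
  have h0 : 0 ≤ P.Θ E := Θ0
  have hR := P.hR
  have z0 : ∀ {S σ ρ u B}, Bd (d := T) S σ ρ u B → p ∈ S → Bd {p} 0 ρ u B := fun {S σ ρ u B} hb hS => by
    obtain ⟨h0, c, b, h1, h2, h3⟩ := hb.subset (Set.singleton_subset_iff.2 hS)
    refine ⟨h0, c, b, h1, fun ν => ?_, h3⟩
    obtain ⟨s, l, e1, e2, e3⟩ := h2 ν
    exact ⟨s, l, e1, e2, fun p _ q _ => by simp⟩
  have hd : ∀ n i, Bd {p} 0 (D.R / 8) (fun p ψ => (s (n + 1)).K i p ψ - (s n).K i p ψ) (P.Θ E * hh n) := fun n i => z0 ((h n).2.2 i) (hp _)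
  have hg : HasSum hh 2 := hasSum_geometric_two
  have hd0 : ∀ n, 0 ≤ P.Θ E * hh n := fun n => mul_nonneg h0 (hh0 n).le
  have hsum : ∀ i ψ, Summable fun n => (s (n + 1)).K i p ψ - (s n).K i p ψ := fun i ψ =>
    Summable.of_norm_bounded (hg.summable.mul_left (P.Θ E)) fun n => (hd n i).norm_le (hd0 n) rfl ψ
  let K : Ix T Bt → Fn T := fun i q ψ => (s 0).K i p ψ + ∑' n, ((s (n + 1)).K i p ψ - (s n).K i p ψ)
  have htail : ∀ N i, Bd {p} 0 (D.R / 8) (fun p ψ => K i p ψ - (s N).K i p ψ) (P.Θ E * (2 * hh N)) := fun N i => by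
    refine Bd.tsum (by positivity) (fun n => hd (n + N) i) (fun q hq ψ => ?_) (le_of_eq ?_)
    · rw [Set.mem_singleton_iff] at hq; rw [hq]
      have := (hasSum_nat_add_iff' (f := fun n => (s (n + 1)).K i p ψ - (s n).K i p ψ) N).2 (hsum i ψ).hasSum
      rw [Finset.sum_range_sub (fun n => (s n).K i p ψ)] at this
      have e : K i p ψ - (s N).K i p ψ = (∑' (b : ℕ), ((s (b + 1)).K i p ψ - (s b).K i p ψ) - ((s N).K i p ψ - (s 0).K i p ψ)) := by
        show (s 0).K i p ψ + _ - _ = _; ring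
      rw [e]; exact this
    · have h1 : HasSum (fun n => P.Θ E * hh (n + N)) (P.Θ E * (2 * hh N)) := by
        have := (hg.mul_right (hh N)).mul_left (P.Θ E)
        have e : (fun n => P.Θ E * hh (n + N)) = fun n => P.Θ E * (hh n * hh N) := by funext n; simp only [hh, pow_add]
        rw [e]; exact this
      rw [← h1.tsum_eq, ENNReal.ofReal_tsum_of_nonneg (fun n => hd0 _) h1.summable]
  have hhl : Tendsto hh atTop (nhds 0) := tendsto_pow_atTop_nhds_zero_of_lt_one (by norm_num) (by norm_num)
  have hKl : ∀ i ψ, Tendsto (fun N => (s N).K i p ψ) atTop (nhds (K i p ψ)) := fun i ψ => by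
    rw [tendsto_iff_norm_sub_tendsto_zero]
    refine squeeze_zero (fun _ => norm_nonneg _) (fun N => ?_) (g := fun N => P.Θ E * (2 * hh N)) (by simpa using (hhl.const_mul 2).const_mul (P.Θ E))
    rw [norm_sub_rev]
    exact (htail N i).norm_le (mul_nonneg h0 (mul_nonneg zero_le_two (hh0 N).le)) (Set.mem_singleton p) ψ
  have hr8 : ∀ n, 0 < P.rr n ∧ D.R / 8 ≤ P.rr n := fun n => by
    have : D.R / 8 ≤ P.rr n := by unfold Par.rr; nlinarith [hh0 n]
    exact ⟨by linarith, this⟩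
  have hKN : ∀ N i, Bd {p} 0 (D.R / 8) ((s N).K i) (P.ηη E N) := fun N i => (z0 ((h N).1.hK i) (hp N)).rho (by positivity) (hr8 N).2
  have hK : ∀ i, Bd {p} 0 (D.R / 8) (K i) (3 * P.Θ E) := fun i => by
    refine (((htail 0 i).add (hKN 0 i) (mul_nonneg h0 (mul_nonneg zero_le_two (hh0 0).le)) ηη0).mono (le_of_eq ?_)).congr fun q _ ψ => by ring
    simp only [Par.ηη, hh]; ring
  have hDl : ∀ i ψ, Tendsto (fun N => DD Real.sqrt P.ω ((s N).K i) p ψ) atTop (nhds (DD Real.sqrt P.ω (K i) p ψ)) := fun i ψ => by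
    simp only [DD]
    refine Tendsto.const_mul _ ?_
    rw [tendsto_iff_norm_sub_tendsto_zero]
    refine squeeze_zero (fun _ => norm_nonneg _) (fun N => ?_) (g := fun N => ‖P.ω‖ / (D.R / 8) * (P.Θ E * (2 * hh N)))
      (by simpa using ((hhl.const_mul 2).const_mul (P.Θ E)).const_mul (‖P.ω‖ / (D.R / 8)))
    have := ((htail N i).dv (δ := D.R / 8) (by positivity) le_rfl P.ω).norm_le (mul_nonneg (by positivity) (mul_nonneg h0 (mul_nonneg zero_le_two (hh0 N).le))) (Set.mem_singleton p) ψ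
    rwa [dv_sub ((hK i).dif (by positivity) rfl) ((hKN N i).dif (by positivity) rfl), norm_sub_rev] at this
  have hcl : ∀ j ψ, Tendsto (fun N => cmp D.β₀ (gr D.f j) (fun j => (s N).K (.inl j)) p ψ) atTop (nhds (cmp D.β₀ (gr D.f j) (fun j => K (.inl j)) p ψ)) := fun j ψ => by
    have hc := ((P.hg {p} 0 j).hasFDerivAt hR rfl (xx D.β₀ (fun j => K (.inl j)) p ψ)).continuousAt
    refine hc.tendsto.comp (tendsto_pi_nhds.2 fun i => ?_)
    simp only [xx, Pi.add_apply]
    exact ((Complex.continuous_re.tendsto _).comp (hKl (.inl i) ψ)).const_add _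
  have hel : ∀ i ψ, Tendsto (fun N => er Real.sqrt P.ω D.β₀ D.f (s N) i p ψ) atTop (nhds 0) := fun i ψ => by
    rw [tendsto_zero_iff_norm_tendsto_zero]
    refine squeeze_zero (fun _ => norm_nonneg _) (fun N => ((h N).1.he i).norm_le (by positivity) (hp N) ψ) ?_
    have h1 : Tendsto (fun N => (E : ℝ) * hh N ^ P.k) atTop (nhds 0) := by
      have := (hhl.pow P.k).const_mul (E : ℝ)
      rwa [zero_pow (by unfold Par.k; omega), mul_zero] at this
    refine h1.congr fun N => ?_
    simp [Par.EE, hh]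
  have rK : ∀ i, Rl {p} (K i) := fun i q hq ψ => by
    have := (Complex.continuous_im.tendsto _).comp (hKl i ψ)
    have h2 : (Complex.im ∘ fun N => (s N).K i p ψ) = fun _ => 0 := funext fun N => (h N).1.rK i p (hp N) ψ
    rw [h2] at this
    exact tendsto_nhds_unique this tendsto_const_nhds
  have e1 : ∀ j ψ, DD Real.sqrt P.ω (K (.inl j)) p ψ = K (.inr j) p ψ := fun j ψ => by
    have := tendsto_nhds_unique (hel (.inl j) ψ) ((hDl (.inl j) ψ).sub (hKl (.inr j) ψ))
    exact (sub_eq_zero.1 this.symm)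
  have e2 : ∀ j ψ, Tendsto (fun N => (Sum.elim (fun t => (s N).lam t p) (fun _ => 0) j : ℂ)) atTop
      (nhds (DD Real.sqrt P.ω (K (.inr j)) p ψ + cmp D.β₀ (gr D.f j) (fun j => K (.inl j)) p ψ)) := fun j ψ => by
    have := ((hDl (.inr j) ψ).add (hcl j ψ)).sub (hel (.inr j) ψ)
    rw [sub_zero] at this
    refine this.congr fun N => ?_
    simp only [er]; ring
  let Λ : T → ℂ := fun t => DD Real.sqrt P.ω (K (.inr (.inl t))) p 0 + cmp D.β₀ (gr D.f (.inl t)) (fun j => K (.inl j)) p 0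
  have e3 : ∀ j ψ, DD Real.sqrt P.ω (K (.inr j)) p ψ + cmp D.β₀ (gr D.f j) (fun j => K (.inl j)) p ψ = Sum.elim Λ (fun _ => 0) j := by
    rintro (t | t) ψ
    · exact tendsto_nhds_unique (e2 (.inl t) ψ) (e2 (.inl t) 0)
    · exact tendsto_nhds_unique (e2 (.inr t) ψ) tendsto_const_nhds
  have hC : Bd {p} 0 D.R D.f |D.C| := (P.hf {p} 0).mono (le_abs_self _)
  have e4 := lam_zero (β₀ := D.β₀) (f := D.f) (κ := √p) (ω := P.ω) (Λ := Λ) (by positivity) (by positivity) (abs_nonneg _) hC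
    (show D.R / 8 + 3 * P.Θ E ≤ D.R by linarith [hs.s3]) hK rK e1 e3
  refine ⟨K, hK, rK, e1, fun j ψ => ?_⟩
  have := e3 j ψ
  have h5 : Sum.elim Λ (fun _ => 0) j = 0 := by rcases j with t | t <;> simp [e4]
  rw [h5] at this
  exact eq_neg_of_add_eq_zero_left this
end lim
end
section
section ini
variable {T Bt L : Type} [Fintype T] [Fintype Bt] [Fintype L] [DecidableEq T] [DecidableEq Bt] [DecidableEq L]
lemma Bd.all {ρ B : ℝ} {u : (T → ℝ) → ℂ} (h : Bd {0} 0 ρ (fun _ => u) B) (S : Set ℝ) (σ : ℝ≥0∞) : Bd S σ ρ (fun _ => u) B := by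
  obtain ⟨h0, c, b, h1, h2, h3⟩ := h
  exact ⟨h0, fun ν _ => c ν 0, b, fun p _ ψ => h1 0 rfl ψ, fun ν => (LB.const _).mono ((h2 ν).enorm rfl), h3⟩
lemma Bx.rt {ρ : ℝ} {u : (T → ℝ) → ℂ} (h : Bx 0 ρ (fun _ => u)) : ∃ B : ℝ, 0 ≤ B ∧ ∀ b, 0 < b →
    Bd (Set.Icc (b / 4) b) (ENNReal.ofReal b) ρ (fun p ψ => ((√p : ℝ) : ℂ) * u ψ) (√b * B) := by
  obtain ⟨B, h0, h⟩ := h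
  refine ⟨2 * B, by positivity, fun b hb => ?_⟩
  have := (Bd.of_LB (d := T) h.1 (sqrt_LB hb subset_rfl)).mul (h.all (Set.Icc (b / 4) b) (ENNReal.ofReal b)) (by positivity)
  exact this.mono (by linarith)
lemma solve0 {ρ δ γ : ℝ} {g : (T → ℝ) → ℂ} {ω : T → ℝ} {τ : ℕ} (hδ : 0 < δ) (hδρ : δ < ρ) (hγ : 0 < γ)
    (dio : ∀ ν : T → ℤ, ν ≠ 0 → γ ≤ |dot ν ω| * nm ν ^ τ) (hg : Bx 0 ρ (fun _ => g)) (h0 : mean (fun _ => g) 0 = 0) :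
    ∃ v : (T → ℝ) → ℂ, Bx 0 (ρ - δ) (fun _ => v) ∧ ∀ p ψ, dv ω (fun _ => v) p ψ = g ψ := by
  obtain ⟨B, hB, hg⟩ := hg
  have i1 := norm_nonneg ω
  have i2 : 0 < 1 / γ := by positivity
  have i3 : 0 < 1 / δ := by positivity
  obtain ⟨v, hv, hc⟩ := solve_aux (S := {0}) (σ := 0) (κ := fun _ => 1) (ω := ω) (γ := γ)
    (X := 3 + 1 / γ + ‖ω‖ + 1 / δ + ((2 * τ + 1).factorial : ℝ)) (Y := 1) (δ := δ) (τ := τ) (m := fun _ => 0) (g := fun _ => g)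
    (fun p hp ν hν => by
      have := dio ν hν
      simpa using this) hγ (by linarith) (by linarith) (by linarith) zero_le_one
    (by simpa using LB.const (S := {0}) (σ := 0) 1) le_rfl ((LB.const 0).mono (by simp)) hδ (by linarith) hδρ.le (by linarith) hg
  refine ⟨v 0, ⟨_, by positivity, hv.congr fun p hp ψ => by rw [show p = 0 from hp]⟩, fun p ψ => ?_⟩
  have h2 : 0 < (ρ - δ) / 2 := by linarith
  show dv ω v 0 ψ = g ψ
  refine Bd.ext (S := {0}) (v := fun _ => g) (hv.dv h2 (by linarith) ω) hg rfl (fun ν => ?_) ψ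
  rw [hv.coef_dv (by linarith) rfl, hc 0 rfl]
  split_ifs with h
  · subst h; rw [coef_zero, h0]; simp
  · have : (dot ν ω : ℂ) ≠ 0 := by
      have := dio ν h
      intro h'
      rw [Complex.ofReal_eq_zero] at h'
      rw [h'] at this; simp at this; linarith
    push_cast
    field_simp
    simp
structure Ini (β₀ : Bt → ℝ) (f : (T ⊕ Bt → ℝ) → ℂ) (R : ℝ) (ω : T → ℝ) (γ : ℝ) (τ : ℕ) (U : Bt → Bt → ℂ) (a : Bt → ℂ) : Prop where
  hR : 0 < R
  hf : Bx 0 (3 * R) (fun _ => f)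
  fr : ∀ x, (f x).im = 0
  hγ : 0 < γ
  dio : ∀ ν : T → ℤ, ν ≠ 0 → γ ≤ |dot ν ω| * nm ν ^ τ
  crit : ∀ j, mean (cmp β₀ (gr (fun _ => f) (.inr j)) (fun _ _ (_ : T → ℝ) => 0)) 0 = 0
  eig : ∀ k j, ∑ i, mean (cmp β₀ (dv (Pi.single (.inr i) 1) (gr (fun _ => f) (.inr j))) (fun _ _ (_ : T → ℝ) => 0)) 0 * U k i = a k * U k j
variable {β₀ : Bt → ℝ} {f : (T ⊕ Bt → ℝ) → ℂ} {R : ℝ} {ω : T → ℝ} {γ : ℝ} {τ : ℕ} {U : Bt → Bt → ℂ} {a : Bt → ℂ}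
lemma Bx.cm {g : Fn (T ⊕ Bt)} (hR : 0 < R) (h : Bx 0 R g) : Bx 0 R (cmp β₀ g (fun _ _ (_ : T → ℝ) => 0)) :=
  let ⟨B, h0, h⟩ := h; ⟨B, h0, h.cmp hR.le le_rfl (by linarith) (fun _ => Bd.zero hR.le) (fun _ _ _ _ => rfl)⟩
lemma mean_t {g : Fn (T ⊕ Bt)} (hR : 0 < R) (h : Bx 0 R g) (t : T) :
    mean (cmp β₀ (dv (Pi.single (.inl t) 1) g) (fun _ _ (_ : T → ℝ) => 0)) 0 = 0 := by
  refine Eq.trans ?_ ((h.cm (β₀ := β₀) hR).mean_dv hR (Pi.single t 1))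
  obtain ⟨B, h0, h⟩ := h
  refine mean_congr fun ψ => ?_
  rw [(h.chain (β₀ := β₀) hR (u := fun _ _ (_ : T → ℝ) => 0) (fun j => (Bd.zero (S := {0}) (σ := 0) (ρ := 1) zero_le_one).dif one_pos rfl) rfl (fun _ _ _ _ => rfl) _ ψ).2,
    Finset.sum_eq_single (Sum.inl t)]
  · simp [dv]
  · rintro (j | j) - hj
    · have : j ≠ t := fun h => hj (by rw [h])
      simp [dv, this]
    · simp [dv]
  · simp
lemma Ini.hg (H : Ini β₀ f R ω γ τ U a) (j) : Bx 0 (2 * R) (gr (fun _ => f) j) := by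
  have := H.hf.dv H.hR (by linarith [H.hR]) (Pi.single j 1)
  rwa [show 3 * R - R = 2 * R by ring] at this
lemma Ini.hQ (H : Ini β₀ f R ω γ τ U a) (i j) : Bx 0 R (dv (Pi.single i 1) (gr (fun _ => f) j)) := by
  have := (H.hg j).dv H.hR (by linarith [H.hR]) (Pi.single i 1)
  rwa [show 2 * R - R = R by ring] at this
lemma Ini.y (H : Ini β₀ f R ω γ τ U a) (j) : ∃ y : (T → ℝ) → ℂ, (∀ ψ, (y ψ).im = 0) ∧ Bx 0 (R / 2) (fun _ => y) ∧
    ∀ p ψ, dv ω (fun _ => y) p ψ = - cmp β₀ (gr (fun _ => f) j) (fun _ _ (_ : T → ℝ) => 0) 0 ψ := by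
  have hR := H.hR
  have hg : Bx 0 R (gr (fun _ => f) j) := let ⟨B, h0, h⟩ := H.hg j; ⟨B, h0, h.rho hR.le (by linarith)⟩
  have hm : mean (cmp β₀ (gr (fun _ => f) j) (fun _ _ (_ : T → ℝ) => 0)) 0 = 0 := by
    rcases j with t | j
    · obtain ⟨B, h0, h⟩ := H.hf
      exact mean_t (R := R) hR ⟨B, h0, h.rho hR.le (by linarith)⟩ t
    · exact H.crit j
  have h1 := (hg.cm (β₀ := β₀) hR).smul (-1)
  obtain ⟨v, hv, h⟩ := solve0 (δ := R / 2) (g := fun ψ => (-1) * cmp β₀ (gr (fun _ => f) j) (fun _ _ (_ : T → ℝ) => 0) 0 ψ) (by linarith) (by linarith) H.hγ H.dio h1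
    (by have := mean_smul (-1) (cmp β₀ (gr (fun _ => f) j) (fun _ _ (_ : T → ℝ) => 0)) 0
        rw [hm, mul_zero] at this; exact this)
  have hd : ∀ p, Dif (fun _ => v) p := fun p => hv.dif (by linarith)
  refine ⟨fun ψ => ((v ψ).re : ℂ), fun ψ => by simp, ?_, fun p ψ => ?_⟩
  · have : R - R / 2 = R / 2 := by ring
    rw [this] at hv
    obtain ⟨B, h0, hv⟩ := hv
    exact ⟨_, by positivity, ((hv.add hv.conj h0 h0).smul (1 / 2)).congr fun p _ ψ => by rw [Complex.add_conj]; push_cast; ring⟩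
  · have e := dv_re (hd p) ω ψ
    rw [h] at e
    refine e.trans ?_
    obtain ⟨B, h0, hf⟩ := H.hf
    have : (gr (fun _ => f) j 0 (xx β₀ (fun _ _ (_ : T → ℝ) => 0) 0 ψ)).im = 0 :=
      Rl.dv (S := {0}) (fun _ _ x => H.fr x) rfl (hf.dif (by linarith) rfl) _ _
    exact Complex.ext (by simp [cmp]) (by simp [cmp, this])
lemma Ini.w (H : Ini β₀ f R ω γ τ U a) (k j) : ∃ y : (T → ℝ) → ℂ, Bx 0 (R / 2) (fun _ => y) ∧
    ∀ p ψ, dv ω (fun _ => y) p ψ = a k * Sum.elim (fun _ => 0) (U k) j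
      - ∑ i, cmp β₀ (dv (Pi.single i 1) (gr (fun _ => f) j)) (fun _ _ (_ : T → ℝ) => 0) 0 ψ * Sum.elim (fun _ => 0) (U k) i := by
  have hR := H.hR
  let Q : T ⊕ Bt → Fn T := fun i => cmp β₀ (dv (Pi.single i 1) (gr (fun _ => f) j)) (fun _ _ (_ : T → ℝ) => 0)
  have hQ : ∀ i, Bx 0 R (Q i) := fun i => (H.hQ i j).cm (β₀ := β₀) hR
  have h1 : ∀ i, Bx 0 R (fun p ψ => (-(Sum.elim (fun _ => 0) (U k) i : ℂ)) * Q i p ψ) := fun i => (hQ i).smul _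
  have h2 := Bx.sum hR.le h1
  have hm : mean (fun p ψ => ∑ i, (-(Sum.elim (fun _ => 0) (U k) i : ℂ)) * Q i p ψ) 0 = - (a k * Sum.elim (fun _ => 0) (U k) j) := by
    choose B b0 hb using h1
    rw [mean_sum _ (Finset.sum_nonneg fun i _ => b0 i) hR.le (fun i => (hb i).mono (Finset.single_le_sum (fun i _ => b0 i) (Finset.mem_univ i))) rfl]
    simp_rw [mean_smul]
    rw [Fintype.sum_sum_type]
    simp only [Sum.elim_inl, Sum.elim_inr, neg_zero, zero_mul, Finset.sum_const_zero, zero_add]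
    rcases j with t | j
    · simp only [Sum.elim_inl, mul_zero, neg_zero]
      refine Finset.sum_eq_zero fun i _ => ?_
      have : mean (Q (.inr i)) 0 = mean (cmp β₀ (dv (Pi.single (.inl t) 1) (gr (fun _ => f) (.inr i))) (fun _ _ (_ : T → ℝ) => 0)) 0 := by
        obtain ⟨B, h0, h⟩ := H.hf
        exact mean_congr fun ψ => h.dv_comm (by linarith) rfl _ _ _
      rw [this, mean_t (R := 2 * R) (by linarith) (H.hg _), mul_zero]
    · rw [Sum.elim_inr, ← H.eig, ← Finset.sum_neg_distrib]
      exact Finset.sum_congr rfl fun i _ => by ring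
  have hc : Bx 0 R (fun _ (_ : T → ℝ) => a k * Sum.elim (fun _ => 0) (U k) j) := ⟨_, norm_nonneg _, Bd.const hR.le _⟩
  obtain ⟨v, hv, h⟩ := solve0 (δ := R / 2) (g := fun ψ => a k * Sum.elim (fun _ => 0) (U k) j + ∑ i, (-(Sum.elim (fun _ => 0) (U k) i : ℂ)) * Q i 0 ψ)
    (by linarith) (by linarith) H.hγ H.dio (hc.add h2) (by
      obtain ⟨_, _, c1⟩ := hc
      obtain ⟨_, _, c2⟩ := h2
      have := mean_add c1 c2 (p := 0) rfl
      rw [mean_const, hm, add_neg_cancel] at this; exact this)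
  refine ⟨v, by rwa [show R - R / 2 = R / 2 by ring] at hv, fun p ψ => ?_⟩
  rw [h, sub_eq_add_neg, ← Finset.sum_neg_distrib]
  congr 1
  exact Finset.sum_congr rfl fun i _ => by ring
end ini
end
section
section ini
variable {T Bt L : Type} [Fintype T] [Fintype Bt] [Fintype L] [DecidableEq T] [DecidableEq Bt] [DecidableEq L]
variable {β₀ : Bt → ℝ} {f : (T ⊕ Bt → ℝ) → ℂ} {R : ℝ} {ω : T → ℝ} {γ : ℝ} {τ : ℕ} {U Z : Bt → Bt → ℂ} {a : Bt → ℂ}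
noncomputable def V1 (U : Bt → Bt → ℂ) (m : Bt × Bool → ℂ) (l : Bt × Bool) : Ix T Bt → ℂ :=
  Sum.elim (Sum.elim (fun _ => 0) (U l.1)) (fun j => m l * Sum.elim (fun _ => 0) (U l.1) j)
noncomputable def W1 (Z : Bt → Bt → ℂ) (m : Bt × Bool → ℂ) : Fr T (Bt × Bool) → Ix T Bt → ℂ
  | .inl k => fun i => dl i k
  | .inr (.inl k) => fun i => dn i k
  | .inr (.inr l) => Sum.elim (Sum.elim (fun _ => 0) (fun b => Z l.1 b / 2)) (Sum.elim (fun _ => 0) (fun b => (m l)⁻¹ * Z l.1 b / 2))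
lemma WV {m0 : Bt → ℂ} {m : Bt × Bool → ℂ} (h0 : ∀ k, m0 k ≠ 0) (hm : ∀ l, m l = (if l.2 then 1 else -1) * m0 l.1)
    (hZ : ∀ k k', ∑ b, Z k b * U k' b = if k = k' then 1 else 0) (b b' : Fr T (Bt × Bool)) :
    ∑ i, W1 Z m b i * P0 (V1 U m) i b' = if b = b' then 1 else 0 := by
  rcases b with k | k | l <;> rcases b' with k' | k' | l' <;>
    simp [Fintype.sum_sum_type, W1, V1, P0, dl, dn]
  · simp [eq_comm]
  · simp [eq_comm]
  · have e1 : ∑ x, Z l.1 x / 2 * U l'.1 x = (if l.1 = l'.1 then 1 else 0) / 2 := by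
      rw [← hZ, Finset.sum_div]; exact Finset.sum_congr rfl fun _ _ => by ring
    have e2 : ∑ x, (m l)⁻¹ * Z l.1 x / 2 * (m l' * U l'.1 x) = (m l)⁻¹ * m l' * (if l.1 = l'.1 then 1 else 0) / 2 := by
      rw [← hZ, Finset.mul_sum, Finset.sum_div]; exact Finset.sum_congr rfl fun _ _ => by ring
    rw [e1, e2, hm, hm]
    obtain ⟨k, s⟩ := l
    obtain ⟨k', s'⟩ := l'
    by_cases hk : k = k'
    · subst hk
      have := h0 k
      cases s <;> cases s' <;> simp <;> field_simp <;> norm_num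
    · simp [hk]
lemma sum2_nn {ι ι' : Type} [Fintype ι] [Fintype ι'] {B : ι → ι' → ℝ} (h : ∀ i j, 0 ≤ B i j) : 0 ≤ ∑ i, ∑ j, B i j :=
  Finset.sum_nonneg fun j _ => Finset.sum_nonneg fun k _ => h _ _
lemma le_sum2 {ι ι' : Type} [Fintype ι] [Fintype ι'] {B : ι → ι' → ℝ} (h : ∀ i j, 0 ≤ B i j) (i j) : B i j ≤ ∑ i, ∑ j, B i j :=
  (Finset.single_le_sum (fun j _ => h i j) (Finset.mem_univ j)).trans
    (Finset.single_le_sum (f := fun i => ∑ j, B i j) (fun i _ => Finset.sum_nonneg fun k _ => h _ _) (Finset.mem_univ i))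
lemma Ini.state (H : Ini β₀ f R ω γ τ U a) {m : Bt × Bool → ℂ} (hm : ∀ l, m l * m l = - a l.1) :
    ∃ C : ℝ, 0 ≤ C ∧ ∃ s : St T Bt (Bt × Bool), (s.μ = fun l _ => m l) ∧ (s.lam = fun _ _ => 0) ∧ (∀ i S, Rl S (s.K i)) ∧
      ∀ b, 0 < b → (∀ i, Bd (Set.Icc (b / 4) b) (ENNReal.ofReal b) (R / 4) (s.K i) (√b * C)) ∧
        (∀ k i, Bd (Set.Icc (b / 4) b) (ENNReal.ofReal b) (R / 4) (dv (Pi.single k 1) (s.K i)) (√b * C)) ∧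
        (∀ l i, Bd (Set.Icc (b / 4) b) (ENNReal.ofReal b) (R / 4) (fun p ψ => s.V l i p ψ - V1 U m l i) (√b * C)) ∧
        (∀ i, Bd (Set.Icc (b / 4) b) (ENNReal.ofReal b) (R / 4) (er Real.sqrt ω β₀ (fun _ => f) s i) (√b * C)) ∧
        (∀ l i, Bd (Set.Icc (b / 4) b) (ENNReal.ofReal b) (R / 4) (FF Real.sqrt ω β₀ (fun _ => f) s l i) (√b * C)) := by
  have hR := H.hR
  have hR4 : (0:ℝ) ≤ R / 4 := by linarith
  choose y yr hy ye using H.y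
  choose w hw we using H.w
  have hy4 : ∀ j, Bx 0 (R / 4) (fun _ => y j) := fun j => let ⟨B, h0, h⟩ := hy j; ⟨B, h0, h.rho hR4 (by linarith)⟩
  have hw4 : ∀ k j, Bx 0 (R / 4) (fun _ => w k j) := fun k j => let ⟨B, h0, h⟩ := hw k j; ⟨B, h0, h.rho hR4 (by linarith)⟩
  have hdy : ∀ k j, Bx 0 (R / 4) (fun _ => dv (Pi.single k 1) (fun _ => y j) 0) := fun k j => by
    have := (hy j).dv (δ := R / 4) (by linarith) (by linarith) (Pi.single k 1)
    rwa [show R / 2 - R / 4 = R / 4 by ring] at this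
  choose By by0 hby using fun j => (hy4 j).rt
  choose Bw bw0 hbw using fun k j => (hw4 k j).rt
  choose Bm bm0 hbm using fun (l : Bt × Bool) j => ((hw4 l.1 j).smul (m l)).rt
  choose Bd' bd0 hbd using fun k j => (hdy k j).rt
  let C := ∑ j, By j + ∑ k, ∑ j, Bw k j + ∑ l, ∑ j, Bm l j + ∑ k, ∑ j, Bd' k j
  have p1 : 0 ≤ ∑ j, By j := Finset.sum_nonneg fun j _ => by0 j
  have p2 := sum2_nn bw0
  have p3 := sum2_nn bm0
  have p4 := sum2_nn bd0
  have q1 : ∀ j, By j ≤ C := fun j => by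
    have := Finset.single_le_sum (fun j _ => by0 j) (Finset.mem_univ j); linarith
  have q2 : ∀ k j, Bw k j ≤ C := fun k j => by have := le_sum2 bw0 k j; linarith
  have q3 : ∀ k j, Bm k j ≤ C := fun k j => by have := le_sum2 bm0 k j; linarith
  have q4 : ∀ k j, Bd' k j ≤ C := fun k j => by have := le_sum2 bd0 k j; linarith
  have hC : 0 ≤ C := by positivity
  have ydif : ∀ p j, Dif (fun _ => y j) p := fun p j => (hy4 j).dif (by linarith)
  have wdif : ∀ p k j, Dif (fun _ => w k j) p := fun p k j => (hw4 k j).dif (by linarith)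
  refine ⟨C, hC, ⟨Sum.elim (fun _ _ _ => 0) (fun j p ψ => ((√p : ℝ) : ℂ) * y j ψ), fun _ _ => 0,
    fun l => Sum.elim (fun j _ _ => Sum.elim (fun _ => 0) (U l.1) j) (fun j p ψ => ((√p : ℝ) : ℂ) * w l.1 j ψ + m l * Sum.elim (fun _ => 0) (U l.1) j),
    fun l _ => m l⟩, rfl, rfl, ?_, fun b hb => ?_⟩
  · rintro (i | i) S p _ ψ
    · rfl
    · simp [yr]
  have hsb := Real.sqrt_nonneg b
  have z0 : ∀ g : Fn T, (∀ p ∈ Set.Icc (b / 4) b, ∀ ψ, g p ψ = 0) → Bd (Set.Icc (b / 4) b) (ENNReal.ofReal b) (R / 4) g (√b * C) := fun g h =>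
    ((Bd.zero hR4).congr h).mono (by positivity)
  have hs : ∀ p ∈ Set.Icc (b / 4) b, ((√p : ℝ) : ℂ) ≠ 0 := fun p hp => by
    have := hp.1
    exact_mod_cast (Real.sqrt_pos.mpr (by linarith)).ne'
  refine ⟨?_, ?_, ?_, ?_, ?_⟩
  · rintro (j | j)
    · exact z0 _ fun p _ ψ => rfl
    · exact (hby j b hb).mono (by gcongr; exact q1 j)
  · rintro k (j | j)
    · exact z0 _ fun p _ ψ => by simp [dv]
    · exact ((hbd k j b hb).mono (by gcongr; exact q4 k j)).congr fun p _ ψ => dv_smul (fun p => ((√p : ℝ) : ℂ)) (fun _ => y j) p _ ψ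
  · rintro l (j | j)
    · exact z0 _ fun p _ ψ => by simp [V1]
    · exact ((hbw l.1 j b hb).mono (by gcongr; exact q2 _ j)).congr fun p _ ψ => by simp [V1]
  · rintro (j | j)
    · exact ((hby j b hb).neg.mono (by gcongr; exact q1 j)).congr fun p _ ψ => by simp [er, DD, dv]
    · refine z0 _ fun p hp ψ => ?_
      have := dv_smul (fun p => ((√p : ℝ) : ℂ)) (fun _ => y j) p ω ψ
      simp only [er, DD, Sum.elim_inr]
      rw [this, ye, ← mul_assoc, inv_mul_cancel₀ (hs p hp), one_mul]
      cases j <;> simp [cmp, gr, dv, xx]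
  · rintro l (j | j)
    · refine ((hbw l.1 j b hb).neg.mono (by gcongr; exact q2 _ j)).congr fun p _ ψ => ?_
      simp [FF, DD, dv, BB]
    · refine ((hbm l j b hb).mono (by gcongr; exact q3 _ j)).congr fun p hp ψ => ?_
      have e1 := dv_add (u := fun p ψ => ((√p : ℝ) : ℂ) * w l.1 j ψ) (v := fun p (_ : T → ℝ) => m l * Sum.elim (fun _ => 0) (U l.1) j) (p := p)
        (fun ψ v => (wdif p l.1 j ψ v).const_mul _) (fun ψ v => differentiableAt_const _) ω ψ
      rw [dv_const (fun _ => m l * Sum.elim (fun _ => 0) (U l.1) j), dv_smul (fun p => ((√p : ℝ) : ℂ)) (fun _ => w l.1 j), we, add_zero] at e1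
      simp only [FF, DD, BB, Sum.elim_inr, QQ, Sum.elim_inl]
      rw [e1, ← mul_assoc, inv_mul_cancel₀ (hs p hp), one_mul, mul_add, ← mul_assoc (m l) (m l), hm]
      have : ∀ i, cmp β₀ (dv (Pi.single i 1) (gr (fun _ => f) j)) (fun _ _ (_ : T → ℝ) => 0) p ψ =
        cmp β₀ (dv (Pi.single i 1) (gr (fun _ => f) j)) (fun _ _ (_ : T → ℝ) => 0) 0 ψ := fun i => rfl
      simp_rw [this]; ring
theorem Ini.par (H : Ini β₀ f R ω γ τ U a) (hZ : ∀ k k', ∑ b, Z k b * U k' b = if k = k' then 1 else 0)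
    (ha : ∀ k, a k ≠ 0) (hi : Function.Injective a) :
    ∃ (D : Dat T Bt (Bt × Bool)) (P : Par D), D.β₀ = β₀ ∧ D.f = (fun _ => f) ∧ P.ω = ω ∧ D.R = R ∧ D.V₀ = V1 U P.m ∧ ∀ l, P.m l * P.m l = - a l.1 := by
  have hR := H.hR
  have hm0 : ∀ k, ∃ z : ℂ, z * z = - a k := fun k => let ⟨z, hz⟩ := IsAlgClosed.exists_pow_nat_eq (- a k) (n := 2) two_pos; ⟨z, by rw [← hz]; ring⟩
  choose m0 hm0 using hm0
  have m00 : ∀ k, m0 k ≠ 0 := fun k h => ha k (by have := hm0 k; rw [h] at this; simpa using this.symm)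
  let m : Bt × Bool → ℂ := fun l => (if l.2 then 1 else -1) * m0 l.1
  have hm : ∀ l, m l * m l = - a l.1 := fun ⟨k, s⟩ => by
    rw [← hm0]; cases s <;> simp [m]
  have mz : ∀ l, m l ≠ 0 := fun l h => ha l.1 (by have := hm l; rw [h] at this; simpa using this.symm)
  let z : Option (Bt × Bool) → ℂ := fun o => mo (fun l _ => m l) o 0
  have zi : ∀ o o', o ≠ o' → z o - z o' ≠ 0 := by
    rintro (_ | ⟨k, s⟩) (_ | ⟨k', s'⟩) hoo h
    · exact hoo rfl
    · simp [z, mo] at h; exact mz _ h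
    · simp [z, mo] at h; exact mz _ h
    · have h : m (k, s) = m (k', s') := by simpa [z, mo, sub_eq_zero] using h
      have e := hm (k, s)
      rw [h, hm] at e
      have e : k' = k := hi (by simpa using e)
      subst e
      have := m00 k'
      cases s <;> cases s' <;> simp [m, self_eq_neg, neg_eq_self, this] at h hoo
  obtain ⟨Cf, hCf, hf⟩ := H.hf
  choose Bg bg0 hbg using H.hg
  choose Bq bq0 hbq using H.hQ
  let w : ℝ := 1 + ∑ b, ∑ i, ‖W1 (T := T) Z m b i‖ + ∑ b, ∑ i, ‖V1 (T := T) U m b i‖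
  have w1 := sum2_nn fun b i => norm_nonneg (W1 (T := T) Z m b i)
  have w2 := sum2_nn fun b i => norm_nonneg (V1 (T := T) U m b i)
  let M : ℝ := ∑ o, ∑ o', ‖z o - z o'‖
  have M0 : 0 ≤ M := sum2_nn fun o o' => norm_nonneg _
  let c : ℝ := 1 + ∑ o, ∑ o', ‖z o - z o'‖⁻¹
  have c0 : 1 ≤ c := by have := sum2_nn fun o o' => inv_nonneg.mpr (norm_nonneg (z o - z o')); linarith
  let τ' := 2 * τ + 2 * Fintype.card T
  let N := Fintype.card (Ix T Bt)
  have g1 : 0 ≤ ∑ j, Bg j := Finset.sum_nonneg fun j _ => bg0 j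
  have g2 := sum2_nn bq0
  have hγ := H.hγ
  let X : ℝ := 3 + ∑ j, Bg j + ∑ i, ∑ j, Bq i j + 2 * w + 192 / R + 1 / (γ / 2) + ‖ω‖ + ((2 * τ' + 1).factorial : ℝ) + N + (M + 1) + (2 / c⁻¹ + (M + 1) * (2 / c⁻¹) ^ 2)
  have x1 : 0 < 192 / R := by positivity
  have x2 : 0 < 1 / (γ / 2) := by positivity
  have x3 := norm_nonneg ω
  have x4 : (0:ℝ) ≤ ((2 * τ' + 1).factorial : ℝ) := Nat.cast_nonneg _
  have x5 : (0:ℝ) ≤ N := Nat.cast_nonneg _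
  have x6 : (0:ℝ) ≤ 2 / c⁻¹ + (M + 1) * (2 / c⁻¹) ^ 2 := by positivity
  have x7 : 1 ≤ w := by simp only [w]; linarith
  let D : Dat T Bt (Bt × Bool) := ⟨β₀, fun _ => f, V1 U m, W1 Z m, R, w, Cf⟩
  refine ⟨D,
    { ω := ω, τ := τ', τ₁ := τ, N := N, X := X, γ := γ / 2, M := M, χ := c⁻¹, m := m, hR := hR
      hf := fun S σ => (hf.rho hR.le (by show R ≤ _; linarith)).all S σ
      hg := fun S σ j => by
        have := Finset.single_le_sum (fun j _ => bg0 j) (Finset.mem_univ j)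
        exact Bd.all (u := gr (fun _ => f) j 0) (((hbg j).rho (ρ' := R) hR.le (by linarith)).mono (B := X) (by simp only [X]; linarith)) S σ
      hQ := fun S σ i j => by
        have := le_sum2 bq0 i j
        exact Bd.all (u := dv (Pi.single i 1) (gr (fun _ => f) j) 0) ((hbq i j).mono (B := X) (by simp only [X]; linarith)) S σ
      fr := fun _ x => H.fr x
      hW := WV m00 (fun _ => rfl) hZ
      card := by simp; ring
      hN := le_rfl, w1 := x7, wX := by simp only [X, D]; linarith
      hw := fun b i => by
        have := le_sum2 (fun b i => norm_nonneg (W1 (T := T) Z m b i)) b i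
        simp only [D, w]; linarith
      hv := fun b i => by
        have := le_sum2 (fun b i => norm_nonneg (V1 (T := T) U m b i)) b i
        simp only [D, w]; linarith
      hX := by simp only [X]; linarith
      hRX := by show 192 / R ≤ X; simp only [X]; linarith
      hγ := by linarith
      hγX := by simp only [X]; linarith
      hω := by simp only [X]; linarith
      hτ := by simp only [X]; linarith
      hNX := by simp only [X]; linarith
      hχ := by positivity
      hM := fun o o' => le_sum2 (fun o o' => norm_nonneg (z o - z o')) o o'
      hM1 := by simp only [X]; linarith
      hχX := by simp only [X]; linarith
      hsep := fun o o' h => by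
        have := le_sum2 (fun o o' => inv_nonneg.mpr (norm_nonneg (z o - z o'))) o o'
        exact inv_le_of_inv_le₀ (norm_pos_iff.mpr (zi o o' h)) (by linarith)
      dio := fun ν hν => by rw [mul_div_cancel₀ _ two_ne_zero]; exact H.dio ν hν
      hττ := le_rfl }, rfl, rfl, rfl, rfl, rfl, hm⟩
theorem Ini.start (H : Ini β₀ f R ω γ τ U a) (hZ : ∀ k k', ∑ b, Z k b * U k' b = if k = k' then 1 else 0)
    (ha : ∀ k, a k ≠ 0) (hi : Function.Injective a) :
    ∃ (D : Dat T Bt (Bt × Bool)) (P : Par D) (κ₁ : ℝ), 0 < κ₁ ∧ D.β₀ = β₀ ∧ D.f = (fun _ => f) ∧ P.ω = ω ∧ D.R = R ∧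
      ∀ b, 0 < b → √b ≤ κ₁ → ∃ E s, Sm P b E ∧ 3 * P.Θ E ≤ R ∧ Pre P b E 0 (Set.Icc (b / 4) b) s := by
  have hR := H.hR
  obtain ⟨D, P, rfl, hDf, hPω, rfl, hV, hm⟩ := H.par hZ ha hi
  obtain ⟨C₁, hC₁, s, sμ, slam, sr, hs⟩ := H.state hm
  let G : ℝ := P.X ^ P.k * (C₁ + 1)
  have hX := P.hX
  have hG : 0 < G := by positivity
  have hχ := P.hχ
  obtain ⟨κ₁, hκ, k1⟩ : ∃ κ₁ : ℝ, 0 < κ₁ ∧ (κ₁ ≤ 1 / 2 ∧ 2 ^ P.k * (G * κ₁) ≤ 1 ∧ 12 * (P.N : ℝ) ^ 4 * D.w ^ 2 * (3 * (G * κ₁)) ≤ 1 ∧ 4 * (3 * (G * κ₁)) ≤ D.R ∧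
      6 * (G * κ₁) ≤ 1 ∧ 36 * (G * κ₁) ≤ P.χ) := by
    have ev : ∀ c d : ℝ, 0 < d → ∀ᶠ x in nhdsWithin (0:ℝ) (Set.Ioi 0), c * x ≤ d := fun c d hd => by
      have : Tendsto (fun x : ℝ => c * x) (nhdsWithin 0 (Set.Ioi 0)) (nhds (c * 0)) := ((continuous_const.mul continuous_id).tendsto 0).mono_left nhdsWithin_le_nhds
      rw [mul_zero] at this
      exact this.eventually (ge_mem_nhds hd)
    obtain ⟨x, h1, h2, h3, h4, h5, h6, h7⟩ := ((ev 1 (1/2) (by norm_num)).and <| (ev (2 ^ P.k * G) 1 one_pos).and <| (ev (12 * (P.N : ℝ) ^ 4 * D.w ^ 2 * (3 * G)) 1 one_pos).and <|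
      (ev (4 * (3 * G)) D.R hR).and <| (ev (6 * G) 1 one_pos).and <| (ev (36 * G) P.χ hχ).and self_mem_nhdsWithin).exists
    exact ⟨x, h7, by linarith, by linarith, by linarith, by linarith, by linarith, by linarith⟩
  refine ⟨D, P, κ₁, hκ, rfl, hDf, hPω, rfl, fun b hb hbk => ?_⟩
  have hsb := Real.sqrt_nonneg b
  let E : ℝ≥0 := ⟨√b * (C₁ + 1), mul_nonneg hsb (by linarith)⟩
  have hE : (E : ℝ) = √b * (C₁ + 1) := rfl
  have hΘ : P.Θ E ≤ G * κ₁ := by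
    calc P.Θ E = G * √b := by simp only [Par.Θ, hE, G]; ring
      _ ≤ _ := by gcongr
  have hEb : √b * C₁ ≤ E := mul_le_mul_of_nonneg_left (by linarith) hsb
  have hη : P.ηη E 0 = P.Θ E := by simp [Par.ηη, hh]; ring
  have hEE : (P.EE E 0 : ℝ) = E := by simp [Par.EE]
  have hr : P.rr 0 = D.R / 4 := by simp [Par.rr, hh]; ring
  have hbη : √b * C₁ ≤ P.Θ E := hEb.trans (le_mul_of_one_le_left E.2 (one_le_pow₀ (by linarith)))
  have Θ0 := Θ0 (P := P) (E := E)
  obtain ⟨k1, k2, k3, k4, k5, k6⟩ := k1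
  obtain ⟨b1, b2, b3, b4, b5⟩ := hs b hb
  refine ⟨E, s, ⟨hb, by linarith, le_trans (by gcongr) k2, le_trans (by gcongr) k3, le_trans (by gcongr) k4, by linarith, by linarith⟩, by linarith,
    ⟨subset_rfl, isClosed_Icc, ?_, fun i => sr i _, ?_, ?_, ?_, fun t p _ => by simp [slam], ?_, ?_⟩⟩
  · rw [hη, hr]; exact fun i => (b1 i).mono hbη
  · rw [hη, hr]; exact fun k i => (b2 k i).mono hbη
  · rw [hη, hr, hV]; exact fun k i => (b3 k i).mono hbη
  · intro l
    rw [sμ]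
    simpa using (LB.const (S := Set.Icc (b / 4) b) (σ := ENNReal.ofReal b) 0).mono (by simp)
  · rw [hEE, hr, hPω, hDf]; exact fun i => (b4 i).mono hEb
  · rw [hEE, hr, hPω, hDf]; exact fun k i => (b5 k i).mono hEb
end ini
end
section
section mn
variable {T Bt : Type} [Fintype T] [Fintype Bt] [DecidableEq T] [DecidableEq Bt]
variable {β₀ : Bt → ℝ} {f : (T ⊕ Bt → ℝ) → ℂ} {R : ℝ} {ω : T → ℝ} {γ : ℝ} {τ : ℕ} {U Z : Bt → Bt → ℂ} {a : Bt → ℂ}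
def Sol (β₀ : Bt → ℝ) (f : (T ⊕ Bt → ℝ) → ℂ) (R : ℝ) (ω : T → ℝ) (p : ℝ) (K : Ix T Bt → Fn T) : Prop :=
  (∀ i, Bd {p} 0 (R / 8) (K i) R) ∧ (∀ i, Rl {p} (K i)) ∧ (∀ j ψ, DD Real.sqrt ω (K (.inl j)) p ψ = K (.inr j) p ψ) ∧
    (∀ j ψ, DD Real.sqrt ω (K (.inr j)) p ψ = - cmp β₀ (gr (fun _ => f) j) (fun j => K (.inl j)) p ψ)
theorem Ini.main (H : Ini β₀ f R ω γ τ U a) (hZ : ∀ k k', ∑ b, Z k b * U k' b = if k = k' then 1 else 0)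
    (ha : ∀ k, a k ≠ 0) (hi : Function.Injective a) (t0 : T) : ∃ (K : ℝ≥0∞) (κ₁ : ℝ), K ≠ ⊤ ∧ 0 < κ₁ ∧ ∀ b, 0 < b → √b ≤ κ₁ →
      ∃ A ⊆ Set.Icc (b / 4) b, IsClosed A ∧ volume (Set.Icc (b / 4) b \ A) ≤ K * ENNReal.ofReal (b * √b) ∧
        ∀ p ∈ A, ∃ u, Sol β₀ f R ω p u := by
  obtain ⟨D, P, κ₁, h0, rfl, hf, rfl, rfl, h⟩ := H.start hZ ha hi
  refine ⟨P.KK, κ₁, P.KK_ne t0, h0, fun b hb hbκ => ?_⟩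
  obtain ⟨E, s, hs, hE, hp⟩ := h b hb hbκ
  obtain ⟨A', s, h00, hA⟩ := hp.seq hs t0
  refine ⟨⋂ n, A' n, ?_, isClosed_iInter fun n => (hA n).1.cA, ?_, fun p hp => ?_⟩
  · rw [← h00]; exact Set.iInter_subset _ _
  · rw [← h00]; exact Pre.meas hs fun n => ⟨(hA n).1, (hA n).2.1⟩
  · obtain ⟨K, h1, h2, h3, h4⟩ := Pre.lim hs hA (Set.mem_iInter.1 hp)
    exact ⟨K, fun i => (h1 i).mono hE, h2, h3, by rw [← hf]; exact h4⟩
end mn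
end
section
section ana
lemma pow_fac_le {x : ℝ} (hx : 0 ≤ x) (n : ℕ) : x ^ n / n.factorial ≤ Real.exp x := by
  have h : HasSum (fun n : ℕ => x ^ n / n.factorial) (Real.exp x) := by
    have := NormedSpace.expSeries_div_hasSum_exp (𝔸 := ℝ) x
    rwa [← Real.exp_eq_exp_ℝ] at this
  exact le_hasSum h n fun _ _ => by positivity
lemma ana_core {ι E : Type} [NormedAddCommGroup E] [NormedSpace ℝ E] {c : ι → ℂ} {l : ι → E →L[ℝ] ℂ} {F : E → ℂ} {x : E} {ρ : ℝ} (hρ : 0 < ρ)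
    (hs : Summable fun ν => ‖c ν‖ * Real.exp (ρ * ‖l ν‖)) (h : ∀ y, HasSum (fun ν => c ν * Complex.exp (l ν y)) (F (x + y))) : AnalyticAt ℝ F x := by
  let q : (n : ℕ) → ι → ContinuousMultilinearMap ℝ (fun _ : Fin n => E) ℂ := fun n ν =>
    (c ν * ((n.factorial : ℝ) : ℂ)⁻¹) • (ContinuousMultilinearMap.mkPiAlgebraFin ℝ n ℂ).compContinuousLinearMap (fun _ => l ν)
  have hq : ∀ n ν, ‖q n ν‖ * ρ ^ n ≤ ‖c ν‖ * Real.exp (ρ * ‖l ν‖) := fun n ν => by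
    have h1 : ‖q n ν‖ ≤ ‖c ν‖ * (n.factorial : ℝ)⁻¹ * ‖l ν‖ ^ n := by
      refine (norm_smul_le (c ν * ((n.factorial : ℝ) : ℂ)⁻¹) ((ContinuousMultilinearMap.mkPiAlgebraFin ℝ n ℂ).compContinuousLinearMap (fun _ => l ν))).trans ?_
      rw [norm_mul, norm_inv, Complex.norm_real, Real.norm_of_nonneg (by positivity)]
      refine mul_le_mul_of_nonneg_left ?_ (by positivity)
      refine (ContinuousMultilinearMap.norm_compContinuousLinearMap_le _ _).trans ?_
      simp
    calc _ ≤ ‖c ν‖ * (n.factorial : ℝ)⁻¹ * ‖l ν‖ ^ n * ρ ^ n := by gcongr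
      _ = ‖c ν‖ * ((ρ * ‖l ν‖) ^ n / n.factorial) := by rw [mul_pow]; ring
      _ ≤ _ := mul_le_mul_of_nonneg_left (pow_fac_le (by positivity) n) (norm_nonneg _)
  have hqs : ∀ n, Summable fun ν => ‖q n ν‖ := fun n => by
    refine Summable.of_nonneg_of_le (fun _ => norm_nonneg _) (fun ν => ?_) (hs.mul_right (ρ ^ n)⁻¹)
    rw [← div_eq_mul_inv, le_div_iff₀ (by positivity)]; exact hq n ν
  have he : ∀ n ν y, q n ν (fun _ => y) = c ν * ((l ν y) ^ n / n.factorial) := fun n ν y => by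
    simp [q, List.ofFn_const]; ring
  refine ⟨fun n => ∑' ν, q n ν, ENNReal.ofReal ρ, ?_, by simpa using hρ, fun {y} hy => ?_⟩
  · refine FormalMultilinearSeries.le_radius_of_bound _ (∑' ν, ‖c ν‖ * Real.exp (ρ * ‖l ν‖)) fun n => ?_
    rw [Real.coe_toNNReal _ hρ.le]
    calc _ ≤ (∑' ν, ‖q n ν‖) * ρ ^ n := by gcongr; exact norm_tsum_le_tsum_norm (hqs n)
      _ = ∑' ν, ‖q n ν‖ * ρ ^ n := tsum_mul_right.symm
      _ ≤ _ := Summable.tsum_le_tsum (hq n) ((hqs n).mul_right _) hs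
  · have hy' : ‖y‖ ≤ ρ := by
      rw [Metric.mem_eball, edist_zero_right, ← ofReal_norm] at hy
      exact ((ENNReal.ofReal_lt_ofReal_iff hρ).1 hy).le
    have hexp : ∀ z : ℂ, HasSum (fun n : ℕ => z ^ n / n.factorial) (Complex.exp z) := fun z => by
      have := NormedSpace.expSeries_div_hasSum_exp (𝔸 := ℂ) z
      rwa [← Complex.exp_eq_exp_ℂ] at this
    have hexr : ∀ x : ℝ, HasSum (fun n : ℕ => x ^ n / n.factorial) (Real.exp x) := fun x => by
      have := NormedSpace.expSeries_div_hasSum_exp (𝔸 := ℝ) x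
      rwa [← Real.exp_eq_exp_ℝ] at this
    have hS : Summable fun z : ι × ℕ => c z.1 * ((l z.1 y) ^ z.2 / z.2.factorial) := by
      refine Summable.of_norm ((summable_prod_of_nonneg fun _ => norm_nonneg _).2 ?_)
      have e : ∀ ν n, ‖c ν * ((l ν y) ^ n / (n.factorial : ℂ))‖ = ‖c ν‖ * (‖l ν y‖ ^ n / n.factorial) := fun ν n => by simp
      simp only [e]
      have e2 : ∀ ν, HasSum (fun n : ℕ => ‖c ν‖ * (‖l ν y‖ ^ n / n.factorial)) (‖c ν‖ * Real.exp ‖l ν y‖) := fun ν => (hexr _).mul_left _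
      refine ⟨fun ν => (e2 ν).summable, ?_⟩
      simp only [fun ν => (e2 ν).tsum_eq]
      refine Summable.of_nonneg_of_le (fun _ => by positivity) (fun ν => ?_) hs
      gcongr
      calc _ ≤ ‖l ν‖ * ‖y‖ := (l ν).le_opNorm y
        _ ≤ ρ * ‖l ν‖ := by rw [mul_comm]; gcongr
    have h1 : HasSum (fun z : ι × ℕ => c z.1 * ((l z.1 y) ^ z.2 / z.2.factorial)) (F (x + y)) := by
      have := hS.hasSum.prod_fiberwise fun ν => (hexp (l ν y)).mul_left (c ν)
      rw [(h y).unique this]; exact hS.hasSum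
    have h2 := (Equiv.prodComm ℕ ι).hasSum_iff.2 h1
    refine h2.prod_fiberwise fun n => ?_
    have := ContinuousMultilinearMap.hasSum_eval (Summable.of_norm (hqs n)).hasSum (fun _ => y)
    simp only [he] at this; exact this
variable {d : Type} [Fintype d]
noncomputable def ell (ν : d → ℤ) : (d → ℝ) →L[ℝ] ℂ :=
  ∑ k, (ContinuousLinearMap.proj (R := ℝ) (φ := fun _ : d => ℝ) k).smulRight ((ν k : ℂ) * Complex.I)
lemma ell_apply (ν : d → ℤ) (y : d → ℝ) : ell ν y = (dot ν y : ℂ) * Complex.I := by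
  simp only [ell, dot]; push_cast; rw [Finset.sum_mul]
  simp; exact Finset.sum_congr rfl fun k _ => by ring
lemma ell_norm (ν : d → ℤ) : ‖ell ν‖ ≤ nm ν := ContinuousLinearMap.opNorm_le_bound _ (nm_nonneg _) fun y => by
  rw [ell_apply, norm_mul, Complex.norm_I, mul_one, Complex.norm_real]; exact abs_dot_le ν y
lemma ee_add_right (ν : d → ℤ) (ψ y : d → ℝ) : ee ν (ψ + y) = ee ν ψ * Complex.exp (ell ν y) := by
  rw [ell_apply, ee, ee, dot_add_right, ← Complex.exp_add]; push_cast; ring_nf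
lemma Bd.ana {p ρ : ℝ} {u : Fn d} {B : ℝ} (hρ : 0 < ρ) (h : Bd {p} 0 ρ u B) : AnalyticOnNhd ℝ (u p) Set.univ := fun ψ _ => by
  obtain ⟨h0, c, b, h1, h2, h3⟩ := h
  refine ana_core (c := fun ν => c ν p * KAM.ee ν ψ) (l := fun ν => ell ν) hρ ?_ fun y => hs_congr (h1 p rfl (ψ + y)) fun ν => by rw [ee_add_right]; ring
  have hne : ∑' ν, b ν * wt ρ ν ≠ ⊤ := ne_top_of_le_ne_top ENNReal.ofReal_ne_top h3
  refine Summable.of_nonneg_of_le (fun _ => by positivity) (fun ν => ?_) (ENNReal.summable_toReal hne)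
  have hν := ENNReal.ne_top_of_tsum_ne_top hne ν
  rw [norm_mul, ee_norm, mul_one, ← ENNReal.ofReal_le_iff_le_toReal hν, ENNReal.ofReal_mul (norm_nonneg _), ofReal_norm]
  refine mul_le_mul' ((h2 ν).enorm rfl) (ENNReal.ofReal_le_ofReal (Real.exp_le_exp.2 (mul_le_mul_of_nonneg_left (ell_norm ν) hρ.le)))
lemma ee_per [DecidableEq d] (ν : d → ℤ) (ψ : d → ℝ) (i : d) : ee ν (ψ + Pi.single i (2 * π)) = ee ν ψ := by
  rw [ee_add_right, ell_apply]
  have : dot ν (Pi.single i (2 * π)) = ν i * (2 * π) := by simp [dot, Pi.single_apply]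
  rw [this]; push_cast
  rw [mul_assoc, Complex.exp_int_mul_two_pi_mul_I, mul_one]
lemma Bd.per [DecidableEq d] {p ρ : ℝ} {u : Fn d} {B : ℝ} (h : Bd {p} 0 ρ u B) (ψ : d → ℝ) (i : d) : u p (ψ + Pi.single i (2 * π)) = u p ψ := by
  obtain ⟨h0, c, b, h1, h2, h3⟩ := h
  exact (h1 p rfl _).unique (hs_congr (h1 p rfl ψ) fun ν => by rw [ee_per])
end ana
end
section
section tr
variable {T Bt : Type} [Fintype T] [Fintype Bt] [DecidableEq T] [DecidableEq Bt]
variable {β₀ : Bt → ℝ} {f : (T → ℝ) × (Bt → ℝ) → ℝ} {R : ℝ} {ω : T → ℝ}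
def pr (x : T ⊕ Bt → ℝ) : (T → ℝ) × (Bt → ℝ) := (fun i => x (.inl i), fun j => x (.inr j))
noncomputable def Fc (f : (T → ℝ) × (Bt → ℝ) → ℝ) (x : T ⊕ Bt → ℝ) : ℂ := (f (pr x) : ℂ)
lemma gr_Fc (hf : Differentiable ℝ f) (j : T ⊕ Bt) (p : ℝ) (x : T ⊕ Bt → ℝ) :
    gr (fun _ => Fc f) j p x = ((fderiv ℝ f (pr x) (pr (Pi.single j 1)) : ℝ) : ℂ) := by
  have h1 : HasDerivAt (fun t : ℝ => pr x + t • pr (Pi.single j 1)) (pr (Pi.single j 1)) 0 := by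
    simpa using ((hasDerivAt_id (0 : ℝ)).smul_const (pr (Pi.single j (1:ℝ)))).const_add (pr x)
  have h2 : HasFDerivAt f (fderiv ℝ f (pr x)) (pr x + (0:ℝ) • pr (Pi.single j 1)) := by simpa using (hf (pr x)).hasFDerivAt
  exact (h2.comp_hasDerivAt (0:ℝ) h1).ofReal_comp.deriv
lemma dv_at {u : Fn T} {p : ℝ} (h : Dif u p) (v ψ : T → ℝ) (t : ℝ) : HasDerivAt (fun t => (u p (ψ + t • v)).re) (dv v u p (ψ + t • v)).re t := by
  have h1 := (h (ψ + t • v) v).hasDerivAt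
  have e0 : HasDerivAt (fun s : ℝ => s - t) 1 t := (hasDerivAt_id t).sub_const t
  have h2 := HasDerivAt.scomp_of_eq t h1 e0 (by simp)
  rw [one_smul] at h2
  have h3 := Complex.reCLM.hasFDerivAt.comp_hasDerivAt t h2
  refine h3.congr_of_eventuallyEq (Eventually.of_forall fun s => ?_)
  simp only [Function.comp_apply, Complex.reCLM_apply]
  rw [add_assoc, ← add_smul]; simp
lemma Sol.fin {p : ℝ} {K : Ix T Bt → Fn T} (hf : Differentiable ℝ f) (hR : 0 < R) (hp : 0 < p) (h : Sol β₀ (Fc f) R ω p K) :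
    ∃ (A : (T → ℝ) → T → ℝ) (B : (T → ℝ) → Bt → ℝ), AnalyticOnNhd ℝ A Set.univ ∧ AnalyticOnNhd ℝ B Set.univ ∧
      (∀ ψ i, A (ψ + Pi.single i (2 * π)) = A ψ) ∧ (∀ ψ i, B (ψ + Pi.single i (2 * π)) = B ψ) ∧
      (∀ ψ : T → ℝ, ∀ t : ℝ, deriv (deriv fun u : ℝ => ψ + u • ω + A (ψ + u • ω)) t
              = (fun i => -p * fderiv ℝ f (ψ + t • ω + A (ψ + t • ω), β₀ + B (ψ + t • ω)) (Pi.single i 1, 0)) ∧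
            deriv (deriv fun u : ℝ => β₀ + B (ψ + u • ω)) t
              = (fun j => -p * fderiv ℝ f (ψ + t • ω + A (ψ + t • ω), β₀ + B (ψ + t • ω)) (0, Pi.single j 1))) := by
  obtain ⟨h1, h2, h3, h4⟩ := h
  have hR8 : 0 < R / 8 := by positivity
  have ha : ∀ i, AnalyticOnNhd ℝ (fun ψ => (K i p ψ).re) Set.univ := fun i ψ _ =>
    (Complex.reCLM.analyticAt _).comp ((h1 i).ana hR8 ψ trivial)
  have hs : √p ≠ 0 := (Real.sqrt_pos.2 hp).ne'
  have hsc : ((√p : ℝ) : ℂ) ≠ 0 := by exact_mod_cast hs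
  have hd : ∀ i, Dif (K i) p := fun i => (h1 i).dif hR8 rfl
  have d1 : ∀ j ψ t, HasDerivAt (fun t : ℝ => (K (.inl j) p (ψ + t • ω)).re) (√p * (K (.inr j) p (ψ + t • ω)).re) t := fun j ψ t => by
    convert dv_at (hd (.inl j)) ω ψ t using 1
    rw [← h3 j, DD, ← Complex.re_ofReal_mul, mul_inv_cancel_left₀ hsc]
  have d2 : ∀ j ψ t, HasDerivAt (fun t : ℝ => √p * (K (.inr j) p (ψ + t • ω)).re)
      (-p * fderiv ℝ f (pr (xx β₀ (fun j => K (.inl j)) p (ψ + t • ω))) (pr (Pi.single j 1))) t := fun j ψ t => by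
    refine ((dv_at (hd (.inr j)) ω ψ t).const_mul √p).congr_deriv ?_
    have e : dv ω (K (.inr j)) p (ψ + t • ω) = √p * (- cmp β₀ (gr (fun _ => Fc f) j) (fun j => K (.inl j)) p (ψ + t • ω)) := by
      rw [← h4 j, DD, mul_inv_cancel_left₀ hsc]
    rw [e, cmp, gr_Fc hf, Complex.re_ofReal_mul, Complex.neg_re, Complex.ofReal_re]
    linear_combination (- fderiv ℝ f (pr (xx β₀ (fun j => K (.inl j)) p (ψ + t • ω))) (pr (Pi.single j 1))) * (Real.mul_self_sqrt hp.le)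
  have ex : ∀ ψ, pr (xx β₀ (fun j => K (.inl j)) p ψ) = (ψ + fun i => (K (.inl (.inl i)) p ψ).re, β₀ + fun j => (K (.inl (.inr j)) p ψ).re) := fun ψ => rfl
  have e1 : ∀ i : T, pr (Pi.single (Sum.inl i) 1) = ((Pi.single i 1, 0) : (T → ℝ) × (Bt → ℝ)) := fun i => by
    ext k <;> simp [pr, Pi.single_apply]
  have e2 : ∀ i : Bt, pr (Pi.single (Sum.inr i) 1) = ((0, Pi.single i 1) : (T → ℝ) × (Bt → ℝ)) := fun i => by
    ext k <;> simp [pr, Pi.single_apply]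
  refine ⟨fun ψ i => (K (.inl (.inl i)) p ψ).re, fun ψ j => (K (.inl (.inr j)) p ψ).re,
    fun ψ _ => AnalyticAt.pi fun i => ha _ ψ trivial, fun ψ _ => AnalyticAt.pi fun i => ha _ ψ trivial,
    fun ψ i => by ext k; exact congrArg _ ((h1 _).per ψ i), fun ψ i => by ext k; exact congrArg _ ((h1 _).per ψ i), fun ψ t => ⟨?_, ?_⟩⟩
  · have q1 : (deriv fun u : ℝ => ψ + u • ω + fun i => (K (.inl (.inl i)) p (ψ + u • ω)).re) =
        fun t => ω + fun i => √p * (K (.inr (.inl i)) p (ψ + t • ω)).re := by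
      ext1 t
      refine HasDerivAt.deriv (HasDerivAt.add ?_ (hasDerivAt_pi.2 fun i => d1 _ ψ t))
      simpa using ((hasDerivAt_id t).smul_const ω).const_add ψ
    rw [q1]
    refine HasDerivAt.deriv (HasDerivAt.const_add _ (hasDerivAt_pi.2 fun i => ?_))
    have := d2 (.inl i) ψ t
    rwa [ex, e1] at this
  · have q1 : (deriv fun u : ℝ => β₀ + fun i => (K (.inl (.inr i)) p (ψ + u • ω)).re) =
        fun t i => √p * (K (.inr (.inr i)) p (ψ + t • ω)).re := by
      ext1 t
      exact HasDerivAt.deriv (HasDerivAt.const_add _ (hasDerivAt_pi.2 fun i => d1 _ ψ t))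
    rw [q1]
    refine HasDerivAt.deriv (hasDerivAt_pi.2 fun i => ?_)
    have := d2 (.inr i) ψ t
    rwa [ex, e2] at this
end tr
end
section
section four
lemma ana_bd {V : Type} [NormedAddCommGroup V] [NormedSpace ℝ V] {G : V → ℂ} {x : V} (h : AnalyticAt ℝ G x) :
    ∃ C A : ℝ, 0 ≤ C ∧ 0 ≤ A ∧ ∀ᶠ y in nhds x, ∀ n, ∀ e : V, ‖e‖ ≤ 1 → ‖iteratedFDeriv ℝ n G y (fun _ => e)‖ ≤ C * A ^ n * n.factorial := by
  obtain ⟨p, r, h⟩ := h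
  obtain ⟨δ, hδ, hδr⟩ := ENNReal.lt_iff_exists_nnreal_btwn.1 h.r_pos
  have hδ0 : 0 < δ := by exact_mod_cast hδ
  let q : ℝ≥0 := δ / 2
  have hq : 0 < q := by positivity
  have hqq : q + q = δ := add_halves δ
  have hqr : (q + q : ℝ≥0∞) < r := by rw [← ENNReal.coe_add, hqq]; exact hδr
  have hs := p.changeOriginSeries_summable_aux₁ (hqr.trans_le h.r_le)
  have hs' := NNReal.summable_sigma.1 hs
  refine ⟨((∑' s : Σ k l : ℕ, { s : Finset (Fin (k + l)) // s.card = l }, ‖p (s.1 + s.2.1)‖₊ * q ^ s.2.1 * q ^ s.1 : ℝ≥0) : ℝ), (q : ℝ)⁻¹, by positivity, by positivity, ?_⟩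
  filter_upwards [Metric.closedBall_mem_nhds x (show (0:ℝ) < q from hq)] with y hy n e he
  obtain ⟨z, rfl⟩ : ∃ z, y = x + z := ⟨y - x, by abel⟩
  have hz : ‖z‖₊ ≤ q := by rw [mem_closedBall_iff_norm, add_sub_cancel_left] at hy; exact hy
  have hzr : (‖z‖₊ : ℝ≥0∞) < r := lt_of_le_of_lt (by exact_mod_cast hz.trans (by simp : q ≤ q + q)) hqr
  have h1 := (h.changeOrigin hzr).factorial_smul e n
  rw [← h1, ← Nat.cast_smul_eq_nsmul ℝ, norm_smul, mul_comm]
  rw [Real.norm_of_nonneg (by positivity)]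
  refine mul_le_mul_of_nonneg_right ?_ (by positivity)
  have h2 : ‖p.changeOrigin z n‖₊ ≤ ∑' s : Σ l : ℕ, { s : Finset (Fin (n + l)) // s.card = l }, ‖p (n + s.1)‖₊ * q ^ s.1 := by
    refine (p.nnnorm_changeOrigin_le n (hzr.trans_le h.r_le)).trans ?_
    refine Summable.tsum_le_tsum (fun s => by gcongr) (p.changeOriginSeries_summable_aux₂ (hzr.trans_le h.r_le) n)
      (p.changeOriginSeries_summable_aux₂ ((lt_of_le_of_lt (by simp) hqr).trans_le h.r_le) n)
  have h3 : ‖p.changeOrigin z n‖₊ * q ^ n ≤ ∑' s : Σ k l : ℕ, { s : Finset (Fin (k + l)) // s.card = l }, ‖p (s.1 + s.2.1)‖₊ * q ^ s.2.1 * q ^ s.1 := by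
    rw [hs.tsum_sigma' (fun n => hs'.1 n)]
    refine le_trans ?_ (hs'.2.le_tsum n (fun _ _ => zero_le))
    calc _ ≤ (∑' s : Σ l : ℕ, { s : Finset (Fin (n + l)) // s.card = l }, ‖p (n + s.1)‖₊ * q ^ s.1) * q ^ n := mul_le_mul_left h2 _
      _ = ∑' s : Σ l : ℕ, { s : Finset (Fin (n + l)) // s.card = l }, ‖p (n + s.1)‖₊ * q ^ s.1 * q ^ n := (NNReal.tsum_mul_right _ _).symm
      _ ≤ _ := le_rfl
  rw [inv_pow, ← div_eq_mul_inv, le_div_iff₀ (by positivity)]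
  refine le_trans ?_ (NNReal.coe_le_coe.2 h3)
  push_cast
  refine mul_le_mul_of_nonneg_right ?_ (by positivity)
  refine ((p.changeOrigin z n).le_opNorm _).trans ?_
  refine mul_le_of_le_one_right (norm_nonneg _) (Finset.prod_le_one (fun _ _ => norm_nonneg _) fun _ _ => he)
lemma ana_bdK {V : Type} [NormedAddCommGroup V] [NormedSpace ℝ V] {G : V → ℂ} (h : AnalyticOnNhd ℝ G Set.univ) {S : Set V} (hS : IsCompact S) :
    ∃ C A : ℝ, 0 ≤ C ∧ 0 ≤ A ∧ ∀ y ∈ S, ∀ n, ∀ e : V, ‖e‖ ≤ 1 → ‖iteratedFDeriv ℝ n G y (fun _ => e)‖ ≤ C * A ^ n * n.factorial := by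
  refine hS.induction_on (p := fun S => ∃ C A : ℝ, 0 ≤ C ∧ 0 ≤ A ∧ ∀ y ∈ S, ∀ n, ∀ e : V, ‖e‖ ≤ 1 → ‖iteratedFDeriv ℝ n G y (fun _ => e)‖ ≤ C * A ^ n * n.factorial)
    ⟨0, 0, le_rfl, le_rfl, fun _ h => h.elim⟩ ?_ ?_ ?_
  · rintro s t hst ⟨C, A, h1, h2, h3⟩; exact ⟨C, A, h1, h2, fun y hy => h3 y (hst hy)⟩
  · rintro s t ⟨C, A, h1, h2, h3⟩ ⟨C', A', h1', h2', h3'⟩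
    refine ⟨C + C', A + A', by positivity, by positivity, ?_⟩
    rintro y (hy | hy) n e he
    · refine (h3 y hy n e he).trans ?_; gcongr <;> linarith
    · refine (h3' y hy n e he).trans ?_; gcongr <;> linarith
  · intro x _
    obtain ⟨C, A, h1, h2, h3⟩ := ana_bd (h x trivial)
    exact ⟨_, mem_nhdsWithin_of_mem_nhds h3, C, A, h1, h2, fun y hy => hy⟩
variable {J : Type} [Fintype J] [DecidableEq J]
def tc (x : J → ℝ) : UnitAddTorus J := fun i => (x i : UnitAddCircle)
def Per (G : (J → ℝ) → ℂ) : Prop := ∀ x i, G (x + Pi.single i 1) = G x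
lemma Per.int {G : (J → ℝ) → ℂ} (h : Per G) (m : J → ℤ) (x : J → ℝ) : G (x + fun i => (m i : ℝ)) = G x := by
  have h1 : ∀ i (n : ℤ) x, G (x + Pi.single i (n : ℝ)) = G x := fun i n => by
    induction n with
    | zero => simp
    | succ n ih => intro x; push_cast at ih ⊢; rw [Pi.single_add, ← add_assoc, h, ih]
    | pred n ih => intro x; rw [← h (x + _) i, add_assoc, ← Pi.single_add]; push_cast at ih ⊢; simpa using ih x
  have h2 : ∀ s : Finset J, ∀ x, G (x + ∑ i ∈ s, Pi.single i (m i : ℝ)) = G x := fun s => by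
    induction s using Finset.induction_on with
    | empty => simp
    | insert a s ha ih => intro x; rw [Finset.sum_insert ha, ← add_assoc, ih, h1]
  rw [← h2 Finset.univ x, Finset.univ_sum_single]
lemma tc_quot : IsOpenQuotientMap (tc : (J → ℝ) → UnitAddTorus J) :=
  IsOpenQuotientMap.piMap fun _ => QuotientAddGroup.isOpenQuotientMap_mk
lemma Per.lift {G : (J → ℝ) → ℂ} (h : Per G) (hc : Continuous G) : ∃ F : C(UnitAddTorus J, ℂ), ∀ x, F (tc x) = G x := by
  have hs := (tc_quot (J := J)).surjective
  have e : ∀ x y : J → ℝ, tc x = tc y → G x = G y := fun x y hxy => by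
    have : ∀ i, ∃ n : ℤ, x i = y i + n := fun i => by
      have := congrFun hxy i
      have h0 : ((x i - y i : ℝ) : UnitAddCircle) = 0 := by rw [AddCircle.coe_sub]; exact sub_eq_zero.2 this
      obtain ⟨n, hn⟩ := AddCircle.coe_eq_zero_iff _ |>.1 h0
      exact ⟨n, by simp at hn; linarith⟩
    choose n hn using this
    rw [← h.int n y]; congr 1; ext i; exact hn i
  refine ⟨⟨fun z => G (Function.surjInv hs z), ?_⟩, fun x => e _ _ (Function.surjInv_eq hs _)⟩
  rw [tc_quot.isQuotientMap.continuous_iff]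
  exact hc.congr fun x => e _ _ (Function.surjInv_eq hs _).symm
end four
end
section
section fou
open UnitAddTorus
noncomputable local instance : MeasureSpace UnitAddCircle := ⟨AddCircle.haarAddCircle⟩
local instance : Measure.IsAddHaarMeasure (volume : Measure UnitAddCircle) :=
  inferInstanceAs (Measure.IsAddHaarMeasure AddCircle.haarAddCircle)
local instance : IsProbabilityMeasure (volume : Measure UnitAddCircle) :=
  inferInstanceAs (IsProbabilityMeasure AddCircle.haarAddCircle)
variable {J : Type} [Fintype J] [DecidableEq J]
lemma mF_tc (ν : J → ℤ) (x : J → ℝ) : mFourier ν (tc x) = ee ν ((2 * π) • x) := by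
  simp only [mFourier, tc, ContinuousMap.coe_mk, fourier_coe_apply]
  rw [← Complex.exp_sum, ee, dot_smul_right, dot]; congr 1; push_cast
  rw [Finset.mul_sum, Finset.sum_mul]; exact Finset.sum_congr rfl fun k _ => by ring
lemma tc_add (x y : J → ℝ) : tc (x + y) = tc x + tc y := rfl
lemma mF_add (ν : J → ℤ) (z : UnitAddTorus J) (y : J → ℝ) : mFourier ν (z + tc y) = mFourier ν z * ee ν ((2 * π) • y) := by
  obtain ⟨x, rfl⟩ := tc_quot.surjective z
  rw [← tc_add, mF_tc, mF_tc, smul_add, ee, ee, ee, ← Complex.exp_add, dot_add_right]; push_cast; ring_nf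
def bx : Set (J → ℝ) := {x : J → ℝ | ∀ i, x i ∈ Set.Ioc (0 : ℝ) (0 + 1)}
lemma coef_box (F : UnitAddTorus J → ℂ) (ν : J → ℤ) : mFourierCoeff F ν = ∫ x in bx, mFourier (-ν) (tc x) * F (tc x) :=
  mFourierCoeff_eq_integral F ν (fun _ => 0)
lemma bx_vol : volume (bx : Set (J → ℝ)) = 1 := by
  have : (bx : Set (J → ℝ)) = Set.univ.pi fun _ => Set.Ioc 0 (0 + 1) := by ext; simp [bx]
  rw [this, volume_pi_pi]; simp
lemma coef_le (F : UnitAddTorus J → ℂ) (ν : J → ℤ) {C : ℝ} (h : ∀ x ∈ Set.Icc (0 : J → ℝ) 1, ‖F (tc x)‖ ≤ C) : ‖mFourierCoeff F ν‖ ≤ C := by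
  rw [coef_box]
  have := norm_setIntegral_le_of_norm_le_const (μ := volume) (s := (bx : Set (J → ℝ))) (f := fun x => mFourier (-ν) (tc x) * F (tc x)) (C := C) (by rw [bx_vol]; simp)
    (fun x hx => by
      rw [norm_mul, mF_tc, ee_norm, one_mul]
      exact h x ⟨fun i => (hx i).1.le, fun i => by simpa using (hx i).2⟩)
  simpa [Measure.real, bx_vol] using this
lemma dint {X : Type} [MeasurableSpace X] {μ : Measure X} [IsFiniteMeasure μ] {F F' : ℝ → X → ℂ} {C C' : ℝ} (hm : ∀ t, AEStronglyMeasurable (F t) μ)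
    (hm' : ∀ t, AEStronglyMeasurable (F' t) μ) (hb : ∀ t x, ‖F t x‖ ≤ C) (hb' : ∀ t x, ‖F' t x‖ ≤ C') (hd : ∀ t x, HasDerivAt (fun t => F t x) (F' t x) t) (t : ℝ) :
    HasDerivAt (fun t => ∫ x, F t x ∂μ) (∫ x, F' t x ∂μ) t :=
  (hasDerivAt_integral_of_dominated_loc_of_deriv_le (bound := fun _ => C') (s := Set.univ) univ_mem (Eventually.of_forall hm)
    (Integrable.mono' (integrable_const C) (hm t) (Eventually.of_forall (hb t))) (hm' t) (Eventually.of_forall fun x t _ => hb' t x) (integrable_const _)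
    (Eventually.of_forall fun x t _ => hd t x)).2
lemma ibp {F F' : C(UnitAddTorus J, ℂ)} {h h' : (J → ℝ) → ℂ} (hF : ∀ x, F (tc x) = h x) (hF' : ∀ x, F' (tc x) = h' x) (i : J)
    (hd : ∀ x t, HasDerivAt (fun t : ℝ => h (x + t • Pi.single i 1)) (h' (x + t • Pi.single i 1)) t) (ν : J → ℤ) :
    mFourierCoeff F' ν = (2 * π * ν i : ℝ) * Complex.I * mFourierCoeff F ν := by
  have hct : Continuous (tc : (J → ℝ) → UnitAddTorus J) := tc_quot.continuous
  have hch : Continuous h := (F.continuous.comp hct).congr hF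
  have hch' : Continuous h' := (F'.continuous.comp hct).congr hF'
  have hm : Continuous fun x : J → ℝ => mFourier (-ν) (tc x) := (mFourier (-ν)).continuous.comp hct
  have key : ∀ t : ℝ, ∫ x in bx, mFourier (-ν) (tc x) * h (x + t • Pi.single i 1) = Complex.exp (t * ((2 * π * ν i : ℝ) * Complex.I)) * mFourierCoeff F ν := fun t => by
    have e1 : ∫ x in bx, mFourier (-ν) (tc x) * h (x + t • Pi.single i 1) = ∫ z, mFourier (-ν) z * F (z + tc (t • Pi.single i 1)) := by
      refine Eq.trans ?_ (integral_preimage (fun z => mFourier (-ν) z * F (z + tc (t • Pi.single i 1))) (fun _ => 0)).symm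
      refine integral_congr_ae (Eventually.of_forall fun x => ?_)
      simp only [← hF, tc_add]; rfl
    have e2 : ∀ z, mFourier (-ν) z * F (z + tc (t • Pi.single i 1)) =
        Complex.exp (t * ((2 * π * ν i : ℝ) * Complex.I)) * (mFourier (-ν) (z + tc (t • Pi.single i 1)) * F (z + tc (t • Pi.single i 1))) := fun z => by
      rw [mF_add, ee]
      have : dot (-ν) ((2 * π) • t • Pi.single i (1:ℝ)) = - (t * (2 * π * ν i)) := by
        rw [dot_smul_right, dot_smul_right]; simp [dot, Pi.single_apply]; ring
      rw [this]
      have e : Complex.exp (t * ((2 * π * ν i : ℝ) * Complex.I)) * Complex.exp (((-(t * (2 * π * ν i)) : ℝ) : ℂ) * Complex.I) = 1 := by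
        rw [← Complex.exp_add, ← Complex.exp_zero]; congr 1; push_cast; ring
      linear_combination (-(mFourier (-ν) z * F (z + tc (t • Pi.single i 1)))) * e
    rw [e1, integral_congr_ae (Eventually.of_forall e2), integral_const_mul, integral_add_right_eq_self (fun z => mFourier (-ν) z * F z)]; rfl
  have d1 : HasDerivAt (fun t : ℝ => ∫ x in bx, mFourier (-ν) (tc x) * h (x + t • Pi.single i 1)) (((2 * π * ν i : ℝ) : ℂ) * Complex.I * mFourierCoeff F ν) 0 := by
    simp only [key]
    have := (((hasDerivAt_id (0:ℝ)).ofReal_comp.mul_const (((2 * π * ν i : ℝ) : ℂ) * Complex.I)).cexp).mul_const (mFourierCoeff F ν)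
    simpa using this
  have d2 : HasDerivAt (fun t : ℝ => ∫ x in bx, mFourier (-ν) (tc x) * h (x + t • Pi.single i 1)) (∫ x in bx, mFourier (-ν) (tc x) * h' (x + (0:ℝ) • Pi.single i 1)) 0 := by
    have : IsFiniteMeasure (volume.restrict (bx : Set (J → ℝ))) := ⟨by simp [bx_vol]⟩
    have q1 : ∀ (t : ℝ) (x : J → ℝ), ‖mFourier (-ν) (tc x) * h (x + t • Pi.single i 1)‖ ≤ ‖F‖ := fun t x => by
      rw [norm_mul, mF_tc, ee_norm, one_mul, ← hF]; exact F.norm_coe_le_norm _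
    have q2 : ∀ (t : ℝ) (x : J → ℝ), ‖mFourier (-ν) (tc x) * h' (x + t • Pi.single i 1)‖ ≤ ‖F'‖ := fun t x => by
      rw [norm_mul, mF_tc, ee_norm, one_mul, ← hF']; exact F'.norm_coe_le_norm _
    have q3 : ∀ t : ℝ, Continuous fun x : J → ℝ => x + t • Pi.single i 1 := fun t => continuous_add_const _
    exact dint (F := fun t x => mFourier (-ν) (tc x) * h (x + t • Pi.single i 1)) (F' := fun t x => mFourier (-ν) (tc x) * h' (x + t • Pi.single i 1))
      (fun t => (hm.mul (hch.comp (q3 t))).aestronglyMeasurable) (fun t => (hm.mul (hch'.comp (q3 t))).aestronglyMeasurable) q1 q2 (fun t x => (hd x t).const_mul _) 0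
  rw [← d1.unique d2 |>.symm, coef_box]
  simp [hF']
end fou
end
section
section dec
open UnitAddTorus
variable {J : Type} [Fintype J] [DecidableEq J]
lemma dec1 {G : (J → ℝ) → ℂ} (hG : AnalyticOnNhd ℝ G Set.univ) (hP : Per G) {F : C(UnitAddTorus J, ℂ)} (hF : ∀ x, F (tc x) = G x) :
    ∃ C δ : ℝ, 0 ≤ C ∧ 0 < δ ∧ ∀ ν j, ‖mFourierCoeff F ν‖ * Real.exp (δ * |(ν j : ℝ)|) ≤ C := by
  obtain ⟨C, A, hC, hA, hb⟩ := ana_bdK hG (S := Set.Icc (0 : J → ℝ) 1) isCompact_Icc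
  have hcd : ContDiff ℝ ⊤ G := contDiff_iff_contDiffAt.2 fun x => (hG x trivial).contDiffAt
  refine ⟨2 * C, π / (A + 1), by positivity, by positivity, fun ν j => ?_⟩
  let h : ℕ → (J → ℝ) → ℂ := fun n x => iteratedFDeriv ℝ n G x (fun _ => Pi.single j 1)
  have hp : ∀ n, Per (h n) := fun n x i => by
    have := iteratedFDeriv_comp_add_right (𝕜 := ℝ) (f := G) n (Pi.single i 1) x
    simp only [h]; rw [← this]; congr 2; funext y; exact hP y i
  have hc : ∀ n, Continuous (h n) := fun n =>
    (ContinuousMultilinearMap.apply ℝ (fun _ : Fin n => J → ℝ) ℂ (fun _ => Pi.single j 1)).continuous.comp (hcd.continuous_iteratedFDeriv (m := n) (by simp))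
  have hd : ∀ n x t, HasDerivAt (fun t : ℝ => h n (x + t • Pi.single j 1)) (h (n + 1) (x + t • Pi.single j 1)) t := fun n x t => by
    have d1 : DifferentiableAt ℝ (iteratedFDeriv ℝ n G) (x + t • Pi.single j 1) := (hcd.differentiable_iteratedFDeriv (m := n) (by exact_mod_cast WithTop.coe_lt_top _)) _
    have d2 := (ContinuousMultilinearMap.apply ℝ (fun _ : Fin n => J → ℝ) ℂ (fun _ => Pi.single j 1)).hasFDerivAt.comp _ d1.hasFDerivAt
    have d3 : HasDerivAt (fun t : ℝ => x + t • (Pi.single j 1 : J → ℝ)) (Pi.single j 1) t := by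
      simpa using ((hasDerivAt_id t).smul_const (Pi.single j (1:ℝ) : J → ℝ)).const_add x
    have d4 : h (n + 1) (x + t • Pi.single j 1) = _ := iteratedFDeriv_succ_apply_left _
    rw [d4]; exact d2.comp_hasDerivAt t d3
  choose Fn hFn using fun n => (hp n).lift (hc n)
  have hF0 : Fn 0 = F := by
    ext z; obtain ⟨x, rfl⟩ := tc_quot.surjective z; rw [hFn, hF]; simp [h]
  have hi : ∀ n, mFourierCoeff (Fn n) ν = ((2 * π * ν j : ℝ) * Complex.I) ^ n * mFourierCoeff F ν := fun n => by
    induction n with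
    | zero => simp [hF0]
    | succ n ih => rw [ibp (hFn n) (hFn (n + 1)) j (hd n), ih]; ring
  have hn : ∀ n : ℕ, ‖mFourierCoeff F ν‖ * ((π / (A + 1) * |(ν j : ℝ)|) ^ n / n.factorial) ≤ C * (1 / 2) ^ n := fun n => by
    have h1 := coef_le (Fn n) ν (C := C * A ^ n * n.factorial) (fun x hx => by
      rw [hFn]; refine hb x hx n _ ?_
      exact (pi_norm_le_iff_of_nonneg zero_le_one).2 fun k => by by_cases e : k = j <;> simp [e])
    rw [hi, norm_mul, norm_pow, norm_mul, Complex.norm_I, mul_one, Complex.norm_real, Real.norm_eq_abs, abs_mul, abs_of_pos (by positivity : 0 < 2 * π)] at h1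
    have e : ‖mFourierCoeff F ν‖ * ((π / (A + 1) * |(ν j : ℝ)|) ^ n / n.factorial) = ((2 * π * |(ν j : ℝ)|) ^ n * ‖mFourierCoeff F ν‖) * ((1 / 2) ^ n / ((A + 1) ^ n * n.factorial)) := by
      rw [show π / (A + 1) * |(ν j : ℝ)| = (2 * π * |(ν j : ℝ)|) * (1 / 2) / (A + 1) by field_simp, div_pow, mul_pow _ (1/2 : ℝ)]; field_simp
    rw [e]
    refine (mul_le_mul_of_nonneg_right h1 (by positivity)).trans ?_
    have h2 : A ^ n ≤ (A + 1) ^ n := pow_le_pow_left₀ hA (by linarith) n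
    have hf : (0:ℝ) < n.factorial := by positivity
    have hA1 : 0 < (A + 1) ^ n := by positivity
    rw [show C * A ^ n * n.factorial * ((1 / 2) ^ n / ((A + 1) ^ n * n.factorial)) = C * (1 / 2) ^ n * (A ^ n / (A + 1) ^ n) by field_simp]
    exact mul_le_of_le_one_right (by positivity) ((div_le_one hA1).2 h2)
  have he := (NormedSpace.expSeries_div_hasSum_exp (𝔸 := ℝ) (π / (A + 1) * |(ν j : ℝ)|)).mul_left ‖mFourierCoeff F ν‖
  rw [← Real.exp_eq_exp_ℝ] at he
  have := hasSum_le hn he ((hasSum_geometric_of_lt_one (by norm_num) (by norm_num : (1/2:ℝ) < 1)).mul_left C)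
  refine this.trans (le_of_eq ?_); norm_num; ring
lemma dec2 [Nonempty J] {G : (J → ℝ) → ℂ} (hG : AnalyticOnNhd ℝ G Set.univ) (hP : Per G) {F : C(UnitAddTorus J, ℂ)} (hF : ∀ x, F (tc x) = G x) :
    ∃ C δ : ℝ, 0 ≤ C ∧ 0 < δ ∧ ∀ ν, ‖mFourierCoeff F ν‖ * Real.exp (δ * nm ν) ≤ C := by
  obtain ⟨C, δ, hC, hδ, h⟩ := dec1 hG hP hF
  have hN : (0:ℝ) < Fintype.card J := by exact_mod_cast Fintype.card_pos
  refine ⟨C, δ / Fintype.card J, hC, by positivity, fun ν => ?_⟩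
  obtain ⟨j, -, hj⟩ := Finset.exists_max_image Finset.univ (fun k => |(ν k : ℝ)|) Finset.univ_nonempty
  have h1 : nm ν ≤ Fintype.card J * |(ν j : ℝ)| := by
    have := Finset.sum_le_card_nsmul Finset.univ (fun k => |(ν k : ℝ)|) _ hj
    simpa [nm] using this
  refine le_trans ?_ (h ν j)
  refine mul_le_mul_of_nonneg_left (Real.exp_le_exp.2 ?_) (norm_nonneg _)
  rw [div_mul_eq_mul_div, div_le_iff₀ hN]; nlinarith
lemma sum_exp {δ : ℝ} (hδ : 0 < δ) : Summable fun ν : J → ℤ => Real.exp (-(δ * nm ν)) := by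
  let n := Fintype.card J + 1
  refine Summable.of_norm_bounded_eventually ((summable_nm (T := J) (n := n) (by omega)).mul_left (n.factorial / δ ^ n)) ?_
  refine (Set.finite_singleton (0 : J → ℤ)).subset fun ν hν => ?_
  by_contra h0
  refine hν ?_
  have h1 : 0 < nm ν := lt_of_lt_of_le one_pos (one_le_nm h0)
  have := pow_fac_le (x := δ * nm ν) (by positivity) n
  change ‖Real.exp (-(δ * nm ν))‖ ≤ _
  rw [Real.norm_of_nonneg (Real.exp_pos _).le, Real.exp_neg]
  refine (inv_anti₀ (by positivity) this).trans (le_of_eq ?_)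
  rw [mul_pow]; field_simp
lemma ana_Bx [Nonempty J] {g : (J → ℝ) → ℂ} (hg : AnalyticOnNhd ℝ g Set.univ) (hP : ∀ x i, g (x + Pi.single i (2 * π)) = g x) :
    ∃ ρ : ℝ, 0 < ρ ∧ Bx 0 ρ (fun _ => g) := by
  let L : (J → ℝ) →L[ℝ] (J → ℝ) := (2 * π) • ContinuousLinearMap.id ℝ _
  have hGa : AnalyticOnNhd ℝ (fun x => g ((2 * π) • x)) Set.univ := fun x _ =>
    (hg _ trivial).comp_of_eq (L.analyticAt x) rfl
  have hGP : Per (fun x => g ((2 * π) • x)) := fun x i => by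
    simp only []; rw [smul_add, ← Pi.single_smul, smul_eq_mul, mul_one, hP]
  have hGc : Continuous (fun x => g ((2 * π) • x)) := continuous_iff_continuousAt.2 fun x => (hGa x trivial).continuousAt
  obtain ⟨F, hF⟩ := hGP.lift hGc
  obtain ⟨C, δ, hC, hδ, h⟩ := dec2 hGa hGP hF
  have hle : ∀ ν, ‖mFourierCoeff F ν‖ * Real.exp (δ / 2 * nm ν) ≤ C * Real.exp (-(δ / 2 * nm ν)) := fun ν => by
    have := h ν
    rw [show δ * nm ν = δ / 2 * nm ν + δ / 2 * nm ν by ring, Real.exp_add] at this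
    rw [Real.exp_neg, ← div_eq_mul_inv, le_div_iff₀ (Real.exp_pos _)]; linarith
  have hs := (sum_exp (J := J) (half_pos hδ)).mul_left C
  have hs1 : Summable (mFourierCoeff F) := Summable.of_norm_bounded hs fun ν => by
    refine le_trans ?_ (hle ν)
    exact le_mul_of_one_le_right (norm_nonneg _) (Real.one_le_exp (mul_nonneg (half_pos hδ).le (nm_nonneg _)))
  refine ⟨δ / 2, half_pos hδ, ∑' ν : J → ℤ, C * Real.exp (-(δ / 2 * nm ν)), tsum_nonneg fun _ => by positivity, (half_pos hδ).le,
    fun ν _ => mFourierCoeff F ν, fun ν => ‖mFourierCoeff F ν‖ₑ, fun p _ ψ => ?_, fun ν => ⟨_, 0, by rw [add_zero], fun _ _ => le_rfl, fun _ _ _ _ => by simp⟩, ?_⟩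
  · have := hasSum_mFourier_series_apply_of_summable hs1 (tc ((2 * π)⁻¹ • ψ))
    rw [hF, smul_smul, mul_inv_cancel₀ (by positivity), one_smul] at this
    refine hs_congr this fun ν => ?_
    rw [mF_tc, smul_smul, mul_inv_cancel₀ (by positivity), one_smul]; rfl
  · rw [ENNReal.ofReal_tsum_of_nonneg (fun _ => by positivity) hs]
    refine ENNReal.tsum_le_tsum fun ν => ?_
    simp only []; rw [← ofReal_norm, wt, ← ENNReal.ofReal_mul (norm_nonneg _)]
    exact ENNReal.ofReal_le_ofReal (hle ν)
end dec
end
section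
section MMs
variable {T Bt : Type} [Fintype T] [Fintype Bt] [DecidableEq T] [DecidableEq Bt] {ρ : ℝ}
noncomputable def Mn (g : Fn (T ⊕ Bt)) : Fn Bt := fun p β => mean (cmp β g (fun _ _ (_ : T → ℝ) => 0)) p
lemma cmp0 (g : Fn (T ⊕ Bt)) (p : ℝ) (β : Bt → ℝ) (ψ : T → ℝ) : cmp β g (fun _ _ (_ : T → ℝ) => 0) p ψ = g p (Sum.elim ψ β) := by
  simp only [cmp, xx]; congr 1; ext i; simp
lemma ee_elim (ν : T ⊕ Bt → ℤ) (ψ : T → ℝ) (β : Bt → ℝ) : ee ν (Sum.elim ψ β) = ee (fun i => ν (.inl i)) ψ * ee (fun i => ν (.inr i)) β := by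
  rw [ee, ee, ee, ← Complex.exp_add]; simp only [dot, Fintype.sum_sum_type, Sum.elim_inl, Sum.elim_inr]; push_cast; ring_nf
lemma Bx.Mn {g : Fn (T ⊕ Bt)} (h : Bx 0 ρ g) : Bx 0 ρ (Mn g) := by
  obtain ⟨B, hB, h⟩ := h
  obtain ⟨h0, hr, hs, -⟩ := h.spec
  refine ⟨1 * B, by linarith, comp_core h (fun ν p β => if (fun i => ν (.inl i)) = 0 then KAM.ee (fun i => ν (.inr i)) β else 0) _ h0 zero_le_one (fun ν => ?_) ?_⟩
  · rw [one_mul]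
    split_ifs with hν
    · refine (Bd.ee h0 _).mono (Real.exp_le_exp.2 (mul_le_mul_of_nonneg_left ?_ h0))
      rw [nm, nm, Fintype.sum_sum_type]; exact le_add_of_nonneg_left (Finset.sum_nonneg fun _ _ => abs_nonneg _)
    · exact (Bd.zero h0).mono (Real.exp_pos _).le
  · intro p hp β
    have h1 := hasSum_integral_of_summable_integral_norm
      (μ := volume.restrict (Set.univ.pi fun _ : T => Set.Icc (0 : ℝ) (2 * π)))
      (F := fun ν ψ => coef g ν p * KAM.ee ν (Sum.elim ψ β)) (fun ν => ?_) ?_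
    · have h2 := h1.mul_left ((((2 * π) ^ Fintype.card T : ℝ) : ℂ)⁻¹)
      have h3 : KAM.Mn g p β = (((2 * π) ^ Fintype.card T : ℝ) : ℂ)⁻¹ *
        ∫ ψ in Set.univ.pi fun _ : T => Set.Icc (0 : ℝ) (2 * π), ∑' ν, coef g ν p * KAM.ee ν (Sum.elim ψ β) := by
        rw [KAM.Mn, KAM.mean]; congr 2; funext ψ; rw [cmp0]; exact (hr p hp _).tsum_eq.symm
      rw [← h3] at h2
      refine hs_congr h2 fun ν => ?_
      simp only [ee_elim]
      rw [integral_const_mul, integral_mul_const]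
      have := mean_ee (fun i => ν (.inl i)) p
      rw [KAM.mean] at this
      rw [mul_left_comm, ← mul_assoc (_ : ℂ)⁻¹, this]; split_ifs <;> simp
    · refine Integrable.of_bound ((continuous_const.mul ((cont_ee ν).comp ?_)).aestronglyMeasurable) ‖coef g ν p‖ ?_
      · exact continuous_pi fun i => by cases i <;> simp only [Sum.elim_inl, Sum.elim_inr] <;> fun_prop
      · exact Eventually.of_forall fun ψ => by rw [norm_mul, ee_norm, mul_one]
    · simp only [norm_mul, ee_norm, mul_one, integral_const, smul_eq_mul]
      exact (hs p hp).mul_left _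
lemma dv_at' {u : Fn T} {p : ℝ} (h : Dif u p) (v ψ : T → ℝ) (t : ℝ) : HasDerivAt (fun t => u p (ψ + t • v)) (dv v u p (ψ + t • v)) t := by
  have h1 := (h (ψ + t • v) v).hasDerivAt
  have e0 : HasDerivAt (fun s : ℝ => s - t) 1 t := (hasDerivAt_id t).sub_const t
  have h2 := HasDerivAt.scomp_of_eq t h1 e0 (by simp)
  rw [one_smul] at h2
  refine h2.congr_of_eventuallyEq (Eventually.of_forall fun s => ?_)
  simp only [Function.comp_apply]
  rw [add_assoc, ← add_smul]; simp
lemma Mn_dv {g : Fn (T ⊕ Bt)} (h : Bx 0 ρ g) (hρ : 0 < ρ) (j : Bt) (β : Bt → ℝ) :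
    dv (Pi.single j 1) (Mn g) 0 β = Mn (dv (Pi.single (.inr j) 1) g) 0 β := by
  obtain ⟨B', hB', h'⟩ := h.dv (half_pos hρ) (by linarith) (Pi.single (.inr j) 1)
  have hd := h.dif hρ
  obtain ⟨B, hB, h⟩ := h
  have e : ∀ (t : ℝ) (ψ : T → ℝ), Sum.elim ψ (β + t • Pi.single j 1) = Sum.elim ψ β + t • Pi.single (.inr j) (1 : ℝ) := fun t ψ => by
    ext i; cases i <;> simp [Pi.single_apply]
  have hc : ∀ β : Bt → ℝ, Continuous fun ψ : T → ℝ => (Sum.elim ψ β : T ⊕ Bt → ℝ) := fun β =>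
    continuous_pi fun i => by cases i <;> simp only [Sum.elim_inl, Sum.elim_inr] <;> fun_prop
  have c1 : Continuous (g 0) := continuous_iff_continuousAt.2 fun x => (h.hasFDerivAt hρ rfl x).continuousAt
  have c2 : Continuous (dv (Pi.single (.inr j) 1) g 0) := continuous_iff_continuousAt.2 fun x => (h'.hasFDerivAt (by linarith) rfl x).continuousAt
  have := dint (μ := volume.restrict (Set.univ.pi fun _ : T => Set.Icc (0 : ℝ) (2 * π)))
    (F := fun t ψ => g 0 (Sum.elim ψ (β + t • Pi.single j 1))) (F' := fun t ψ => dv (Pi.single (.inr j) 1) g 0 (Sum.elim ψ (β + t • Pi.single j 1)))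
    (fun t => (c1.comp (hc (β + t • Pi.single j 1))).aestronglyMeasurable) (fun t => (c2.comp (hc (β + t • Pi.single j 1))).aestronglyMeasurable) (fun t x => h.norm_le hB rfl _)
    (fun t x => h'.norm_le hB' rfl _) (fun t ψ => by simp only [e]; exact dv_at' hd _ _ t) 0
  have h2 := (this.const_mul ((((2 * π) ^ Fintype.card T : ℝ) : ℂ)⁻¹)).deriv
  simp only [dv, Mn, mean, cmp0] at h2 ⊢
  rw [h2]; simp
lemma re_fd {h : (Bt → ℝ) → ℝ} {u : Fn Bt} (hu : Bx 0 ρ u) (hρ : 0 < ρ) (e : ∀ β, ((h β : ℝ) : ℂ) = u 0 β) (v β : Bt → ℝ) :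
    ((fderiv ℝ h β v : ℝ) : ℂ) = dv v u 0 β := by
  obtain ⟨B, hB, hu⟩ := hu
  have d := hu.hasFDerivAt hρ rfl β
  have dh : DifferentiableAt ℝ h β := by
    have : h = fun β => (u 0 β).re := funext fun β => by rw [← e]; simp
    rw [this]; exact Complex.reCLM.differentiableAt.comp β d
  rw [dv_fderiv d]
  have : u 0 = fun β => Complex.ofRealCLM (h β) := funext fun β => (e β).symm
  rw [this]
  have := (Complex.ofRealCLM.hasFDerivAt.comp β dh.hasFDerivAt).fderiv
  rw [Function.comp_def] at this; rw [this]; rfl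
end MMs
end
section
section setup
lemma pr_cont {T Bt : Type} [Fintype T] [Fintype Bt] (x : T ⊕ Bt → ℝ) : AnalyticAt ℝ (pr : (T ⊕ Bt → ℝ) → (T → ℝ) × (Bt → ℝ)) x := by
  let L : (T ⊕ Bt → ℝ) →L[ℝ] (T → ℝ) × (Bt → ℝ) :=
    (ContinuousLinearMap.pi fun i => ContinuousLinearMap.proj (Sum.inl i)).prod (ContinuousLinearMap.pi fun i => ContinuousLinearMap.proj (Sum.inr i))
  exact L.analyticAt x
lemma setup {r s : ℕ} (hr : 1 ≤ r) (ω : Fin r → ℝ) (C₀ τ₀ : ℝ) (hC₀ : 0 < C₀)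
    (hdio : ∀ ν : Fin r → ℤ, ν ≠ 0 → C₀ * (∑ k, |(ν k : ℝ)|) ^ (-τ₀) ≤ |∑ k, ω k * (ν k : ℝ)|)
    (f : (Fin r → ℝ) × (Fin s → ℝ) → ℝ) (hfa : AnalyticOnNhd ℝ f Set.univ)
    (hper₁ : ∀ p : (Fin r → ℝ) × (Fin s → ℝ), ∀ i : Fin r, f (p.1 + Pi.single i (2 * π), p.2) = f p)
    (hper₂ : ∀ p : (Fin r → ℝ) × (Fin s → ℝ), ∀ j : Fin s, f (p.1, p.2 + Pi.single j (2 * π)) = f p)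
    (f₀ : (Fin s → ℝ) → ℝ)
    (hf₀ : ∀ β, f₀ β = ((2 * π) ^ r)⁻¹ * ∫ α in Set.univ.pi fun _ : Fin r => Set.Icc (0 : ℝ) (2 * π), f (α, β))
    (β₀ : Fin s → ℝ) (hcrit : fderiv ℝ f₀ β₀ = 0) (a : Fin s → ℝ) (hmono : StrictMono a)
    (heig : ∀ i, Module.End.HasEigenvalue
      (Matrix.toLin' fun i' j' : Fin s =>
        fderiv ℝ (fun β => fderiv ℝ f₀ β (Pi.single j' 1)) β₀ (Pi.single i' 1)) (a i)) :
    ∃ (R : ℝ) (τ : ℕ) (U Z : Fin s → Fin s → ℂ), Ini β₀ (Fc f) R ω C₀ τ U (fun k => (a k : ℂ)) ∧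
      ∀ k k', ∑ b, Z k b * U k' b = if k = k' then 1 else 0 := by
  have hga : AnalyticOnNhd ℝ (Fc f) Set.univ := fun x _ =>
    (Complex.ofRealCLM.analyticAt _).comp_of_eq ((hfa (pr x) trivial).comp_of_eq (pr_cont x) rfl) rfl
  have hgp : ∀ x i, Fc f (x + Pi.single i (2 * π)) = Fc f x := fun x i => by
    simp only [Fc]; congr 1
    cases i with
    | inl i => rw [← hper₁ (pr x) i]; congr 1; ext k <;> simp [pr, Pi.single_apply]
    | inr i => rw [← hper₂ (pr x) i]; congr 1; ext k <;> simp [pr, Pi.single_apply]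
  have : Nonempty (Fin r ⊕ Fin s) := ⟨.inl ⟨0, hr⟩⟩
  obtain ⟨ρ, hρ, hB⟩ := ana_Bx hga hgp
  have hB1 : ∀ j, Bx 0 (ρ / 2) (gr (fun _ => Fc f) (.inr j)) := fun j => by
    have := hB.dv (half_pos hρ) (by linarith) (Pi.single (.inr j) 1); rwa [sub_half] at this
  have e0 : ∀ β, ((f₀ β : ℝ) : ℂ) = Mn (fun _ => Fc f) 0 β := fun β => by
    rw [hf₀, Mn, mean]; simp only [cmp0, Fc, pr, Sum.elim_inl, Sum.elim_inr, Fintype.card_fin]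
    push_cast; congr 1; exact (integral_ofReal (𝕜 := ℂ)).symm
  have e1 : ∀ j β, ((fderiv ℝ f₀ β (Pi.single j 1) : ℝ) : ℂ) = Mn (gr (fun _ => Fc f) (.inr j)) 0 β := fun j β => by
    rw [re_fd hB.Mn hρ e0, Mn_dv hB hρ]; rfl
  have e2 : ∀ i j, ((fderiv ℝ (fun β => fderiv ℝ f₀ β (Pi.single j 1)) β₀ (Pi.single i 1) : ℝ) : ℂ) = Mn (dv (Pi.single (.inr i) 1) (gr (fun _ => Fc f) (.inr j))) 0 β₀ := fun i j => by
    rw [re_fd (hB1 j).Mn (half_pos hρ) (e1 j), Mn_dv (hB1 j) (half_pos hρ)]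
  choose V hV using fun i => (heig i).exists_hasEigenvector
  have hli := Module.End.eigenvectors_linearIndependent' _ a hmono.injective V hV
  have hdet : IsUnit (Matrix.of V) := by
    rw [← Matrix.linearIndependent_rows_iff_isUnit]; exact hli
  have hdet' := (Matrix.isUnit_iff_isUnit_det _).1 hdet
  refine ⟨ρ / 3, ⌈τ₀⌉₊, fun k j => (V k j : ℂ), fun k j => (((Matrix.of V)⁻¹ j k : ℝ) : ℂ), ⟨by linarith, by rwa [mul_div_cancel₀ _ (by norm_num)], fun x => by simp [Fc], hC₀, fun ν hν => ?_, fun j => ?_, fun k j => ?_⟩, fun k k' => ?_⟩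
  · have h1 := hdio ν hν
    have h2 : dot ν ω = ∑ k, ω k * (ν k : ℝ) := Finset.sum_congr rfl fun k _ => mul_comm _ _
    have hn := one_le_nm hν
    rw [← h2] at h1
    change C₀ * nm ν ^ (-τ₀) ≤ _ at h1
    have h3 : nm ν ^ τ₀ ≤ nm ν ^ ⌈τ₀⌉₊ := by
      rw [← Real.rpow_natCast]; exact Real.rpow_le_rpow_of_exponent_le hn (Nat.le_ceil _)
    have h4 : 0 < nm ν ^ τ₀ := Real.rpow_pos_of_pos (by linarith) _
    rw [Real.rpow_neg (by linarith), ← div_eq_mul_inv, div_le_iff₀ h4] at h1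
    exact h1.trans (mul_le_mul_of_nonneg_left h3 (abs_nonneg _))
  · change Mn (gr (fun _ => Fc f) (.inr j)) 0 β₀ = 0
    rw [← e1, hcrit]; simp
  · have h1 := (hV k).apply_eq_smul
    have h2 : ∑ i, fderiv ℝ (fun β => fderiv ℝ f₀ β (Pi.single i 1)) β₀ (Pi.single j 1) * V k i = a k * V k j := congrFun h1 j
    have h3 : ∀ i, mean (cmp β₀ (dv (Pi.single (.inr i) 1) (gr (fun _ => Fc f) (.inr j))) (fun _ _ (_ : Fin r → ℝ) => 0)) 0 = ((fderiv ℝ (fun β => fderiv ℝ f₀ β (Pi.single i 1)) β₀ (Pi.single j 1) : ℝ) : ℂ) := fun i => by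
      rw [e2, Mn]; refine mean_congr fun ψ => ?_
      obtain ⟨B, -, hb⟩ := hB
      exact hb.dv_comm hρ rfl _ _ _
    simp only [h3]
    exact_mod_cast h2
  · have h1 := congrFun (congrFun (Matrix.mul_nonsing_inv _ hdet') k') k
    rw [Matrix.mul_apply, Matrix.one_apply] at h1
    simp only [Matrix.of_apply] at h1
    rw [show (if k = k' then (1:ℂ) else 0) = ((if k' = k then (1:ℝ) else 0 : ℝ) : ℂ) by by_cases h : k = k' <;> simp [h, eq_comm], ← h1]
    push_cast; exact Finset.sum_congr rfl fun b _ => mul_comm _ _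
end setup
end
section
section dens
lemma dens {P : ℝ → Prop} {K : ℝ≥0∞} {κ : ℝ} (hK : K ≠ ⊤) (hκ : 0 < κ)
    (h : ∀ b, 0 < b → √b ≤ κ → ∃ A ⊆ Set.Icc (b/4) b, IsClosed A ∧ volume (Set.Icc (b/4) b \ A) ≤ K * ENNReal.ofReal (b * √b) ∧ ∀ p ∈ A, P p) :
    ∃ (εbar : ℝ) (E : Set ℝ), 0 < εbar ∧ MeasurableSet E ∧ E ⊆ Set.Ioo 0 εbar ∧ (∀ ε ∈ E, P ε) ∧
      Tendsto (fun ε => (volume (E ∩ Set.Ioo 0 ε)).toReal / ε) (nhdsWithin 0 (Set.Ioi 0)) (nhds 1) := by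
  have hb : ∀ n : ℕ, √(κ ^ 2 * (1 / 4) ^ n) = κ * (1 / 2) ^ n := fun n => by
    rw [show κ ^ 2 * (1 / 4 : ℝ) ^ n = (κ * (1 / 2) ^ n) ^ 2 by rw [mul_pow, ← pow_mul, mul_comm n, pow_mul]; norm_num]
    exact Real.sqrt_sq (by positivity)
  choose A hA hAc hAv hAP using fun n : ℕ => h (κ ^ 2 * (1 / 4) ^ n) (by positivity) (by
    rw [hb]; exact mul_le_of_le_one_right hκ.le (pow_le_one₀ (by norm_num) (by norm_num)))
  refine ⟨κ ^ 2, (⋃ n, A n) ∩ Set.Ioo 0 (κ ^ 2), by positivity, (MeasurableSet.iUnion fun n => (hAc n).measurableSet).inter measurableSet_Ioo,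
    Set.inter_subset_right, fun ε hε => ?_, ?_⟩
  · obtain ⟨n, hn⟩ := Set.mem_iUnion.1 hε.1; exact hAP n _ hn
  set E := (⋃ n, A n) ∩ Set.Ioo 0 (κ ^ 2)
  have hEm : MeasurableSet E := (MeasurableSet.iUnion fun n => (hAc n).measurableSet).inter measurableSet_Ioo
  have key : ∀ ε, 0 < ε → ε < κ ^ 2 → (volume (Set.Ioo 0 ε \ E)).toReal ≤ 8 * K.toReal * κ * ε * √(4 * ε / κ ^ 2) := fun ε h0 h1 => by
    have hk2 : 0 < κ ^ 2 := by positivity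
    obtain ⟨n, hn1, hn2⟩ := exists_nat_pow_near_of_lt_one (x := ε / κ ^ 2) (y := (1 / 4 : ℝ)) (by positivity) ((div_le_one hk2).2 h1.le) (by norm_num) (by norm_num)
    have hsub : Set.Ioo 0 ε \ E ⊆ ⋃ l : ℕ, (Set.Icc (κ ^ 2 * (1 / 4) ^ (n + l) / 4) (κ ^ 2 * (1 / 4) ^ (n + l)) \ A (n + l)) := fun x hx => by
      obtain ⟨⟨hx0, hxε⟩, hxE⟩ := hx
      obtain ⟨m, hm1, hm2⟩ := exists_nat_pow_near_of_lt_one (x := x / κ ^ 2) (y := (1 / 4 : ℝ)) (by positivity) ((div_le_one hk2).2 (by linarith)) (by norm_num) (by norm_num)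
      have hmn : n < m + 1 := by
        refine (pow_lt_pow_iff_right_of_lt_one₀ (by norm_num : (0:ℝ) < 1 / 4) (by norm_num)).1 (hm1.trans (lt_of_lt_of_le ?_ hn2))
        gcongr
      obtain ⟨l, rfl⟩ := Nat.exists_eq_add_of_le (Nat.lt_succ_iff.1 hmn)
      rw [lt_div_iff₀ hk2, pow_succ] at hm1
      rw [div_le_iff₀ hk2] at hm2
      exact Set.mem_iUnion.2 ⟨l, ⟨by linarith, by linarith⟩, fun hxA => hxE ⟨Set.mem_iUnion.2 ⟨_, hxA⟩, hx0, by linarith⟩⟩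
    have hv : volume (Set.Ioo 0 ε \ E) ≤ K * ENNReal.ofReal (κ ^ 3 * (1 / 8) ^ n * (1 - 1 / 8)⁻¹) := by
      refine (measure_mono hsub).trans ((measure_iUnion_le _).trans ?_)
      refine (ENNReal.tsum_le_tsum fun l => hAv (n + l)).trans ?_
      rw [ENNReal.tsum_mul_left]
      refine mul_le_mul_right (le_of_eq ?_) _
      rw [← ENNReal.ofReal_tsum_of_nonneg (fun _ => by positivity)]
      · congr 1
        rw [← (hasSum_geometric_of_lt_one (by norm_num) (by norm_num : (1/8:ℝ) < 1)).tsum_eq, ← tsum_mul_left]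
        refine tsum_congr fun l => ?_
        rw [hb, show (1/8:ℝ) = 1/4 * (1/2) by norm_num, mul_pow, mul_pow, pow_add, pow_add]; ring
      · have := (hasSum_geometric_of_lt_one (by norm_num) (by norm_num : (1/8:ℝ) < 1)).summable.mul_left (κ ^ 3 * (1 / 8) ^ n)
        refine this.congr fun l => ?_
        rw [hb, show (1/8:ℝ) = 1/4 * (1/2) by norm_num, mul_pow, mul_pow, pow_add, pow_add]; ring
    have h2 := ENNReal.toReal_mono (by finiteness) hv
    rw [ENNReal.toReal_mul, ENNReal.toReal_ofReal (by positivity)] at h2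
    have h3 : (1 / 4 : ℝ) ^ n ≤ 4 * ε / κ ^ 2 := by rw [pow_succ] at hn1; rw [mul_div_assoc]; linarith
    have h4 : (1 / 2 : ℝ) ^ n ≤ √(4 * ε / κ ^ 2) := Real.le_sqrt_of_sq_le (by rw [← pow_mul, mul_comm n, pow_mul]; norm_num at h3 ⊢; linarith)
    have h5 : (1 / 8 : ℝ) ^ n ≤ 4 * ε / κ ^ 2 * √(4 * ε / κ ^ 2) := by
      rw [show (1/8:ℝ) = 1/4 * (1/2) by norm_num, mul_pow]; exact mul_le_mul h3 h4 (by positivity) (by positivity)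
    refine h2.trans ?_
    have h6 : κ ^ 3 * (1 / 8) ^ n * (1 - 1 / 8)⁻¹ ≤ κ ^ 3 * (4 * ε / κ ^ 2 * √(4 * ε / κ ^ 2)) * 2 := by
      refine mul_le_mul (mul_le_mul_of_nonneg_left h5 (by positivity)) (by norm_num) (by norm_num) (by positivity)
    refine (mul_le_mul_of_nonneg_left h6 ENNReal.toReal_nonneg).trans (le_of_eq ?_)
    field_simp; ring
  have hlim : Tendsto (fun ε : ℝ => 1 - 8 * K.toReal * κ * √(4 * ε / κ ^ 2)) (nhdsWithin 0 (Set.Ioi 0)) (nhds 1) := by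
    have : Continuous fun ε : ℝ => 1 - 8 * K.toReal * κ * √(4 * ε / κ ^ 2) := by fun_prop
    have := this.tendsto 0
    simp only [mul_zero, zero_div, Real.sqrt_zero, sub_zero] at this
    exact this.mono_left nhdsWithin_le_nhds
  refine tendsto_of_tendsto_of_tendsto_of_le_of_le' hlim tendsto_const_nhds ?_ ?_
  · filter_upwards [Ioo_mem_nhdsGT (show (0:ℝ) < κ ^ 2 by positivity)] with ε hε
    have h1 := key ε hε.1 hε.2
    have h2 : (volume (Set.Ioo 0 ε ∩ E)).toReal + (volume (Set.Ioo 0 ε \ E)).toReal = ε := by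
      rw [← ENNReal.toReal_add (measure_ne_top_of_subset Set.inter_subset_left (by simp)) (measure_ne_top_of_subset Set.sdiff_subset (by simp)),
        measure_inter_add_sdiff _ hEm]; simp [hε.1.le]
    rw [Set.inter_comm, le_div_iff₀ hε.1]
    linarith
  · filter_upwards [self_mem_nhdsWithin] with ε hε
    refine (div_le_one hε).2 ?_
    refine (ENNReal.toReal_mono (by simp) (measure_mono (Set.inter_subset_right (t := Set.Ioo 0 ε)))).trans ?_
    have hε : 0 < ε := hε
    simp [hε.le]
end dens
end
end KAM

theorem mixed_resonant_tori_exist (r s : ℕ) (hr : 1 ≤ r) (hs : 1 ≤ s)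
    (ω : Fin r → ℝ) (C₀ τ₀ : ℝ) (hC₀ : 0 < C₀) (hτ₀ : (r : ℝ) - 1 ≤ τ₀)
    (hdio : ∀ ν : Fin r → ℤ, ν ≠ 0 →
      C₀ * (∑ k, |(ν k : ℝ)|) ^ (-τ₀) ≤ |∑ k, ω k * (ν k : ℝ)|)
    (f : (Fin r → ℝ) × (Fin s → ℝ) → ℝ)
    (hfa : AnalyticOnNhd ℝ f Set.univ)
    (hper₁ : ∀ p : (Fin r → ℝ) × (Fin s → ℝ), ∀ i : Fin r,
      f (p.1 + Pi.single i (2 * π), p.2) = f p)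
    (hper₂ : ∀ p : (Fin r → ℝ) × (Fin s → ℝ), ∀ j : Fin s,
      f (p.1, p.2 + Pi.single j (2 * π)) = f p)
    (f₀ : (Fin s → ℝ) → ℝ)
    (hf₀ : ∀ β, f₀ β = ((2 * π) ^ r)⁻¹ *
      ∫ α in Set.univ.pi fun _ : Fin r => Set.Icc (0 : ℝ) (2 * π), f (α, β))
    (β₀ : Fin s → ℝ)
    (hcrit : fderiv ℝ f₀ β₀ = 0)
    (hdet : (Matrix.det fun i' j' : Fin s =>
      fderiv ℝ (fun β => fderiv ℝ f₀ β (Pi.single j' 1)) β₀ (Pi.single i' 1)) ≠ 0)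
    (a : Fin s → ℝ) (hne : ∀ i, a i ≠ 0) (hmono : StrictMono a)
    (heig : ∀ i, Module.End.HasEigenvalue
      (Matrix.toLin' fun i' j' : Fin s =>
        fderiv ℝ (fun β => fderiv ℝ f₀ β (Pi.single j' 1)) β₀ (Pi.single i' 1)) (a i)) :
    ∃ (εbar : ℝ) (E : Set ℝ), 0 < εbar ∧ MeasurableSet E ∧ E ⊆ Set.Ioo 0 εbar ∧
      (∀ ε ∈ E,
        ∃ (A : (Fin r → ℝ) → Fin r → ℝ) (B : (Fin r → ℝ) → Fin s → ℝ),
          AnalyticOnNhd ℝ A Set.univ ∧ AnalyticOnNhd ℝ B Set.univ ∧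
          (∀ ψ i, A (ψ + Pi.single i (2 * π)) = A ψ) ∧
          (∀ ψ i, B (ψ + Pi.single i (2 * π)) = B ψ) ∧
          (∀ ψ : Fin r → ℝ, ∀ t : ℝ,
            deriv (deriv fun u : ℝ => ψ + u • ω + A (ψ + u • ω)) t
              = (fun i => -ε * fderiv ℝ f
                  (ψ + t • ω + A (ψ + t • ω), β₀ + B (ψ + t • ω)) (Pi.single i 1, 0)) ∧
            deriv (deriv fun u : ℝ => β₀ + B (ψ + u • ω)) t
              = (fun j => -ε * fderiv ℝ f
                  (ψ + t • ω + A (ψ + t • ω), β₀ + B (ψ + t • ω)) (0, Pi.single j 1)))) ∧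
      Tendsto (fun ε => (volume (E ∩ Set.Ioo 0 ε)).toReal / ε)
        (nhdsWithin 0 (Set.Ioi 0)) (nhds 1) := by
  obtain ⟨R, τ, U, Z, H, hZ⟩ := KAM.setup hr ω C₀ τ₀ hC₀ hdio f hfa hper₁ hper₂ f₀ hf₀ β₀ hcrit a hmono heig
  obtain ⟨K, κ, hK, hκ, h⟩ := H.main hZ (fun k => by exact_mod_cast hne k) (fun i j hij => hmono.injective (by exact_mod_cast hij)) ⟨0, hr⟩
  have hfd : Differentiable ℝ f := fun x => (hfa x trivial).differentiableAt
  refine KAM.dens hK hκ fun b hb hbκ => ?_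
  obtain ⟨A, hA, hc, hv, hs⟩ := h b hb hbκ
  refine ⟨A, hA, hc, hv, fun p hp => ?_⟩
  obtain ⟨u, hu⟩ := hs p hp
  exact KAM.Sol.fin hfd H.hR (by linarith [(hA hp).1]) hu
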